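/- arXiv:1601.06807 — 2 statements merged into one kernel-verified Lean document; each statement's English description precedes it below -/
import Mathlib

section
/- Lemma (the decreasing interval covers the circle). For every f ∈ Bimod there exists an integer N ≥ 1 such that f^N(𝕀) = 𝕋¹. -/
open MeasureTheory Set Filter

noncomputable section

/-- Iterated fractional parts in the continued fraction algorithm:
`cfFrac ρ 0 = ρ - ⌊ρ⌋` and `cfFrac ρ (k+1) = 1/(cfFrac ρ k) - ⌊1/(cfFrac ρ k)⌋`. -/
noncomputable def cfFrac (ρ : ℝ) : ℕ → ℝ
  | 0 => Int.fract ρ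
  | n + 1 => Int.fract (1 / cfFrac ρ n)

/-- Partial quotients `a_k` of the continued fraction expansion of `ρ`. -/
noncomputable def cfA (ρ : ℝ) : ℕ → ℤ
  | 0 => ⌊ρ⌋
  | n + 1 => ⌊1 / cfFrac ρ n⌋

/-- Denominators `q_k` of the convergents of `ρ`:
`q_0 = 1`, `q_1 = a_1` (since `q_{-1} = 0`), `q_{k+1} = a_{k+1} q_k + q_{k-1}`. -/
noncomputable def cfQ (ρ : ℝ) : ℕ → ℕ
  | 0 => 1
  | 1 => (cfA ρ 1).toNat
  | n + 2 => (cfA ρ (n + 2)).toNat * cfQ ρ (n + 1) + cfQ ρ n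
/-- The class `Bimod` of degree one bimodal circle endomorphisms, given by the
circle map `f : 𝕋¹ → 𝕋¹` together with a lift `F : ℝ → ℝ` (`π ∘ F = f ∘ π`,
`F(x+1) = F(x)+1`), satisfying (A1) (`C²`, bimodal with non-flat critical points
`c̃⁺ < c̃⁻` of orders `ℓ⁺, ℓ⁻`), (A2) (the rotation numbers of the upper and lower
maps `F₊, F₋` are irrational) and (A3) (all periodic orbits are hyperbolic repelling). -/
structure BimodData where
  /-- the lift -/
  F : ℝ → ℝ
  /-- the circle endomorphism -/
  f : UnitAddCircle → UnitAddCircle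
  /-- lift of the critical point `c⁺` -/
  ctp : ℝ
  /-- lift of the critical point `c⁻` -/
  ctm : ℝ
  /-- `d̃⁺`, the second preimage of the critical value of `c⁺` -/
  dtp : ℝ
  /-- `d̃⁻`, the second preimage of the critical value of `c⁻` -/
  dtm : ℝ
  /-- the non-flatness order `ℓ⁺` -/
  lp : ℝ
  /-- the non-flatness order `ℓ⁻` -/
  lm : ℝ
  /-- the upper map `F₊` (a monotone degree one lift) -/
  Fp : CircleDeg1Lift
  /-- the lower map `F₋` (a monotone degree one lift) -/
  Fm : CircleDeg1Lift
  /-- the diffeomorphism `ψ⁺` -/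
  psip : ℝ → ℝ
  /-- the diffeomorphism `ψ⁻` -/
  psim : ℝ → ℝ
  hf : ∀ x : ℝ, f ((x : ℝ) : UnitAddCircle) = ((F x : ℝ) : UnitAddCircle)
  h0 : 0 < ctp
  h1 : ctp < ctm
  h2 : ctm < 1
  hlift : ∀ x, F (x + 1) = F x + 1
  hC2 : ContDiff ℝ 2 F
  hdecr : ∀ x ∈ Set.Ioo ctp ctm, deriv F x < 0
  hincr : ∀ x ∈ Set.Ioo ctm (ctp + 1), 0 < deriv F x
  hlp : 1 < lp
  hlm : 1 < lm
  hpsipC2 : ContDiff ℝ 2 psip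
  hpsipBij : Function.Bijective psip
  hpsipD : ∀ x, deriv psip x ≠ 0
  hpsip0 : psip ctp = 0
  hpsipEq : ∀ᶠ x in nhds ctp, F x = F ctp - |psip x| ^ lp
  hpsimC2 : ContDiff ℝ 2 psim
  hpsimBij : Function.Bijective psim
  hpsimD : ∀ x, deriv psim x ≠ 0
  hpsim0 : psim ctm = 0
  hpsimEq : ∀ᶠ x in nhds ctm, F x = F ctm + |psim x| ^ lm
  hdtp : dtp ∈ Set.Ioo ctm (ctp + 1)
  hdtpF : F dtp = F ctp
  hFp1 : ∀ x ∈ Set.Icc ctp dtp, Fp x = F ctp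
  hFp2 : ∀ x ∈ Set.Icc dtp (ctp + 1), Fp x = F x
  hdtm : dtm ∈ Set.Ioo (ctm - 1) ctp
  hdtmF : F dtm = F ctm
  hFm1 : ∀ x ∈ Set.Icc dtm ctm, Fm x = F ctm
  hFm2 : ∀ x ∈ Set.Icc ctm (dtm + 1), Fm x = F x
  hirrp : Irrational Fp.translationNumber
  hirrm : Irrational Fm.translationNumber
  hA3 : ∀ (x : ℝ) (n : ℕ), 1 ≤ n → (∃ m : ℤ, F^[n] x = x + (m : ℝ)) →
    1 < |deriv (F^[n]) x|

namespace BimodData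

/-- The critical point `c⁺ = π(c̃⁺)`. -/
noncomputable def cp (B : BimodData) : UnitAddCircle := ((B.ctp : ℝ) : UnitAddCircle)

/-- The critical point `c⁻ = π(c̃⁻)`. -/
noncomputable def cm (B : BimodData) : UnitAddCircle := ((B.ctm : ℝ) : UnitAddCircle)

/-- The interval `𝕀 = π([c̃⁺, c̃⁻])` on which `f` is decreasing. -/
def II (B : BimodData) : Set UnitAddCircle :=
  (fun x : ℝ => ((x : ℝ) : UnitAddCircle)) '' Set.Icc B.ctp B.ctm

/-- The upper rotation number `ρ⁺`. -/
noncomputable def rhop (B : BimodData) : ℝ := B.Fp.translationNumber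

/-- The lower rotation number `ρ⁻`. -/
noncomputable def rhom (B : BimodData) : ℝ := B.Fm.translationNumber

/-- Condition (C⁻): `Σ_{k≥0} q⁻_{2k+1} · d(f^{q⁻_{2k}}(c⁻), c⁻) < ∞`. -/
def CondCm (B : BimodData) : Prop :=
  Summable fun k : ℕ =>
    (cfQ B.rhom (2 * k + 1) : ℝ) * dist (B.f^[cfQ B.rhom (2 * k)] B.cm) B.cm

/-- Condition (C⁺): `Σ_{k≥1} q⁺_{2k} · d(f^{q⁺_{2k-1}}(c⁺), c⁺) < ∞`. -/
def CondCp (B : BimodData) : Prop :=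
  Summable fun k : ℕ =>
    (cfQ B.rhop (2 * k + 2) : ℝ) * dist (B.f^[cfQ B.rhop (2 * k + 1)] B.cp) B.cp

end BimodData

/-- Pairwise non-overlapping intervals of the circle have total length at most one. -/
theorem sum_length_le_one {ι : Type*} (S : Finset ι) (x y : ι → ℝ)
    (hxy : ∀ i ∈ S, x i ≤ y i)
    (hdisj : ∀ i ∈ S, ∀ j ∈ S, ∀ l : ℤ, (i ≠ j ∨ l ≠ 0) → y i ≤ x j + l ∨ y j + l ≤ x i) :
    ∑ i ∈ S, (y i - x i) ≤ 1 := by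
  by_contra! hlt
  have hmeas : volume (⋃ i ∈ S, Ioo (x i) (y i)) = ENNReal.ofReal (∑ i ∈ S, (y i - x i)) := by
    rw [measure_biUnion_finset]
    · simp only [Real.volume_Ioo]
      rw [ENNReal.ofReal_sum_of_nonneg]
      intro i hi
      linarith [hxy i hi]
    · intro i hi j hj hij
      refine Set.disjoint_left.2 fun z hz hz' => ?_
      rcases hdisj i hi j hj 0 (Or.inl hij) with h | h
      · push_cast at h
        linarith [hz.2, hz'.1]
      · push_cast at h
        linarith [hz.1, hz'.2]
    · intro i _
      exact measurableSet_Ioo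
  have hfund := isAddFundamentalDomain_Ioc (T := 1) one_pos 0
  obtain ⟨p, q, hpq, hnd⟩ := exists_pair_mem_lattice_not_disjoint_vadd hfund
    (s := ⋃ i ∈ S, Ioo (x i) (y i))
    ((Finset.measurableSet_biUnion _ fun i _ => measurableSet_Ioo).nullMeasurableSet) (by
      rw [hmeas, Real.volume_Ioc]
      refine (ENNReal.ofReal_lt_ofReal_iff (by linarith)).2 ?_
      linarith)
  obtain ⟨z, hz, hz'⟩ := Set.not_disjoint_iff.1 hnd
  obtain ⟨a, ha, rfl⟩ := hz
  obtain ⟨b, hb, hab⟩ := hz'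
  obtain ⟨m, hm⟩ := AddSubgroup.mem_zmultiples_iff.1 p.2
  obtain ⟨n, hn⟩ := AddSubgroup.mem_zmultiples_iff.1 q.2
  simp only [AddSubgroup.vadd_def, vadd_eq_add, zsmul_eq_mul, mul_one] at hab hm hn
  obtain ⟨i, hi, hai⟩ := Set.mem_iUnion₂.1 ha
  obtain ⟨j, hj, hbj⟩ := Set.mem_iUnion₂.1 hb
  have hmn : n - m ≠ 0 := by
    intro h
    apply hpq
    ext
    rw [← hm, ← hn, sub_eq_zero.1 h]
  have hcast : ((n - m : ℤ) : ℝ) = (n : ℝ) - m := by push_cast; ring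
  rcases hdisj i hi j hj (n - m) (Or.inr hmn) with h | h
  · rw [hcast] at h
    linarith [hai.2, hbj.1]
  · rw [hcast] at h
    linarith [hai.1, hbj.2]

/-- A nontrivial integer combination of an irrational number and `1` does not vanish. -/
theorem Irrational.int_mul_sub_int_ne_zero {ρ : ℝ} (hρ : Irrational ρ) {j : ℤ} (hj : j ≠ 0)
    (l : ℤ) : (j : ℝ) * ρ - l ≠ 0 := by
  have := (hρ.intCast_mul hj).ne_int l
  exact sub_ne_zero.2 this

theorem exists_nat_int_abs_mul_sub_lt (ρ : ℝ) {ε : ℝ} (hε : 0 < ε) :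
    ∃ (k : ℕ) (l : ℤ), 0 < k ∧ |(k : ℝ) * ρ - l| < ε := by
  obtain ⟨n, hn⟩ := exists_nat_one_div_lt hε
  obtain ⟨k, hk, -, h⟩ := Real.exists_nat_abs_mul_sub_round_le ρ (Nat.succ_pos n)
  refine ⟨k, round (k * ρ), hk, h.trans_lt (lt_of_le_of_lt ?_ hn)⟩
  apply one_div_le_one_div_of_le (by positivity)
  push_cast
  linarith

/-- Positive multiples of an irrational number approach integers from above. -/
theorem Irrational.exists_mul_sub_int_mem_Ioo {ρ : ℝ} (hρ : Irrational ρ) {ε : ℝ} (hε : 0 < ε) :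
    ∃ (k : ℕ) (l : ℤ), 0 < k ∧ 0 < (k : ℝ) * ρ - l ∧ (k : ℝ) * ρ - l < ε := by
  obtain ⟨k, l, hk, h⟩ := exists_nat_int_abs_mul_sub_lt ρ (lt_min hε one_pos)
  have hne : (k : ℝ) * ρ - l ≠ 0 := by
    simpa using hρ.int_mul_sub_int_ne_zero (j := k) (by exact_mod_cast hk.ne') l
  have h_lt := h.trans_le (min_le_left _ _)
  have h1 := h.trans_le (min_le_right _ _)
  rcases lt_or_gt_of_ne hne with hneg | hpos
  · rw [abs_of_neg hneg] at h_lt h1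
    set x := -((k : ℝ) * ρ - l) with hx
    have hx0 : 0 < x := by linarith
    have hle : (⌊1 / x⌋₊ : ℝ) * x ≤ 1 := by
      have := Nat.floor_le (one_div_pos.2 hx0).le
      calc (⌊1 / x⌋₊ : ℝ) * x ≤ 1 / x * x := by gcongr
        _ = 1 := by field_simp
    have hgt : 1 < (⌊1 / x⌋₊ : ℝ) * x + x := by
      have := Nat.lt_floor_add_one (1 / x)
      calc 1 = 1 / x * x := by field_simp
        _ < (⌊1 / x⌋₊ + 1) * x := by gcongr
        _ = _ := by ring
    have ht : 0 < ⌊1 / x⌋₊ := by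
      rw [Nat.floor_pos, le_div_iff₀ hx0]
      linarith
    have hk' : 0 < ⌊1 / x⌋₊ * k := Nat.mul_pos ht hk
    have hne' := hρ.int_mul_sub_int_ne_zero (j := (⌊1 / x⌋₊ * k : ℕ))
      (by exact_mod_cast hk'.ne') (⌊1 / x⌋₊ * l - 1 : ℤ)
    have hval : ((⌊1 / x⌋₊ * k : ℕ) : ℝ) * ρ - ((⌊1 / x⌋₊ * l - 1 : ℤ) : ℝ)
        = 1 - (⌊1 / x⌋₊ : ℝ) * x := by
      rw [hx]; push_cast; ring
    refine ⟨⌊1 / x⌋₊ * k, ⌊1 / x⌋₊ * l - 1, hk', ?_, ?_⟩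
    · refine lt_of_le_of_ne ?_ (Ne.symm (by exact_mod_cast hne'))
      rw [hval]; linarith
    · rw [hval]; linarith
  · rw [abs_of_pos hpos] at h_lt
    exact ⟨k, l, hk, hpos, h_lt⟩

/-- Positive multiples of an irrational number approach integers from below. -/
theorem Irrational.exists_int_sub_mul_mem_Ioo {ρ : ℝ} (hρ : Irrational ρ) {ε : ℝ} (hε : 0 < ε) :
    ∃ (k : ℕ) (l : ℤ), 0 < k ∧ 0 < (l : ℝ) - k * ρ ∧ (l : ℝ) - k * ρ < ε := by
  obtain ⟨k, l, hk, h1, h2⟩ := hρ.neg.exists_mul_sub_int_mem_Ioo hε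
  refine ⟨k, -l, hk, ?_, ?_⟩ <;> push_cast <;> linarith

/-- There are arbitrarily large times of best approximation of an irrational number. -/
theorem Irrational.exists_best_approximation {ρ : ℝ} (hρ : Irrational ρ) (N : ℕ) :
    ∃ (q : ℕ) (p : ℤ), N < q ∧ ∀ j l : ℤ, |j| < q → (j ≠ 0 ∨ l ≠ 0) →
      |(q : ℝ) * ρ - p| < |(j : ℝ) * ρ - l| := by
  classical
  have hε : ∃ ε : ℝ, 0 < ε ∧ ε ≤ 1 ∧
      ∀ j : ℕ, 0 < j → j ≤ N → ∀ l : ℤ, ε ≤ |(j : ℝ) * ρ - l| := by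
    induction N with
    | zero => exact ⟨1, one_pos, le_rfl, fun j h h' => by omega⟩
    | succ N ih =>
      obtain ⟨ε, h0, h1, h⟩ := ih
      have hne : ((N + 1 : ℕ) : ℝ) * ρ - round (((N + 1 : ℕ) : ℝ) * ρ) ≠ 0 := by
        simpa using hρ.int_mul_sub_int_ne_zero (j := (N + 1 : ℕ)) (by positivity)
          (round (((N + 1 : ℕ) : ℝ) * ρ))
      refine ⟨min ε |((N + 1 : ℕ) : ℝ) * ρ - round (((N + 1 : ℕ) : ℝ) * ρ)|,
        lt_min h0 (abs_pos.2 hne), (min_le_left _ _).trans h1, fun j hj hjN l => ?_⟩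
      rcases Nat.lt_or_ge N j with hlt | hge
      · obtain rfl : j = N + 1 := by omega
        exact (min_le_right _ _).trans (round_le _ _)
      · exact (min_le_left _ _).trans (h j hj hge l)
  obtain ⟨ε, h0, h1, h⟩ := hε
  have hex : ∃ q : ℕ, 0 < q ∧ ∃ p : ℤ, |(q : ℝ) * ρ - p| < ε := by
    obtain ⟨k, l, hk, hkl⟩ := exists_nat_int_abs_mul_sub_lt ρ h0
    exact ⟨k, hk, l, hkl⟩
  obtain ⟨hq, p, hp⟩ := Nat.find_spec hex
  refine ⟨Nat.find hex, p, ?_, fun j l hj hjl => hp.trans_le ?_⟩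
  · by_contra! hle
    exact (h _ hq hle p).not_gt hp
  · have key : ∀ (i : ℕ) (m : ℤ), 0 < i → i < Nat.find hex → ε ≤ |(i : ℝ) * ρ - m| := by
      intro i m hi hlt
      by_contra! hcon
      exact Nat.find_min hex hlt ⟨hi, m, hcon⟩
    have hj' : j.natAbs < Nat.find hex := by
      rw [Int.abs_eq_natAbs] at hj
      exact_mod_cast hj
    rcases lt_trichotomy j 0 with hneg | rfl | hpos
    · have := key j.natAbs (-l) (by omega) hj'
      have hc : ((j.natAbs : ℕ) : ℝ) = -(j : ℝ) := by
        rw [Nat.cast_natAbs, Int.cast_abs, abs_of_neg (by exact_mod_cast hneg)]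
      rw [hc] at this
      rwa [← abs_neg, show -((j : ℝ) * ρ - l) = -(j : ℝ) * ρ - ((-l : ℤ) : ℝ) by push_cast; ring]
    · have hl : l ≠ 0 := by simpa using hjl
      have : (1 : ℝ) ≤ |(l : ℝ)| := by exact_mod_cast Int.one_le_abs hl
      simpa using h1.trans this
    · have := key j.natAbs l (by omega) hj'
      have hc : ((j.natAbs : ℕ) : ℝ) = (j : ℝ) := by
        rw [Nat.cast_natAbs, Int.cast_abs, abs_of_pos (by exact_mod_cast hpos)]
      rwa [hc] at this

/-- The gaps between an orbit of intervals ordered like a rotation orbit and its translate by a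
time of best approximation do not overlap. -/
theorem sum_gap_le_one {ρ : ℝ} {u v : ℤ → ℝ} (huv : ∀ k, u k < v k)
    (hord : ∀ j k m : ℤ, (j : ℝ) * ρ + m < k * ρ → v j + m ≤ u k)
    {q p : ℤ} (hpos : 0 < (q : ℝ) * ρ - p)
    (hbest : ∀ j l : ℤ, |j| < |q| → (j ≠ 0 ∨ l ≠ 0) → (q : ℝ) * ρ - p < |(j : ℝ) * ρ - l|)
    (S : Finset ℤ) (hS : ∀ i ∈ S, ∀ j ∈ S, |i - j| < |q|) :
    ∑ i ∈ S, (v i - (u (i - q) + p)) ≤ 1 := by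
  refine sum_length_le_one S (fun i => u (i - q) + p) v (fun i _ => ?_) fun i hi j hj l hl => ?_
  · have := hord (i - q) i p (by push_cast; linarith)
    linarith [huv (i - q), huv i]
  · have h := hbest (i - j) l (hS i hi j hj) (by simpa [sub_ne_zero] using hl)
    push_cast at h
    rcases lt_abs.1 h with h | h
    · right
      have := hord j (i - q) (l - p) (by push_cast; linarith)
      push_cast at this
      linarith
    · left
      have := hord i (j - q) (-(p + l)) (by push_cast; linarith)
      push_cast at this
      linarith

/-- **Denjoy's argument**: a wandering orbit of intervals ordered like an irrational rotation orbit
is incompatible with a Lipschitz bound on the logarithms of the scaling ratios. -/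
theorem false_of_wandering_orbit {ρ : ℝ} (hρ : Irrational ρ) {u v s ξ : ℤ → ℝ} {C L : ℝ}
    (huv : ∀ k, u k < v k)
    (hord : ∀ j k m : ℤ, (j : ℝ) * ρ + m < k * ρ → v j + m ≤ u k)
    (hscale : ∀ k, v (k + 1) - u (k + 1) = Real.exp (s k) * (v k - u k))
    (hξ : ∀ k, ξ k ∈ Icc (u k) (v k))
    (hC : ∀ k, |s k| ≤ C) (hL0 : 0 ≤ L)
    (hL : ∀ j k m : ℤ, j ≠ 0 → k ≠ 0 → |s j - s k| ≤ L * |ξ j - ξ k - m|) : False := by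
  have hlen_pos : ∀ k, 0 < v k - u k := fun k => sub_pos.2 (huv k)
  have hlen_le : ∀ k, v k - u k ≤ 1 := by
    intro k
    have := hord k k (-1) (by push_cast; linarith)
    push_cast at this
    linarith
  have hsum : ∀ n : ℕ, ∑ i ∈ Finset.range n, (v (i : ℤ) - u (i : ℤ)) ≤ 1 := by
    intro n
    refine sum_length_le_one _ (fun i : ℕ => u i) (fun i : ℕ => v i)
      (fun i _ => (huv i).le) fun i _ j _ l hl => ?_
    have hne : ((i : ℤ) : ℝ) * ρ - ((j : ℤ) * ρ + l) ≠ 0 := by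
      rcases eq_or_ne i j with rfl | hij
      · have hl' : l ≠ 0 := by simpa using hl
        simpa using hl'
      · have := hρ.int_mul_sub_int_ne_zero (j := (i : ℤ) - j)
          (sub_ne_zero.2 (by exact_mod_cast hij)) l
        intro h0
        apply this
        push_cast at h0 ⊢
        linarith
    rcases lt_or_gt_of_ne hne with h | h
    · left
      have := hord i j (-l) (by push_cast at h ⊢; linarith)
      push_cast at this
      linarith
    · right
      exact hord j i l (by linarith)
  have htend : Tendsto (fun n : ℕ => v (n : ℤ) - u (n : ℤ)) atTop (nhds 0) :=
    (summable_of_sum_range_le (fun n => (hlen_pos n).le) hsum).tendsto_atTop_zero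
  set V := 2 * C + L with hV
  have hδ : 0 < Real.exp (-V) * (v 0 - u 0) ^ 2 := by
    have := hlen_pos 0
    positivity
  obtain ⟨N, hN⟩ := eventually_atTop.1 (htend.eventually (gt_mem_nhds hδ))
  obtain ⟨q, p, hqN, hbest⟩ := hρ.exists_best_approximation N
  have hq0 : 0 < q := by omega
  have hfwd : ∀ (k : ℤ) (n : ℕ), v (k + n) - u (k + n) =
      Real.exp (∑ i ∈ Finset.range n, s (k + i)) * (v k - u k) := by
    intro k n
    induction n with
    | zero => simp
    | succ n ih =>
      have := hscale (k + n)
      rw [Finset.sum_range_succ, add_comm (∑ i ∈ Finset.range n, s (k + i)), Real.exp_add, mul_assoc,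
        ← ih, ← this]
      push_cast
      rw [add_assoc]
  have hq1 := hfwd 0 q
  have hq2 := hfwd (-q) q
  rw [neg_add_cancel] at hq2
  simp only [zero_add] at hq1
  have hgap : ∑ i ∈ Finset.Ico 1 q, |ξ (i : ℤ) - ξ (i - q : ℤ) - p| ≤ 1 := by
    have hne : (q : ℝ) * ρ - p ≠ 0 := by
      simpa using hρ.int_mul_sub_int_ne_zero (j := q) (by exact_mod_cast hq0.ne') p
    rcases lt_or_gt_of_ne hne with hneg | hpos
    · rw [abs_of_neg hneg] at hbest
      have h := sum_gap_le_one (q := -q) (p := -p) huv hord (by push_cast; linarith)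
        (fun j l hj hl => by
          have := hbest j l (by simpa using hj) hl
          push_cast
          linarith)
        ((Finset.Ico 1 q).image fun i : ℕ => (i : ℤ) - q) (by
          intro i hi j hj
          simp only [Finset.mem_image, Finset.mem_Ico] at hi hj
          obtain ⟨a, ha, rfl⟩ := hi
          obtain ⟨b, hb, rfl⟩ := hj
          rw [abs_neg, Nat.abs_cast, abs_lt]
          constructor <;> omega)
      rw [Finset.sum_image (by intro a _ b _ hab; simpa using hab)] at h
      refine le_trans (Finset.sum_le_sum fun i hi => ?_) h
      have h1 := hord i (i - q) (-p) (by push_cast; linarith)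
      have h2 := hξ i
      have h3 := hξ (i - q)
      simp only [sub_neg_eq_add, sub_add_cancel]
      push_cast at h1 ⊢
      rw [abs_le]
      constructor <;> linarith [h2.1, h2.2, h3.1, h3.2, huv i, huv (i - q)]
    · rw [abs_of_pos hpos] at hbest
      have h := sum_gap_le_one (q := q) (p := p) huv hord (by push_cast; linarith)
        (fun j l hj hl => by
          have := hbest j l (by simpa using hj) hl
          push_cast
          linarith)
        ((Finset.Ico 1 q).image fun i : ℕ => (i : ℤ)) (by
          intro i hi j hj
          simp only [Finset.mem_image, Finset.mem_Ico] at hi hj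
          obtain ⟨a, ha, rfl⟩ := hi
          obtain ⟨b, hb, rfl⟩ := hj
          rw [Nat.abs_cast, abs_lt]
          constructor <;> omega)
      rw [Finset.sum_image (by intro a _ b _ hab; simpa using hab)] at h
      refine le_trans (Finset.sum_le_sum fun i hi => ?_) h
      have h1 := hord (i - q) i p (by push_cast; linarith)
      have h2 := hξ i
      have h3 := hξ (i - q)
      rw [abs_le]
      constructor <;> linarith [h2.1, h2.2, h3.1, h3.2, huv i, huv (i - q)]
  have hdist : |∑ i ∈ Finset.range q, (s (i : ℤ) - s (-q + i : ℤ))| ≤ V := by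
    refine (Finset.abs_sum_le_sum_abs _ _).trans ?_
    rw [Finset.range_eq_Ico, ← Finset.add_sum_Ioo_eq_sum_Ico hq0]
    have h0 : |s ((0 : ℕ) : ℤ) - s (-q + (0 : ℕ) : ℤ)| ≤ 2 * C := by
      refine (abs_sub _ _).trans ?_
      linarith [hC ((0 : ℕ) : ℤ), hC (-q + (0 : ℕ) : ℤ)]
    have h1 : ∑ i ∈ Finset.Ioo 0 q, |s (i : ℤ) - s (-q + i : ℤ)| ≤ L := by
      calc ∑ i ∈ Finset.Ioo 0 q, |s (i : ℤ) - s (-q + i : ℤ)|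
          ≤ ∑ i ∈ Finset.Ico 1 q, L * |ξ (i : ℤ) - ξ (i - q : ℤ) - p| := by
            refine Finset.sum_le_sum fun i hi => ?_
            have hi' := Finset.mem_Ico.1 hi
            rw [show (-q + i : ℤ) = i - q by ring]
            exact hL _ _ _ (by omega) (by omega)
        _ = L * ∑ i ∈ Finset.Ico 1 q, |ξ (i : ℤ) - ξ (i - q : ℤ) - p| := by
            rw [Finset.mul_sum]
        _ ≤ L * 1 := by gcongr
        _ = L := mul_one L
    linarith
  have hprod : Real.exp (-V) * (v 0 - u 0) ^ 2 ≤ (v q - u q) * (v (-q) - u (-q)) := by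
    rw [Finset.sum_sub_distrib] at hdist
    set A := ∑ i ∈ Finset.range q, s (i : ℤ)
    set B := ∑ i ∈ Finset.range q, s (-q + i : ℤ)
    have hAB : -V ≤ A - B := (abs_le.1 hdist).1
    have hB : v (-q) - u (-q) = Real.exp (-B) * (v 0 - u 0) := by
      rw [hq2, ← mul_assoc, ← Real.exp_add]
      simp
    rw [hq1, hB]
    calc Real.exp (-V) * (v 0 - u 0) ^ 2 ≤ Real.exp (A - B) * (v 0 - u 0) ^ 2 := by gcongr
      _ = _ := by rw [sub_eq_add_neg, Real.exp_add]; ring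
  have hsmall := hN q hqN.le
  have : (v q - u q) * (v (-q) - u (-q)) ≤ v q - u q :=
    mul_le_of_le_one_right (hlen_pos q).le (hlen_le _)
  linarith

/-- Every point has a bi-infinite orbit under a surjective map. -/
theorem Function.Surjective.exists_int_orbit {α : Type*} {g : α → α} (hg : Function.Surjective g)
    (a : α) : ∃ u : ℤ → α, u 0 = a ∧ ∀ k, u (k + 1) = g (u k) := by
  obtain ⟨t, ht⟩ := hg.hasRightInverse
  refine ⟨fun k => if 0 ≤ k then g^[k.toNat] a else t^[(-k).toNat] a, by simp, fun k => ?_⟩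
  rcases lt_trichotomy k (-1) with h | rfl | h
  · have h1 : ¬ 0 ≤ k + 1 := by omega
    have h2 : ¬ 0 ≤ k := by omega
    have h3 : (-k).toNat = (-(k + 1)).toNat + 1 := by omega
    simp only [h1, h2, if_false, h3, Function.iterate_succ_apply']
    exact (ht _).symm
  · simpa using (ht a).symm
  · have h1 : 0 ≤ k + 1 := by omega
    have h2 : 0 ≤ k := by omega
    have h3 : (k + 1).toNat = k.toNat + 1 := by omega
    simp only [h1, h2, if_true, h3, Function.iterate_succ_apply']

namespace CircleDeg1Lift

theorem pow_lt_add_int (f : CircleDeg1Lift) {n : ℕ} {m : ℤ} (h : n * f.translationNumber < m)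
    (x : ℝ) : (f ^ n) x < x + m :=
  (f ^ n).map_lt_of_translationNumber_lt_int (by rwa [translationNumber_pow]) x

theorem add_int_lt_pow (f : CircleDeg1Lift) {n : ℕ} {m : ℤ} (h : m < n * f.translationNumber)
    (x : ℝ) : x + m < (f ^ n) x :=
  (f ^ n).lt_map_of_int_lt_translationNumber (by rwa [translationNumber_pow]) x

theorem pow_apply_eq_of_apply_eq (f : CircleDeg1Lift) {x y : ℝ} (h : f x = f y) {n : ℕ}
    (hn : 0 < n) : (f ^ n) x = (f ^ n) y := by
  obtain ⟨n, rfl⟩ := Nat.exists_eq_succ_of_ne_zero hn.ne'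
  simp only [pow_succ, mul_apply, h]

/-- If `F` and `f` agree off a plateau of `f`, the `F`-orbit of a point of the plateau with the
right image is its `f`-orbit, because an irrational translation number forbids returns. -/
theorem iterate_eq_pow_of_plateau (f : CircleDeg1Lift) (hirr : Irrational f.translationNumber)
    {F : ℝ → ℝ} (hF : ∀ (x : ℝ) (m : ℤ), F (x + m) = F x + m) {a b c : ℝ} (hc : c ∈ Icc a b)
    (hconst : ∀ x ∈ Icc a b, f x = F c) (heq : ∀ x ∈ Icc b (a + 1), f x = F x) (n : ℕ) :
    F^[n] c = (f ^ n) c := by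
  induction n with
  | zero => rfl
  | succ n ih =>
    rw [Function.iterate_succ_apply', ih, pow_succ', mul_apply]
    rcases Nat.eq_zero_or_pos n with rfl | hn
    · exact (hconst c hc).symm
    obtain ⟨m, hm, -⟩ := existsUnique_sub_zsmul_mem_Ico (one_pos : (0 : ℝ) < 1) ((f ^ n) c) a
    simp only [zsmul_eq_mul, mul_one] at hm
    rcases le_or_gt b ((f ^ n) c - m) with hb | hb
    · have h1 := hF ((f ^ n) c - m) m
      rw [sub_add_cancel, ← heq _ ⟨hb, hm.2.le⟩] at h1
      simpa using h1
    · exfalso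
      have h1 : (f ^ n) (f c) = f c + m := by
        rw [← mul_apply, ← pow_succ, pow_succ', mul_apply, hconst c hc,
          ← hconst _ ⟨hm.1, hb.le⟩]
        simp
      have h2 := f.translationNumber_of_map_pow_eq_add_int h1 hn
      exact hirr ⟨(m : ℚ) / n, by rw [h2]; push_cast; rfl⟩

section Plateaus

variable {f g : CircleDeg1Lift} {a b c d : ℝ}

/-- If two ordered maps share an irrational translation number, the forward orbit under the lower
map of its plateau cannot enter from the left the plateau of the upper map. -/
theorem add_int_le_pow_of_plateau (hfg : f ≤ g) (hτ : f.translationNumber = g.translationNumber)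
    (hirr : Irrational f.translationNumber) (hf : f a = f d) (hg : g b = g c) (hc : c ≤ d)
    {n : ℕ} (hn : 0 < n) {m : ℤ} (h : m < n * f.translationNumber) : b + m ≤ (f ^ n) a := by
  by_contra! hlt
  obtain ⟨k, l, hk, h1, h2⟩ := hirr.exists_int_sub_mul_mem_Ioo (sub_pos.2 h)
  have e1 : d + (l + m : ℤ) < (f ^ k) ((f ^ n) a) := by
    rw [f.pow_apply_eq_of_apply_eq hf hn, ← mul_apply, ← pow_add]
    apply f.add_int_lt_pow
    push_cast
    linarith
  have e2 : (f ^ k) ((f ^ n) a) ≤ (g ^ k) (b + m) :=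
    (pow_mono hfg k _).trans ((g ^ k).monotone hlt.le)
  have e3 : (g ^ k) b < c + l := by
    rw [g.pow_apply_eq_of_apply_eq hg hk]
    exact g.pow_lt_add_int (by rw [← hτ]; linarith) c
  rw [map_add_int] at e2
  push_cast at e1
  linarith

/-- If two ordered maps share an irrational translation number, the forward orbit under the upper
map of its plateau cannot enter from the right the plateau of the lower map. -/
theorem pow_le_add_int_of_plateau (hfg : f ≤ g) (hτ : f.translationNumber = g.translationNumber)
    (hirr : Irrational f.translationNumber) (hf : f a = f d) (hg : g b = g c) (hc : c ≤ d)
    {n : ℕ} (hn : 0 < n) {m : ℤ} (h : n * f.translationNumber < m) : (g ^ n) b ≤ a + m := by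
  by_contra! hlt
  obtain ⟨k, l, hk, h1, h2⟩ := hirr.exists_mul_sub_int_mem_Ioo (sub_pos.2 h)
  have e1 : (g ^ k) ((g ^ n) b) < c + (l + m : ℤ) := by
    rw [g.pow_apply_eq_of_apply_eq hg hn, ← mul_apply, ← pow_add]
    apply g.pow_lt_add_int
    rw [← hτ]
    push_cast
    linarith
  have e2 : (f ^ k) (a + m) ≤ (g ^ k) ((g ^ n) b) :=
    ((f ^ k).monotone hlt.le).trans (pow_mono hfg k _)
  have e3 : d + l < (f ^ k) a := by
    rw [f.pow_apply_eq_of_apply_eq hf hk]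
    exact f.add_int_lt_pow (by linarith) d
  rw [map_add_int] at e2
  push_cast at e1
  linarith

/-- Two ordered maps with a common irrational translation number and overlapping plateaus spanning
`[a, b]` give a bi-infinite orbit of intervals through `[a, b]`, ordered like a rotation orbit. -/
theorem exists_wandering_orbit (hfg : f ≤ g) (hτ : f.translationNumber = g.translationNumber)
    (hirr : Irrational f.translationNumber) (hf : f a = f d) (hg : g b = g c) (hc : c ≤ d)
    (hsurj : Function.Surjective f) (hab : a < b) (hba : b ≤ a + 1) (hfab : f a < f b)
    (hmono : StrictMonoOn f (Icc b (a + 1))) :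
    ∃ u v : ℤ → ℝ, u 0 = a ∧ v 0 = b ∧ (∀ k, u (k + 1) = f (u k)) ∧ (∀ k, v (k + 1) = f (v k)) ∧
      (∀ k, u k < v k) ∧
      ∀ j k m : ℤ, (j : ℝ) * f.translationNumber + m < k * f.translationNumber →
        v j + m ≤ u k := by
  set ρ := f.translationNumber with hρ
  obtain ⟨u, hu0, hu⟩ := hsurj.exists_int_orbit a
  obtain ⟨v, hv0, hv⟩ := hsurj.exists_int_orbit b
  have hun : ∀ (k : ℤ) (n : ℕ), u (k + n) = (f ^ n) (u k) := by
    intro k n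
    induction n with
    | zero => simp
    | succ n ih => rw [pow_succ', mul_apply, ← ih, ← hu]; push_cast; rw [add_assoc]
  have hvn : ∀ (k : ℤ) (n : ℕ), v (k + n) = (f ^ n) (v k) := by
    intro k n
    induction n with
    | zero => simp
    | succ n ih => rw [pow_succ', mul_apply, ← ih, ← hv]; push_cast; rw [add_assoc]
  have hnat : ∀ (j k : ℕ) (m : ℤ), (j : ℝ) * ρ + m < k * ρ → v j + m ≤ u k := by
    intro j k m h
    rcases lt_trichotomy j k with hjk | rfl | hjk
    · obtain ⟨n, rfl⟩ := Nat.exists_eq_add_of_lt hjk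
      have h1 : b + m ≤ (f ^ (n + 1)) a :=
        add_int_le_pow_of_plateau hfg hτ hirr hf hg hc n.succ_pos (by push_cast at h ⊢; linarith)
      have h2 := (f ^ j).monotone h1
      rw [map_add_int, ← mul_apply, ← pow_add] at h2
      have h3 := hun 0 (j + (n + 1))
      have h4 := hvn 0 j
      rw [zero_add, hu0] at h3
      rw [zero_add, hv0] at h4
      rw [h4, add_assoc, h3]
      exact h2
    · have hm : m < 0 := by
        have : (m : ℝ) < 0 := by linarith
        exact_mod_cast this
      have hm' : (m : ℝ) ≤ -1 := by exact_mod_cast Int.le_sub_one_of_lt hm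
      have h2 := (f ^ j).monotone hba
      rw [map_add_one] at h2
      have h3 := hun 0 j
      have h4 := hvn 0 j
      rw [zero_add, hu0] at h3
      rw [zero_add, hv0] at h4
      rw [h3, h4]
      linarith
    · obtain ⟨n, rfl⟩ := Nat.exists_eq_add_of_lt hjk
      have h1 : (g ^ (n + 1)) b ≤ a + (-m : ℤ) :=
        pow_le_add_int_of_plateau hfg hτ hirr hf hg hc n.succ_pos (by push_cast at h ⊢; linarith)
      have h2 := (f ^ k).monotone ((pow_mono hfg (n + 1) b).trans h1)
      rw [map_add_int, ← mul_apply, ← pow_add] at h2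
      have h3 := hun 0 k
      have h4 := hvn 0 (k + (n + 1))
      rw [zero_add, hu0] at h3
      rw [zero_add, hv0] at h4
      rw [h3, add_assoc, h4]
      push_cast at h2
      linarith
  have hlt_nat : ∀ n : ℕ, u n < v n := by
    intro n
    induction n with
    | zero => simpa [hu0, hv0] using hab
    | succ n ih =>
      push_cast
      rw [hu, hv]
      rcases Nat.eq_zero_or_pos n with rfl | hn
      · simpa [hu0, hv0] using hfab
      · have hne : (n : ℝ) * ρ ≠ ⌊(n : ℝ) * ρ⌋ := by
          refine sub_ne_zero.1 ?_
          simpa using hirr.int_mul_sub_int_ne_zero (j := n) (by exact_mod_cast hn.ne') ⌊(n : ℝ) * ρ⌋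
        have hfl := lt_of_le_of_ne (Int.floor_le ((n : ℝ) * ρ)) hne.symm
        have hfl' := Int.lt_floor_add_one ((n : ℝ) * ρ)
        have h1 := hnat 0 n ⌊(n : ℝ) * ρ⌋ (by simpa using hfl)
        have h2 := hnat n 0 (-(⌊(n : ℝ) * ρ⌋ + 1)) (by push_cast; linarith)
        push_cast at h1 h2
        rw [hv0] at h1
        rw [hu0] at h2
        have := hmono (a := u n - ⌊(n : ℝ) * ρ⌋) (b := v n - ⌊(n : ℝ) * ρ⌋)
          ⟨by linarith, by linarith⟩ ⟨by linarith, by linarith⟩ (by linarith)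
        rw [map_sub_int, map_sub_int] at this
        linarith
  have hstrict : ∀ (j k : ℕ) (m : ℤ), (j : ℝ) * ρ + m < k * ρ → v j + m < u k := by
    intro j k m h
    obtain ⟨i, l, -, h1, h2⟩ := hirr.exists_mul_sub_int_mem_Ioo (sub_pos.2 h)
    have e1 := hnat j (j + i) l (by push_cast; linarith)
    have e2 := hnat (j + i) k (m - l) (by push_cast; linarith)
    have e3 := hlt_nat (j + i)
    push_cast at e1 e2 e3
    linarith
  refine ⟨u, v, hu0, hv0, hu, hv, fun k => ?_, fun j k m h => ?_⟩
  · by_contra! hle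
    have h1 := (f ^ k.natAbs).monotone hle
    rw [← hun, ← hvn] at h1
    have h2 : k + k.natAbs = ((k + k.natAbs).toNat : ℕ) := by omega
    rw [h2] at h1
    exact h1.not_gt (hlt_nat _)
  · by_contra! hlt
    have h1 := (f ^ (j.natAbs + k.natAbs)).monotone hlt.le
    rw [map_add_int, ← hun, ← hvn] at h1
    have h2 : k + (j.natAbs + k.natAbs : ℕ) = ((k + (j.natAbs + k.natAbs : ℕ)).toNat : ℕ) := by
      omega
    have h3 : j + (j.natAbs + k.natAbs : ℕ) = ((j + (j.natAbs + k.natAbs : ℕ)).toNat : ℕ) := by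
      omega
    have h4 := hstrict (j + (j.natAbs + k.natAbs : ℕ)).toNat (k + (j.natAbs + k.natAbs : ℕ)).toNat m
      (by
        rw [← Int.cast_natCast (R := ℝ), ← Int.cast_natCast (R := ℝ), ← h2, ← h3]
        push_cast
        linarith)
    rw [← h2, ← h3] at h4
    exact h1.not_gt h4

end Plateaus

end CircleDeg1Lift

/-- A derivative that is positive and `C¹` has a bounded and Lipschitz logarithm on compact
intervals. -/
theorem ContDiff.exists_log_deriv_bound {F : ℝ → ℝ} (hF : ContDiff ℝ 2 F) {a b : ℝ}
    (hpos : ∀ x ∈ Icc a b, 0 < deriv F x) :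
    ∃ C L : ℝ, 0 ≤ L ∧ (∀ x ∈ Icc a b, |Real.log (deriv F x)| ≤ C) ∧
      ∀ x ∈ Icc a b, ∀ y ∈ Icc a b,
        |Real.log (deriv F x) - Real.log (deriv F y)| ≤ L * |x - y| := by
  have h1 : ContDiff ℝ 1 (deriv F) := ((contDiff_succ_iff_deriv (n := 1)).1 hF).2.2
  have hd : Differentiable ℝ (deriv F) := h1.differentiable one_ne_zero
  have hc1 : Continuous (deriv F) := h1.continuous
  have hc2 : Continuous (deriv (deriv F)) := h1.continuous_deriv le_rfl
  obtain ⟨C, hC⟩ := isCompact_Icc.exists_bound_of_continuousOn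
    (hc1.continuousOn.log fun x hx => (hpos x hx).ne' : ContinuousOn _ (Icc a b))
  obtain ⟨L, hL⟩ := isCompact_Icc.exists_bound_of_continuousOn
    (hc2.continuousOn.div hc1.continuousOn fun x hx => (hpos x hx).ne' : ContinuousOn _ (Icc a b))
  refine ⟨C, |L|, abs_nonneg L, hC, fun x hx y hy => ?_⟩
  exact (convex_Icc a b).norm_image_sub_le_of_norm_hasDerivWithin_le
    (f := fun z => Real.log (deriv F z)) (f' := fun z => deriv (deriv F) z / deriv F z)
    (fun z hz => ((hd z).hasDerivAt.log (hpos z hz).ne').hasDerivWithinAt)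
    (fun z hz => (hL z hz).trans (le_abs_self L)) hy hx

namespace BimodData

variable (B : BimodData)

theorem continuous_F : Continuous B.F := B.hC2.continuous

theorem F_add_int (x : ℝ) (m : ℤ) : B.F (x + m) = B.F x + m := by
  induction m using Int.induction_on with
  | zero => simp
  | succ n ih =>
    push_cast at ih ⊢
    rw [← add_assoc, B.hlift, ih, add_assoc]
  | pred n ih =>
    push_cast at ih ⊢
    have := B.hlift (x + (-n - 1))
    rw [show x + (-(n : ℝ) - 1) + 1 = x + -n by ring, ih] at this
    linarith

theorem strictMonoOn_F : StrictMonoOn B.F (Icc B.ctm (B.ctp + 1)) :=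
  strictMonoOn_of_deriv_pos (convex_Icc _ _) B.continuous_F.continuousOn
    (by rw [interior_Icc]; exact B.hincr)

theorem F_ctm_lt_F_ctp : B.F B.ctm < B.F B.ctp :=
  strictAntiOn_of_deriv_neg (convex_Icc _ _) B.continuous_F.continuousOn
    (by rw [interior_Icc]; exact B.hdecr) (left_mem_Icc.2 B.h1.le) (right_mem_Icc.2 B.h1.le) B.h1

theorem F_dtm_add_one : B.F (B.dtm + 1) = B.F B.ctm + 1 := by rw [B.hlift, B.hdtmF]

theorem f_iterate_coe (n : ℕ) (x : ℝ) :
    B.f^[n] (x : UnitAddCircle) = ((B.F^[n] x : ℝ) : UnitAddCircle) := by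
  induction n with
  | zero => rfl
  | succ n ih => rw [Function.iterate_succ_apply', ih, B.hf, Function.iterate_succ_apply']

/-- `𝕀` covers the circle as soon as the images of its endpoints are far apart in the lift. -/
theorem image_II_eq_univ {n : ℕ} (h : B.F^[n] B.ctm + 1 ≤ B.F^[n] B.ctp) :
    B.f^[n] '' B.II = univ := by
  refine eq_univ_of_forall fun θ => ?_
  obtain ⟨t, rfl⟩ := QuotientAddGroup.mk_surjective θ
  obtain ⟨m, hm, -⟩ := existsUnique_sub_zsmul_mem_Ico (one_pos : (0 : ℝ) < 1) t (B.F^[n] B.ctm)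
  obtain ⟨x, hx, hxt⟩ := intermediate_value_Icc' B.h1.le (B.continuous_F.iterate n).continuousOn
    ⟨hm.1, hm.2.le.trans h⟩
  refine ⟨x, ⟨x, hx, rfl⟩, ?_⟩
  rw [B.f_iterate_coe, hxt, AddCircle.coe_sub, AddCircle.coe_zsmul, AddCircle.coe_period, smul_zero,
    sub_zero]

theorem dtp_lt_dtm_add_one (h : B.F B.ctp < B.F B.ctm + 1) : B.dtp < B.dtm + 1 := by
  refine (B.strictMonoOn_F.lt_iff_lt ⟨B.hdtp.1.le, B.hdtp.2.le⟩
    ⟨by linarith [B.hdtm.1], by linarith [B.hdtm.2]⟩).1 ?_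
  rwa [B.hdtpF, B.F_dtm_add_one]

theorem Fm_le_Fp (h : B.F B.ctp < B.F B.ctm + 1) : B.Fm ≤ B.Fp := by
  have hd := B.dtp_lt_dtm_add_one h
  have hdp := B.hdtp
  have hdm := B.hdtm
  have h1 := B.h1
  intro x
  obtain ⟨m, hm, -⟩ := existsUnique_sub_zsmul_mem_Ico (one_pos : (0 : ℝ) < 1) x B.dtm
  simp only [zsmul_eq_mul, mul_one] at hm
  suffices B.Fm (x - m) ≤ B.Fp (x - m) by simpa using this
  generalize x - m = y at hm
  rcases le_or_gt B.dtp y with hy | hy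
  · rw [B.hFm2 y ⟨by linarith [hdp.1], hm.2.le⟩, B.hFp2 y ⟨hy, by linarith [hm.2, hdm.2]⟩]
  rcases le_or_gt B.ctp y with hy' | hy'
  · rw [B.hFp1 y ⟨hy', hy.le⟩, ← B.hdtpF, ← B.hFm2 B.dtp ⟨hdp.1.le, hd.le⟩]
    exact B.Fm.monotone hy.le
  · rw [B.hFm1 y ⟨hm.1, by linarith⟩]
    have h2 := B.hFp2 (B.dtm + 1) ⟨hd.le, by linarith [hdm.2]⟩
    rw [B.Fp.map_add_one, B.F_dtm_add_one] at h2
    have := B.Fp.monotone hm.1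
    linarith

theorem surjective_Fm : Function.Surjective B.Fm := by
  intro y
  obtain ⟨m, hm, -⟩ := existsUnique_sub_zsmul_mem_Ico (one_pos : (0 : ℝ) < 1) y (B.F B.ctm)
  simp only [zsmul_eq_mul, mul_one] at hm
  have hle : B.ctm ≤ B.dtm + 1 := by linarith [B.hdtm.1]
  obtain ⟨x, hx, hxy⟩ := intermediate_value_Icc hle B.continuous_F.continuousOn
    ⟨hm.1, by rw [B.F_dtm_add_one]; exact hm.2.le⟩
  refine ⟨x + m, ?_⟩
  rw [B.Fm.map_add_int, B.hFm2 x hx, hxy]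
  ring

/-- The orbit of `c̃⁺` under `F` is its orbit under the upper map. -/
theorem iterate_ctp (n : ℕ) : B.F^[n] B.ctp = (B.Fp ^ n) B.ctp :=
  B.Fp.iterate_eq_pow_of_plateau B.hirrp B.F_add_int
    ⟨le_rfl, by linarith [B.h1, B.hdtp.1]⟩ B.hFp1 B.hFp2 n

/-- The orbit of `c̃⁻` under `F` is its orbit under the lower map. -/
theorem iterate_ctm (n : ℕ) : B.F^[n] B.ctm = (B.Fm ^ n) B.ctm :=
  B.Fm.iterate_eq_pow_of_plateau B.hirrm B.F_add_int
    ⟨by linarith [B.h1, B.hdtm.2], le_rfl⟩ B.hFm1 B.hFm2 n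

/-- If the upper and lower translation numbers differ, the images of `𝕀` become long. -/
theorem exists_iterate_add_one_le (h : B.Fm.translationNumber < B.Fp.translationNumber) :
    ∃ n : ℕ, 1 ≤ n ∧ B.F^[n] B.ctm + 1 ≤ B.F^[n] B.ctp := by
  obtain ⟨n, hn⟩ := exists_nat_gt (3 / (B.Fp.translationNumber - B.Fm.translationNumber))
  have hpos := sub_pos.2 h
  rw [div_lt_iff₀ hpos] at hn
  have hn1 : 1 ≤ n := by
    rcases Nat.eq_zero_or_pos n with rfl | h0
    · norm_num at hn
    · exact h0
  refine ⟨n, hn1, ?_⟩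
  rw [B.iterate_ctm, B.iterate_ctp]
  have hfl := Int.floor_le ((n : ℝ) * B.Fm.translationNumber)
  have e1 := B.Fm.pow_lt_add_int (n := n) (m := ⌊(n : ℝ) * B.Fm.translationNumber⌋ + 1)
    (by push_cast; exact Int.lt_floor_add_one _) B.ctm
  have e2 := B.Fp.add_int_lt_pow (n := n) (m := ⌊(n : ℝ) * B.Fm.translationNumber⌋ + 3)
    (by push_cast; linarith) B.ctp
  push_cast at e1 e2
  linarith [B.h0, B.h2]

theorem translationNumber_ne (h : B.F B.ctp < B.F B.ctm + 1) :
    B.Fm.translationNumber ≠ B.Fp.translationNumber := by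
  intro hτ
  have hd := B.dtp_lt_dtm_add_one h
  have hdp := B.hdtp
  have hdm := B.hdtm
  have h1 := B.h1
  have hFm : ∀ x ∈ Icc B.dtp (B.dtm + 1), B.Fm x = B.F x := fun x hx =>
    B.hFm2 x ⟨by linarith [hx.1, hdp.1], hx.2⟩
  have hKsub : Icc B.dtp (B.dtm + 1) ⊆ Ioo B.ctm (B.ctp + 1) := fun x hx =>
    ⟨by linarith [hx.1, hdp.1], by linarith [hx.2, hdm.2]⟩
  have hFm_dtm : B.Fm B.dtm = B.F B.ctm := B.hFm1 _ ⟨le_rfl, by linarith [hdm.2]⟩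
  have hFm_dtp : B.Fm B.dtp = B.F B.ctp := by rw [hFm _ ⟨le_rfl, hd.le⟩, B.hdtpF]
  obtain ⟨u, v, hu0, hv0, hu, hv, huv, hord⟩ :=
    CircleDeg1Lift.exists_wandering_orbit (a := B.dtm) (b := B.dtp) (c := B.ctp) (d := B.ctm)
      (B.Fm_le_Fp h) hτ B.hirrm
      (by rw [hFm_dtm, B.hFm1 B.ctm ⟨by linarith [hdm.2], le_rfl⟩])
      (by rw [B.hFp1 B.dtp ⟨by linarith [hdp.1], le_rfl⟩,
        B.hFp1 B.ctp ⟨le_rfl, by linarith [hdp.1]⟩])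
      h1.le B.surjective_Fm (by linarith [hdm.2, hdp.1]) hd.le
      (by rw [hFm_dtm, hFm_dtp]; exact B.F_ctm_lt_F_ctp)
      (by
        intro x hx y hy hxy
        rw [hFm x hx, hFm y hy]
        exact B.strictMonoOn_F (Ioo_subset_Icc_self (hKsub hx)) (Ioo_subset_Icc_self (hKsub hy)) hxy)
  obtain ⟨C, L, hL0, hC, hL⟩ := B.hC2.exists_log_deriv_bound fun x hx => B.hincr x (hKsub hx)
  have hperiodic : ∀ (x : ℝ) (m : ℤ), deriv B.F (x + m) = deriv B.F x := by
    intro x m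
    have : (fun y => B.F (y + m)) = fun y => B.F y + m := funext fun y => B.F_add_int y m
    rw [← deriv_comp_add_const, this, deriv_add_const]
  have hpoint : ∀ k : ℤ, ∃ s ξ : ℝ, ξ ∈ Icc (u k) (v k) ∧
      v (k + 1) - u (k + 1) = Real.exp s * (v k - u k) ∧
      (k ≠ 0 → ∃ m : ℤ, ξ - m ∈ Icc B.dtp (B.dtm + 1) ∧ s = Real.log (deriv B.F (ξ - m))) := by
    intro k
    have hk := sub_pos.2 (huv k)
    rcases eq_or_ne k 0 with rfl | hk0
    · refine ⟨Real.log ((v (0 + 1) - u (0 + 1)) / (v 0 - u 0)), u 0, left_mem_Icc.2 (huv 0).le, ?_,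
        fun h => absurd rfl h⟩
      rw [Real.exp_log (div_pos (sub_pos.2 (huv _)) hk), div_mul_cancel₀ _ hk.ne']
    · set m := ⌊(k : ℝ) * B.Fm.translationNumber⌋
      have hne : (k : ℝ) * B.Fm.translationNumber ≠ m :=
        sub_ne_zero.1 (B.hirrm.int_mul_sub_int_ne_zero hk0 m)
      have hfl := lt_of_le_of_ne (Int.floor_le ((k : ℝ) * B.Fm.translationNumber)) hne.symm
      have hfl' := Int.lt_floor_add_one ((k : ℝ) * B.Fm.translationNumber)
      have e1 := hord 0 k m (by simpa using hfl)
      have e2 := hord k 0 (-(m + 1)) (by push_cast; linarith)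
      push_cast at e2
      rw [hv0] at e1
      rw [hu0] at e2
      have hmem : ∀ x ∈ Icc (u k) (v k), x - m ∈ Icc B.dtp (B.dtm + 1) := fun x hx =>
        ⟨by linarith [hx.1], by linarith [hx.2]⟩
      have hFm' : ∀ x ∈ Icc (u k) (v k), B.Fm x = B.F x := by
        intro x hx
        have e3 := hFm _ (hmem x hx)
        have e4 := B.F_add_int (x - m) m
        rw [sub_add_cancel, ← e3] at e4
        simpa using e4.symm
      obtain ⟨ξ, hξ, hslope⟩ := exists_deriv_eq_slope B.F (huv k) B.continuous_F.continuousOn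
        (B.hC2.differentiable two_ne_zero).differentiableOn
      have hξ' := Ioo_subset_Icc_self hξ
      have hder : deriv B.F (ξ - m) = deriv B.F ξ := by
        rw [← hperiodic (ξ - m) m, sub_add_cancel]
      refine ⟨Real.log (deriv B.F (ξ - m)), ξ, hξ', ?_, fun _ => ⟨m, hmem ξ hξ', rfl⟩⟩
      rw [Real.exp_log (B.hincr _ (hKsub (hmem ξ hξ'))), hder, hslope, div_mul_cancel₀ _ hk.ne', hu,
        hv, hFm' _ (left_mem_Icc.2 (huv k).le), hFm' _ (right_mem_Icc.2 (huv k).le)]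
  choose s ξ hξ hscale hs using hpoint
  have hδ : 0 < B.dtp - B.dtm := by linarith [hdm.2, hdp.1]
  refine false_of_wandering_orbit (C := max C |s 0|) (L := L + L / (B.dtp - B.dtm)) B.hirrm huv hord
    hscale hξ (fun k => ?_) (by positivity) fun j k m hj hk => ?_
  · rcases eq_or_ne k 0 with rfl | hk
    · exact le_max_right _ _
    · obtain ⟨m, hm, hsk⟩ := hs k hk
      rw [hsk]
      exact (hC _ hm).trans (le_max_left _ _)
  · obtain ⟨n, hn, hsj⟩ := hs j hj
    obtain ⟨n', hn', hsk⟩ := hs k hk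
    rw [hsj, hsk]
    refine (hL _ hn _ hn').trans ?_
    have hLδ : 0 ≤ L / (B.dtp - B.dtm) := by positivity
    rcases eq_or_ne (n - n' - m) 0 with h0 | h0
    · have h0' : (n : ℝ) - n' - m = 0 := by exact_mod_cast h0
      rw [show ξ j - n - (ξ k - n') = ξ j - ξ k - m by linarith]
      gcongr
      linarith
    · have h0' : (1 : ℝ) ≤ |(n : ℝ) - n' - m| := by exact_mod_cast Int.one_le_abs h0
      have e1 : |ξ j - n - (ξ k - n')| ≤ 1 - (B.dtp - B.dtm) := by
        rw [abs_le]
        constructor <;> linarith [hn.1, hn.2, hn'.1, hn'.2]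
      have e2 : B.dtp - B.dtm ≤ |ξ j - ξ k - m| := by
        have := abs_sub (ξ j - ξ k - m) (ξ j - n - (ξ k - n'))
        rw [show ξ j - ξ k - m - (ξ j - n - (ξ k - n')) = n - n' - m by ring] at this
        linarith
      calc L * |ξ j - n - (ξ k - n')| ≤ L * 1 := by
            gcongr
            linarith
        _ = L / (B.dtp - B.dtm) * (B.dtp - B.dtm) := by field_simp
        _ ≤ (L + L / (B.dtp - B.dtm)) * |ξ j - ξ k - m| := by
            gcongr
            linarith

end BimodData

/-- **Lemma (the decreasing interval covers the circle).** For every `f ∈ Bimod` there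
exists `N ≥ 1` such that `f^N(𝕀) = 𝕋¹`. -/
theorem II_covers_circle (B : BimodData) :
    ∃ N : ℕ, 1 ≤ N ∧ B.f^[N] '' B.II = Set.univ := by
  rcases le_or_gt (B.F B.ctm + 1) (B.F B.ctp) with h | h
  · exact ⟨1, le_rfl, B.image_II_eq_univ h⟩
  · obtain ⟨n, hn, hle⟩ := B.exists_iterate_add_one_le
      ((CircleDeg1Lift.translationNumber_mono (B.Fm_le_Fp h)).lt_of_ne (B.translationNumber_ne h))
    exact ⟨n, hn, B.image_II_eq_univ hle⟩
end
end

section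
/- For every f ∈ Bimod, Lebesgue-almost every point of 𝕋¹ enters 𝕀 under iteration: λ({x ∈ 𝕋¹ : f^n(x) ∉ 𝕀 for all n ≥ 1}) = 0. -/
open MeasureTheory Set Filter

noncomputable section

lemma mul_sinh_le_sinh_mul {l u : ℝ} (hl : 1 ≤ l) (hu : 0 ≤ u) :
    l * Real.sinh u ≤ Real.sinh (l * u) := by
  have hd : ∀ x : ℝ, HasDerivAt (fun x => Real.sinh (l * x) - l * Real.sinh x)
      (Real.cosh (l * x) * l - l * Real.cosh x) x := fun x => by
    have h1 : HasDerivAt (fun x : ℝ => l * x) l x := by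
      simpa using (hasDerivAt_id x).const_mul l
    exact ((Real.hasDerivAt_sinh _).comp x h1).sub ((Real.hasDerivAt_sinh x).const_mul l)
  have hm : MonotoneOn (fun x => Real.sinh (l * x) - l * Real.sinh x) (Ici 0) := by
    apply monotoneOn_of_deriv_nonneg (convex_Ici 0)
    · exact fun x _ => (hd x).continuousAt.continuousWithinAt
    · exact fun x _ => (hd x).differentiableAt.differentiableWithinAt
    · intro x hx
      rw [interior_Ici, mem_Ioi] at hx
      rw [(hd x).deriv]
      have : Real.cosh x ≤ Real.cosh (l * x) := by
        rw [Real.cosh_le_cosh, abs_of_pos hx, abs_of_pos (by positivity)]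
        nlinarith
      nlinarith
  have := hm (mem_Ici.2 le_rfl) (mem_Ici.2 hu) hu
  simp at this
  linarith

lemma sinh_mul_mul_cosh_le {l u : ℝ} (hl : 1 ≤ l) (hu : 0 ≤ u) :
    Real.sinh (l * u) * Real.cosh u ≤ l * (Real.sinh u * Real.cosh (l * u)) := by
  have hd : ∀ x : ℝ, HasDerivAt
      (fun x => l * (Real.sinh x * Real.cosh (l * x)) - Real.sinh (l * x) * Real.cosh x)
      (l * (Real.cosh x * Real.cosh (l * x) + Real.sinh x * (Real.sinh (l * x) * l)) -
        ((Real.cosh (l * x) * l) * Real.cosh x + Real.sinh (l * x) * Real.sinh x)) x := fun x => by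
    have h1 : HasDerivAt (fun x : ℝ => l * x) l x := by
      simpa using (hasDerivAt_id x).const_mul l
    have h2 := (Real.hasDerivAt_sinh _).comp x h1
    have h3 := (Real.hasDerivAt_cosh _).comp x h1
    exact (((Real.hasDerivAt_sinh x).mul h3).const_mul l).sub (h2.mul (Real.hasDerivAt_cosh x))
  have hm : MonotoneOn
      (fun x => l * (Real.sinh x * Real.cosh (l * x)) - Real.sinh (l * x) * Real.cosh x)
      (Ici 0) := by
    apply monotoneOn_of_deriv_nonneg (convex_Ici 0)
    · exact fun x _ => (hd x).continuousAt.continuousWithinAt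
    · exact fun x _ => (hd x).differentiableAt.differentiableWithinAt
    · intro x hx
      rw [interior_Ici, mem_Ioi] at hx
      rw [(hd x).deriv]
      have h1 : 0 ≤ Real.sinh x := Real.sinh_nonneg_iff.2 hx.le
      have h2 : 0 ≤ Real.sinh (l * x) := Real.sinh_nonneg_iff.2 (by positivity)
      nlinarith [mul_nonneg h1 h2, mul_nonneg (mul_nonneg h1 h2) (by nlinarith : 0 ≤ l ^ 2 - 1)]
  have := hm (mem_Ici.2 le_rfl) (mem_Ici.2 hu) hu
  simp at this
  linarith

/-- For `F = (· ^ l)` and base point `1`, the defect `1 / (x - 1) - deriv F 1 / (F x - F 1)`. -/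
def powDefect (l x : ℝ) : ℝ := 1 / (x - 1) - l / (x ^ l - 1)

lemma sq_rpow_sub_one_ge {l x : ℝ} (hl : 1 ≤ l) (hx : 0 < x) :
    l * (l * x ^ (l - 1)) * (x - 1) ^ 2 ≤ (x ^ l - 1) ^ 2 := by
  obtain ⟨u, rfl⟩ : ∃ u, x = Real.exp (2 * u) :=
    ⟨Real.log x / 2, by rw [mul_div_cancel₀ _ two_ne_zero, Real.exp_log hx]⟩
  have key : (l * Real.sinh u) ^ 2 ≤ Real.sinh (l * u) ^ 2 := by
    rw [sq_le_sq]
    rcases le_total 0 u with hu | hu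
    · rw [abs_of_nonneg (mul_nonneg (by linarith) (Real.sinh_nonneg_iff.2 hu))]
      exact (mul_sinh_le_sinh_mul hl hu).trans (le_abs_self _)
    · have := mul_sinh_le_sinh_mul hl (neg_nonneg.2 hu)
      rw [Real.sinh_neg, mul_neg, mul_neg, Real.sinh_neg] at this
      rw [abs_of_nonpos (by nlinarith [Real.sinh_nonpos_iff.2 hu])]
      exact this.trans (neg_le_abs _)
  have e1 : Real.exp (2 * u) - 1 = 2 * Real.exp u * Real.sinh u := by
    rw [Real.sinh_eq, two_mul, Real.exp_add, Real.exp_neg]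
    field_simp
  have e2 : Real.exp (2 * u) ^ l - 1 = 2 * Real.exp (l * u) * Real.sinh (l * u) := by
    rw [Real.sinh_eq, ← Real.exp_mul, show 2 * u * l = l * u + l * u by ring, Real.exp_add,
      Real.exp_neg]
    field_simp
  have e3 : Real.exp (2 * u) ^ (l - 1) * Real.exp u ^ 2 = Real.exp (l * u) ^ 2 := by
    rw [← Real.exp_mul, sq, sq, ← Real.exp_add, ← Real.exp_add, ← Real.exp_add]
    congr 1; ring
  rw [e1, e2]
  calc l * (l * Real.exp (2 * u) ^ (l - 1)) * (2 * Real.exp u * Real.sinh u) ^ 2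
      = 4 * (Real.exp (2 * u) ^ (l - 1) * Real.exp u ^ 2) * (l * Real.sinh u) ^ 2 := by ring
    _ = 4 * Real.exp (l * u) ^ 2 * (l * Real.sinh u) ^ 2 := by rw [e3]
    _ ≤ 4 * Real.exp (l * u) ^ 2 * Real.sinh (l * u) ^ 2 := by gcongr
    _ = _ := by ring

lemma hasDerivAt_powDefect {l x : ℝ} (hx : 0 < x) (h1 : x - 1 ≠ 0) (hx1 : x ^ l - 1 ≠ 0) :
    HasDerivAt (powDefect l) (-1 / (x - 1) ^ 2 - (-(l * (l * x ^ (l - 1))) / (x ^ l - 1) ^ 2)) x := by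
  have a1 : HasDerivAt (fun x : ℝ => x - 1) 1 x := (hasDerivAt_id x).sub_const 1
  have a2 : HasDerivAt (fun x : ℝ => x ^ l - 1) (l * x ^ (l - 1)) x :=
    (Real.hasDerivAt_rpow_const (Or.inl hx.ne')).sub_const 1
  have := ((hasDerivAt_const x (1 : ℝ)).div a1 h1).sub ((hasDerivAt_const x l).div a2 hx1)
  simp only [zero_mul, zero_sub, mul_one] at this
  exact this

lemma rpow_sub_one_pos {l x : ℝ} (hl : 1 < l) (hx : 1 < x) : 0 < x ^ l - 1 :=
  sub_pos.2 (Real.one_lt_rpow hx (by linarith))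

lemma rpow_sub_one_neg {l x : ℝ} (hl : 1 < l) (h0 : 0 ≤ x) (hx : x < 1) : x ^ l - 1 < 0 :=
  sub_neg.2 (Real.rpow_lt_one h0 hx (by linarith))

lemma antitoneOn_powDefect {l : ℝ} (hl : 1 < l) {s : Set ℝ} (hs : Convex ℝ s) (h0 : s ⊆ Ici 0)
    (h1 : (1 : ℝ) ∉ s) : AntitoneOn (powDefect l) s := by
  have hne : ∀ x ∈ s, x - 1 ≠ 0 ∧ x ^ l - 1 ≠ 0 := by
    intro x hx
    have : x ≠ 1 := fun h => h1 (h ▸ hx)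
    refine ⟨sub_ne_zero.2 this, ?_⟩
    rcases this.lt_or_gt with h | h
    · exact (rpow_sub_one_neg hl (h0 hx) h).ne
    · exact (rpow_sub_one_pos hl h).ne'
  have hpos : ∀ x ∈ interior s, 0 < x := by
    intro x hx
    have := interior_mono h0 hx
    rwa [interior_Ici] at this
  apply antitoneOn_of_deriv_nonpos hs
  · apply ContinuousOn.sub
    · exact continuousOn_const.div (continuousOn_id.sub continuousOn_const) fun x hx => (hne x hx).1
    · refine continuousOn_const.div (ContinuousOn.sub ?_ continuousOn_const) fun x hx => (hne x hx).2
      exact (Real.continuous_rpow_const (by linarith)).continuousOn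
  · exact fun x hx => (hasDerivAt_powDefect (hpos x hx) (hne x (interior_subset hx)).1
      (hne x (interior_subset hx)).2).differentiableAt.differentiableWithinAt
  · intro x hx
    obtain ⟨n1, n2⟩ := hne x (interior_subset hx)
    rw [(hasDerivAt_powDefect (hpos x hx) n1 n2).deriv]
    have := sq_rpow_sub_one_ge hl.le (hpos x hx)
    have p1 : 0 < (x - 1) ^ 2 := by positivity
    have p2 : 0 < (x ^ l - 1) ^ 2 := by positivity
    have : l * (l * x ^ (l - 1)) / (x ^ l - 1) ^ 2 ≤ 1 / (x - 1) ^ 2 := by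
      rw [div_le_div_iff₀ p2 p1]; linarith
    rw [neg_div, neg_div]; linarith

lemma powDefect_exp {l u : ℝ} (hl : 1 < l) (hu : u ≠ 0) :
    powDefect l (Real.exp (2 * u)) = (l - 1) / 2 +
      (Real.cosh u * Real.sinh (l * u) - l * (Real.sinh u * Real.cosh (l * u))) /
        (2 * (Real.sinh u * Real.sinh (l * u))) := by
  have s1 : Real.sinh u ≠ 0 := by simpa using hu
  have s2 : Real.sinh (l * u) ≠ 0 := by simp [hu]; linarith
  have e1 : Real.exp (2 * u) - 1 = 2 * Real.exp u * Real.sinh u := by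
    rw [Real.sinh_eq, two_mul, Real.exp_add, Real.exp_neg]
    field_simp
  have e2 : Real.exp (2 * u) ^ l - 1 = 2 * Real.exp (l * u) * Real.sinh (l * u) := by
    rw [Real.sinh_eq, ← Real.exp_mul, show 2 * u * l = l * u + l * u by ring, Real.exp_add,
      Real.exp_neg]
    field_simp
  have r : ∀ v : ℝ, Real.sinh v ≠ 0 →
      1 / (2 * Real.exp v * Real.sinh v) = (Real.cosh v / Real.sinh v - 1) / 2 := by
    intro v hv
    have : Real.exp v * (Real.cosh v - Real.sinh v) = 1 := by
      rw [Real.cosh_sub_sinh, ← Real.exp_add]; simp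
    field_simp
    linear_combination -this
  rw [powDefect, e1, e2, r u s1, ← mul_one_div l, r _ s2]
  field_simp
  ring

lemma powDefect_le {l x : ℝ} (hl : 1 < l) (hx : 1 < x) : powDefect l x ≤ (l - 1) / 2 := by
  obtain ⟨u, rfl⟩ : ∃ u, x = Real.exp (2 * u) :=
    ⟨Real.log x / 2, by rw [mul_div_cancel₀ _ two_ne_zero, Real.exp_log (by linarith)]⟩
  have hu : 0 < u := by
    have := Real.one_lt_exp_iff.1 hx; linarith
  rw [powDefect_exp hl hu.ne']
  have := sinh_mul_mul_cosh_le hl.le hu.le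
  have h2 : 0 < Real.sinh u * Real.sinh (l * u) :=
    mul_pos (Real.sinh_pos_iff.2 hu) (Real.sinh_pos_iff.2 (by positivity))
  have : (Real.cosh u * Real.sinh (l * u) - l * (Real.sinh u * Real.cosh (l * u))) /
        (2 * (Real.sinh u * Real.sinh (l * u))) ≤ 0 :=
    div_nonpos_of_nonpos_of_nonneg (by linarith) (by linarith)
  linarith

lemma le_powDefect_of_pos {l x : ℝ} (hl : 1 < l) (h0 : 0 < x) (hx : x < 1) :
    (l - 1) / 2 ≤ powDefect l x := by
  obtain ⟨u, rfl⟩ : ∃ u, x = Real.exp (2 * u) :=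
    ⟨Real.log x / 2, by rw [mul_div_cancel₀ _ two_ne_zero, Real.exp_log (by linarith)]⟩
  have hu : u < 0 := by
    have := Real.exp_lt_one_iff.1 hx; linarith
  rw [powDefect_exp hl hu.ne]
  have := sinh_mul_mul_cosh_le hl.le (neg_nonneg.2 hu.le)
  simp only [mul_neg, Real.sinh_neg, Real.cosh_neg] at this
  have h2 : 0 < Real.sinh u * Real.sinh (l * u) :=
    mul_pos_of_neg_of_neg (Real.sinh_neg_iff.2 hu) (Real.sinh_neg_iff.2 (by nlinarith))
  have : 0 ≤ (Real.cosh u * Real.sinh (l * u) - l * (Real.sinh u * Real.cosh (l * u))) /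
        (2 * (Real.sinh u * Real.sinh (l * u))) :=
    div_nonneg (by linarith) (by linarith)
  linarith

lemma powDefect_anti {l x y : ℝ} (hl : 1 < l) (hx0 : 0 ≤ x) (hxy : x ≤ y) (hx : x ≠ 1)
    (hy : y ≠ 1) : powDefect l y ≤ powDefect l x := by
  rcases hx.lt_or_gt with hx1 | hx1
  · have hA := antitoneOn_powDefect hl (convex_Ico 0 1) (fun x hx => hx.1) (by simp)
    rcases hy.lt_or_gt with hy1 | hy1
    · exact hA ⟨hx0, hx1⟩ ⟨hx0.trans hxy, hy1⟩ hxy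
    · have hm : max x (1 / 2) < 1 := max_lt hx1 (by norm_num)
      have h0m : (0 : ℝ) < max x (1 / 2) := lt_max_of_lt_right (by norm_num)
      calc _ ≤ (l - 1) / 2 := powDefect_le hl hy1
        _ ≤ powDefect l (max x (1 / 2)) := le_powDefect_of_pos hl h0m hm
        _ ≤ _ := hA ⟨hx0, hx1⟩ ⟨h0m.le, hm⟩ (le_max_left _ _)
  · exact antitoneOn_powDefect hl (convex_Ioi 1) (fun x (hx : 1 < x) => by simp; linarith)
      (by simp) hx1 (hx1.trans_le hxy) hxy

/-- The difference between the reciprocal of `t - s` and that of `F t - F s`, the latter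
renormalised by the derivative of `F` at `s`. -/
def slopeDefect (F : ℝ → ℝ) (s t : ℝ) : ℝ := 1 / (t - s) - deriv F s / (F t - F s)

lemma slopeDefect_rpow_anti {l s x y : ℝ} (hl : 1 < l) (hs : 0 < s) (hx0 : 0 ≤ x) (hxy : x ≤ y)
    (hx : x ≠ s) (hy : y ≠ s) :
    slopeDefect (fun x => x ^ l) s y ≤ slopeDefect (fun x => x ^ l) s x := by
  have key : ∀ z, 0 ≤ z → slopeDefect (fun x => x ^ l) s z = powDefect l (z / s) / s := by
    intro z hz
    have e : s ^ l = s * s ^ (l - 1) := by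
      rw [← Real.rpow_one_add' hs.le (by linarith)]; congr 1; ring
    have hp : s ^ (l - 1) ≠ 0 := (Real.rpow_pos_of_pos hs _).ne'
    rw [slopeDefect, powDefect, (Real.hasDerivAt_rpow_const (Or.inl hs.ne')).deriv,
      Real.div_rpow hz hs.le, e, sub_div]
    congr 1
    · rw [div_sub_one hs.ne', one_div_div, div_div_cancel_left' hs.ne', one_div]
    · rw [div_sub_one (by positivity), div_div_eq_mul_div, div_div]
      rw [mul_comm _ s, ← mul_assoc, mul_comm l s, mul_assoc, mul_div_mul_left _ _ hs.ne']
  rw [key y (hx0.trans hxy), key x hx0]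
  gcongr
  refine powDefect_anti hl (by positivity) (by gcongr) ?_ ?_ <;> rw [Ne, div_eq_one_iff_eq hs.ne']
  exacts [hx, hy]

lemma ContDiff.exists_abs_deriv_sub_le {F : ℝ → ℝ} (hF : ContDiff ℝ 2 F) (a b : ℝ) :
    ∃ M, 0 ≤ M ∧ ∀ x ∈ Icc a b, ∀ y ∈ Icc a b, |deriv F x - deriv F y| ≤ M * |x - y| := by
  have h1 : ContDiff ℝ 1 (deriv F) :=
    ((contDiff_succ_iff_deriv (n := 1)).1 (by rw [one_add_one_eq_two]; exact hF)).2.2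
  have h2 : Continuous (deriv (deriv F)) := h1.continuous_deriv le_rfl
  obtain ⟨M, hM⟩ := isCompact_Icc.exists_bound_of_continuousOn (h2.continuousOn (s := Icc a b))
  refine ⟨max M 0, le_max_right _ _, fun x hx y hy => ?_⟩
  exact (convex_Icc a b).norm_image_sub_le_of_norm_deriv_le
    (fun z _ => (h1.differentiable one_ne_zero) z) (fun z hz => (hM z hz).trans (le_max_left _ _))
    hy hx

lemma abs_slopeDefect_le {F : ℝ → ℝ} (hF : ContDiff ℝ 2 F) {a b M m s t : ℝ}
    (hM0 : 0 ≤ M) (hM : ∀ x ∈ Icc a b, ∀ y ∈ Icc a b, |deriv F x - deriv F y| ≤ M * |x - y|)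
    (hm : 0 < m) (hs : s ∈ Icc a b) (ht : t ∈ Icc a b) (hst : t ≠ s)
    (hlow : m * |t - s| ≤ |F t - F s|) : |slopeDefect F s t| ≤ M / m := by
  have hd : Differentiable ℝ F := hF.differentiable two_ne_zero
  have hts : 0 < |t - s| := abs_pos.2 (sub_ne_zero.2 hst)
  have hFF : 0 < |F t - F s| := lt_of_lt_of_le (by positivity) hlow
  obtain ⟨c, hc, hcs, hceq⟩ : ∃ c ∈ Icc a b, |c - s| ≤ |t - s| ∧
      deriv F c * (t - s) = F t - F s := by
    rcases hst.lt_or_gt with h | h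
    · obtain ⟨c, hc, e⟩ := exists_deriv_eq_slope F h hd.continuous.continuousOn
        hd.differentiableOn
      refine ⟨c, ⟨ht.1.trans hc.1.le, hc.2.le.trans hs.2⟩, ?_, ?_⟩
      · rw [abs_of_neg (by linarith [hc.2]), abs_of_neg (by linarith)]; linarith [hc.1]
      · rw [e]; field_simp [sub_ne_zero.2 h.ne']; ring
    · obtain ⟨c, hc, e⟩ := exists_deriv_eq_slope F h hd.continuous.continuousOn
        hd.differentiableOn
      refine ⟨c, ⟨hs.1.trans hc.1.le, hc.2.le.trans ht.2⟩, ?_, ?_⟩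
      · rw [abs_of_pos (by linarith [hc.1]), abs_of_pos (by linarith)]; linarith [hc.2]
      · rw [e]; field_simp [sub_ne_zero.2 h.ne']
  have e : slopeDefect F s t = (deriv F c - deriv F s) / (F t - F s) := by
    rw [slopeDefect, sub_div, ← hceq]
    congr 1
    have : deriv F c ≠ 0 := by
      rintro h0; rw [h0, zero_mul] at hceq; rw [← hceq] at hFF; simp at hFF
    rw [div_mul_cancel_left₀ this, one_div]
  rw [e, abs_div, div_le_div_iff₀ hFF hm]
  calc |deriv F c - deriv F s| * m ≤ M * |c - s| * m := by gcongr; exact hM c hc s hs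
    _ ≤ M * |t - s| * m := by gcongr
    _ = M * (m * |t - s|) := by ring
    _ ≤ _ := by gcongr

lemma strictMonoOn_Icc_of_deriv_pos_Ioo {G : ℝ → ℝ} {L : ℝ} (hG : Continuous G)
    (hpos : ∀ x ∈ Ioo 0 L, 0 < deriv G x) : StrictMonoOn G (Icc 0 L) :=
  strictMonoOn_of_deriv_pos (convex_Icc 0 L) hG.continuousOn (by rwa [interior_Icc])

lemma exists_pos_le_deriv {G : ℝ → ℝ} (hG : ContDiff ℝ 2 G) {a b : ℝ}
    (hpos : ∀ x ∈ Icc a b, 0 < deriv G x) :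
    ∃ m, 0 < m ∧ ∀ x ∈ Icc a b, m ≤ deriv G x := by
  rcases (Icc a b).eq_empty_or_nonempty with h | h
  · exact ⟨1, one_pos, by simp [h]⟩
  · obtain ⟨x, hx, hmin⟩ := isCompact_Icc.exists_isMinOn h
      ((hG.continuous_deriv one_le_two).continuousOn)
    exact ⟨deriv G x, hpos x hx, fun y hy => hmin hy⟩

lemma exists_mul_abs_sub_le {G : ℝ → ℝ} {L ρ : ℝ} (hG : ContDiff ℝ 2 G)
    (hpos : ∀ x ∈ Ioo 0 L, 0 < deriv G x) (hρ : 0 < ρ) (hρL : ρ ≤ L / 2) :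
    ∃ m, 0 < m ∧ ∀ s ∈ Icc ρ (L / 2), ∀ t ∈ Icc 0 L, m * |t - s| ≤ |G t - G s| := by
  have hL : 0 < L := by linarith
  have hmono := strictMonoOn_Icc_of_deriv_pos_Ioo hG.continuous hpos
  obtain ⟨m, hm, hmd⟩ := exists_pos_le_deriv hG (a := ρ / 2) (b := 3 * L / 4)
    fun x hx => hpos x ⟨by linarith [hx.1], by linarith [hx.2]⟩
  have hd : Differentiable ℝ G := hG.differentiable two_ne_zero
  have hmid : ∀ᵉ (x ∈ Icc (ρ / 2) (3 * L / 4)) (y ∈ Icc (ρ / 2) (3 * L / 4)), x ≤ y →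
      m * (y - x) ≤ G y - G x :=
    (convex_Icc _ _).mul_sub_le_image_sub_of_le_deriv hd.continuous.continuousOn
      hd.differentiableOn fun x hx => hmd x (interior_subset hx)
  have hκ : ρ / (2 * L) ≤ 1 / 4 := by rw [div_le_div_iff₀ (by positivity) (by norm_num)]; linarith
  have hκ0 : 0 < ρ / (2 * L) := by positivity
  have hκL : ρ / (2 * L) * L = ρ / 2 := by field_simp
  refine ⟨m * (ρ / (2 * L)), by positivity, fun s hs t ht => ?_⟩
  rcases le_total s t with h | h
  · rw [abs_of_nonneg (sub_nonneg.2 h)]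
    refine le_trans ?_ (le_abs_self _)
    rcases le_total t (3 * L / 4) with h' | h'
    · have := hmid s ⟨by linarith [hs.1], by linarith [hs.2]⟩ t ⟨by linarith [hs.1], h'⟩ h
      have : m * (ρ / (2 * L)) * (t - s) ≤ m * 1 * (t - s) := by gcongr; linarith
      linarith
    · have h1 := hmid s ⟨by linarith [hs.1], by linarith [hs.2]⟩ (3 * L / 4)
        ⟨by linarith, le_rfl⟩ (by linarith [hs.2])
      have h2 := hmono.monotoneOn ⟨by linarith, by linarith⟩ ht h'
      have h3 : m * (ρ / (2 * L) * (t - s)) ≤ m * (3 * L / 4 - s) := by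
        gcongr
        nlinarith [hs.1, hs.2, ht.2]
      linarith
  · rw [abs_of_nonpos (sub_nonpos.2 h)]
    refine le_trans ?_ (neg_le_abs _)
    rcases le_total (ρ / 2) t with h' | h'
    · have := hmid t ⟨h', by linarith [hs.2]⟩ s ⟨by linarith [hs.1], by linarith [hs.2]⟩ h
      have : m * (ρ / (2 * L)) * -(t - s) ≤ m * 1 * -(t - s) := by
        have : 0 ≤ -(t - s) := by linarith
        gcongr; linarith
      linarith
    · have h1 := hmid (ρ / 2) ⟨le_rfl, by linarith⟩ s ⟨by linarith [hs.1], by linarith [hs.2]⟩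
        (by linarith [hs.1])
      have h2 := hmono.monotoneOn ht ⟨by linarith, by linarith⟩ h'
      have h3 : m * (ρ / (2 * L) * -(t - s)) ≤ m * (s - ρ / 2) := by
        gcongr
        nlinarith [hs.1, hs.2, ht.1]
      linarith

lemma exists_slopeDefect_le_near_zero {G χ : ℝ → ℝ} {l r : ℝ} (hr : 0 ≤ r) (hl : 1 < l)
    (hχ : ContDiff ℝ 2 χ) (hχ0 : χ 0 = 0) (hχpos : ∀ x ∈ Icc 0 r, 0 < deriv χ x)
    (hGχ : ∀ x ∈ Icc 0 r, G x = G 0 + χ x ^ l) :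
    ∃ C, 0 ≤ C ∧ ∀ s ∈ Ioo 0 r, ∀ t₁ ∈ Icc 0 r, ∀ t₂ ∈ Icc 0 r, t₁ ≠ s → t₂ ≠ s → t₁ < t₂ →
      slopeDefect G s t₂ ≤ slopeDefect G s t₁ + C := by
  obtain ⟨m, hm, hmd⟩ := exists_pos_le_deriv hχ hχpos
  obtain ⟨M, hM0, hM⟩ := hχ.exists_abs_deriv_sub_le 0 r
  have hd : Differentiable ℝ χ := hχ.differentiable two_ne_zero
  have hslope : ∀ᵉ (x ∈ Icc 0 r) (y ∈ Icc 0 r), x ≤ y → m * (y - x) ≤ χ y - χ x :=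
    (convex_Icc _ _).mul_sub_le_image_sub_of_le_deriv hd.continuous.continuousOn
      hd.differentiableOn fun x hx => hmd x (interior_subset hx)
  have hnn : ∀ x ∈ Icc 0 r, 0 ≤ χ x := fun x hx => by
    have := hslope 0 ⟨le_rfl, hr⟩ x hx hx.1
    rw [hχ0] at this
    nlinarith [hx.1]
  have hmono : StrictMonoOn χ (Icc 0 r) := fun x hx y hy hxy => by
    have := hslope x hx y hy hxy.le
    nlinarith
  refine ⟨2 * (M / m), by positivity, fun s hs t₁ ht₁ t₂ ht₂ h₁ h₂ h12 => ?_⟩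
  have hsI : s ∈ Icc 0 r := Ioo_subset_Icc_self hs
  have hχs : 0 < χ s := by
    have := hmono ⟨le_rfl, hr⟩ hsI hs.1
    rwa [hχ0] at this
  have hbd : ∀ t ∈ Icc 0 r, t ≠ s → |slopeDefect χ s t| ≤ M / m := fun t ht hts =>
    abs_slopeDefect_le hχ hM0 hM hm hsI ht hts <| by
      rcases le_total s t with h | h
      · rw [abs_of_nonneg (sub_nonneg.2 h)]
        exact (hslope s hsI t ht h).trans (le_abs_self _)
      · rw [abs_of_nonpos (sub_nonpos.2 h), neg_sub, abs_sub_comm]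
        exact (hslope t ht s hsI h).trans (le_abs_self _)
  have hderiv : deriv G s = deriv χ s * deriv (fun x : ℝ => x ^ l) (χ s) := by
    have h1 : G =ᶠ[nhds s] fun x => G 0 + χ x ^ l := by
      filter_upwards [Icc_mem_nhds hs.1 hs.2] with x hx using hGχ x hx
    have h2 : HasDerivAt (fun x : ℝ => x ^ l) (l * χ s ^ (l - 1)) (χ s) :=
      Real.hasDerivAt_rpow_const (Or.inl hχs.ne')
    have h3 := (h2.comp s (hd s).hasDerivAt).const_add (G 0)
    rw [h1.deriv_eq, h2.deriv, mul_comm]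
    exact h3.deriv
  have key : ∀ t ∈ Icc 0 r, t ≠ s → slopeDefect G s t =
      slopeDefect χ s t + deriv χ s * slopeDefect (fun x => x ^ l) (χ s) (χ t) := by
    intro t ht hts
    simp only [slopeDefect]
    rw [hderiv, hGχ t ht, hGχ s hsI]
    ring
  rw [key t₁ ht₁ h₁, key t₂ ht₂ h₂]
  have hne : ∀ t ∈ Icc 0 r, t ≠ s → χ t ≠ χ s := fun t ht hts h => hts (hmono.injOn ht hsI h)
  have h3 := slopeDefect_rpow_anti hl hχs (hnn t₁ ht₁) (hmono ht₁ ht₂ h12).le (hne t₁ ht₁ h₁)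
    (hne t₂ ht₂ h₂)
  have h4 := mul_le_mul_of_nonneg_left h3 (hχpos s hsI).le
  have h5 := abs_le.1 (hbd t₁ ht₁ h₁)
  have h6 := abs_le.1 (hbd t₂ ht₂ h₂)
  linarith [h5.1, h6.2]

lemma exists_slopeDefect_le_left_half {G ψ : ℝ → ℝ} {L l : ℝ} (hL : 0 < L) (hl : 1 < l)
    (hG : ContDiff ℝ 2 G) (hpos : ∀ x ∈ Ioo 0 L, 0 < deriv G x)
    (hψ : ContDiff ℝ 2 ψ) (hψ0 : ψ 0 = 0) (hψd : deriv ψ 0 ≠ 0)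
    (hGψ : ∀ᶠ x in nhds 0, G x = G 0 + |ψ x| ^ l) :
    ∃ C, 0 ≤ C ∧ ∀ s ∈ Ioc 0 (L / 2), ∀ t₁ ∈ Icc 0 L, ∀ t₂ ∈ Icc 0 L, t₁ ≠ s → t₂ ≠ s →
      t₁ < t₂ → slopeDefect G s t₂ ≤ slopeDefect G s t₁ + C := by
  obtain ⟨χ, hχ, hχ0, hχd, hχψ⟩ : ∃ χ : ℝ → ℝ, ContDiff ℝ 2 χ ∧ χ 0 = 0 ∧ 0 < deriv χ 0 ∧
      ∀ x, |ψ x| = |χ x| := by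
    rcases hψd.lt_or_gt with h | h
    · refine ⟨fun x => -ψ x, hψ.neg, by simp [hψ0], ?_, fun x => (abs_neg _).symm⟩
      rw [deriv.fun_neg]; linarith
    · exact ⟨ψ, hψ, hψ0, h, fun _ => rfl⟩
  have hev : ∀ᶠ x in nhds (0 : ℝ), 0 < deriv χ x :=
    (hχ.continuous_deriv one_le_two).continuousAt.eventually (lt_mem_nhds hχd)
  obtain ⟨δ, hδ, hball⟩ := Metric.eventually_nhds_iff.1 (hev.and hGψ)
  set r := min (δ / 2) (L / 2) with hr
  have hr0 : 0 < r := by positivity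
  have hrδ : r < δ := (min_le_left _ _).trans_lt (by linarith)
  have hrL : r ≤ L / 2 := min_le_right _ _
  have hin : ∀ x ∈ Icc 0 r, dist x 0 < δ := fun x hx => by
    rw [Real.dist_eq, sub_zero, abs_of_nonneg hx.1]; linarith [hx.2]
  have hχmono : StrictMonoOn χ (Icc 0 r) :=
    strictMonoOn_of_deriv_pos (convex_Icc _ _) hχ.continuous.continuousOn
      fun x hx => (hball (hin x (interior_subset hx))).1
  obtain ⟨C, hC0, hC⟩ := exists_slopeDefect_le_near_zero (G := G) hr0.le hl hχ hχ0
    (fun x hx => (hball (hin x hx)).1) fun x hx => by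
      rw [(hball (hin x hx)).2, hχψ, abs_of_nonneg]
      have := hχmono.monotoneOn ⟨le_rfl, hr0.le⟩ hx hx.1
      rwa [hχ0] at this
  obtain ⟨M, hM0, hM⟩ := hG.exists_abs_deriv_sub_le 0 L
  obtain ⟨m, hm, hmlow⟩ := exists_mul_abs_sub_le hG hpos (half_pos hr0) (by linarith)
  have hmono := strictMonoOn_Icc_of_deriv_pos_Ioo hG.continuous hpos
  have hgap : 0 < G r - G (r / 2) :=
    sub_pos.2 (hmono ⟨by linarith, by linarith⟩ ⟨by linarith, by linarith⟩ (by linarith))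
  have hfar : ∀ s ∈ Ioo 0 (r / 2), ∀ t ∈ Icc r L,
      |slopeDefect G s t| ≤ M / ((G r - G (r / 2)) / L) := by
    intro s hs t ht
    refine abs_slopeDefect_le hG hM0 hM (by positivity) ⟨hs.1.le, by linarith [hs.2]⟩
      ⟨by linarith [ht.1], ht.2⟩ (by linarith [hs.2, ht.1]) ?_
    have h1 := hmono.monotoneOn ⟨by linarith, by linarith⟩ ⟨by linarith [ht.1], ht.2⟩ ht.1
    have h2 := hmono.monotoneOn ⟨hs.1.le, by linarith [hs.2]⟩ ⟨by linarith, by linarith⟩ hs.2.le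
    refine le_trans ?_ (le_abs_self _)
    rw [abs_of_pos (by linarith [hs.2, ht.1]), div_mul_eq_mul_div, div_le_iff₀ hL]
    have : t - s ≤ L := by linarith [hs.1, ht.2]
    have : (G r - G (r / 2)) * (t - s) ≤ (G t - G s) * L := by
      apply mul_le_mul <;> linarith [hs.2, ht.1]
    exact this
  set B := M / ((G r - G (r / 2)) / L) with hB
  have hB0 : 0 ≤ B := by positivity
  refine ⟨C + 2 * B + 2 * (M / m), by positivity, fun s hs t₁ ht₁ t₂ ht₂ h₁ h₂ h12 => ?_⟩
  have hMm : 0 ≤ M / m := by positivity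
  rcases lt_or_ge s (r / 2) with hsr | hsr
  · have hs' : s ∈ Ioo 0 (r / 2) := ⟨hs.1, hsr⟩
    have hsr' : s ∈ Ioo 0 r := ⟨hs.1, by linarith⟩
    rcases le_total t₂ r with h2r | h2r
    · linarith [hC s hsr' t₁ ⟨ht₁.1, by linarith⟩ t₂ ⟨ht₂.1, h2r⟩ h₁ h₂ h12]
    · have b2 := abs_le.1 (hfar s hs' t₂ ⟨h2r, ht₂.2⟩)
      rcases lt_or_ge t₁ r with h1r | h1r
      · have b1 := abs_le.1 (hfar s hs' r ⟨le_rfl, by linarith⟩)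
        linarith [hC s hsr' t₁ ⟨ht₁.1, h1r.le⟩ r ⟨hr0.le, le_rfl⟩ h₁ (by linarith) h1r, b1.1, b2.2]
      · have b1 := abs_le.1 (hfar s hs' t₁ ⟨h1r, ht₁.2⟩)
        linarith [b1.1, b2.2]
  · have hb : ∀ t ∈ Icc 0 L, t ≠ s → |slopeDefect G s t| ≤ M / m := fun t ht hts =>
      abs_slopeDefect_le hG hM0 hM hm ⟨hs.1.le, by linarith [hs.2]⟩ ht hts
        (hmlow s ⟨hsr, hs.2⟩ t ht)
    have b1 := abs_le.1 (hb t₁ ht₁ h₁)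
    have b2 := abs_le.1 (hb t₂ ht₂ h₂)
    linarith [b1.1, b2.2]

lemma slopeDefect_reflect (G : ℝ → ℝ) (L c s t : ℝ) :
    slopeDefect (fun x => c - G (L - x)) s t = -slopeDefect G (L - s) (L - t) := by
  have hd : deriv (fun x => c - G (L - x)) s = deriv G (L - s) := by
    rw [deriv_const_sub, deriv_comp_const_sub, neg_neg]
  rw [slopeDefect, slopeDefect, hd, show L - t - (L - s) = -(t - s) by ring,
    show c - G (L - t) - (c - G (L - s)) = -(G (L - t) - G (L - s)) by ring, div_neg, div_neg]
  ring

lemma exists_slopeDefect_le {G ψ φ : ℝ → ℝ} {L l k : ℝ} (hL : 0 < L) (hl : 1 < l) (hk : 1 < k)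
    (hG : ContDiff ℝ 2 G) (hpos : ∀ x ∈ Ioo 0 L, 0 < deriv G x)
    (hψ : ContDiff ℝ 2 ψ) (hψ0 : ψ 0 = 0) (hψd : deriv ψ 0 ≠ 0)
    (hGψ : ∀ᶠ x in nhds 0, G x = G 0 + |ψ x| ^ l)
    (hφ : ContDiff ℝ 2 φ) (hφ0 : φ L = 0) (hφd : deriv φ L ≠ 0)
    (hGφ : ∀ᶠ x in nhds L, G x = G L - |φ x| ^ k) :
    ∃ C, 0 ≤ C ∧ ∀ s ∈ Ioo 0 L, ∀ t₁ ∈ Icc 0 L, ∀ t₂ ∈ Icc 0 L, t₁ ≠ s → t₂ ≠ s →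
      t₁ < t₂ → slopeDefect G s t₂ ≤ slopeDefect G s t₁ + C := by
  obtain ⟨C, hC0, hC⟩ := exists_slopeDefect_le_left_half hL hl hG hpos hψ hψ0 hψd hGψ
  have hrefl : ContDiff ℝ 2 fun x : ℝ => L - x := contDiff_const.sub contDiff_id
  obtain ⟨C', hC0', hC'⟩ := exists_slopeDefect_le_left_half (G := fun x => 0 - G (L - x))
    (ψ := fun x => φ (L - x)) hL hk (contDiff_const.sub (hG.comp hrefl))
    (fun x hx => by
      rw [deriv_const_sub, deriv_comp_const_sub, neg_neg]
      exact hpos _ ⟨by linarith [hx.2], by linarith [hx.1]⟩)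
    (hφ.comp hrefl) (by simpa using hφ0) (by rw [deriv_comp_const_sub]; simpa using hφd)
    (by
      have : Tendsto (fun x : ℝ => L - x) (nhds 0) (nhds L) := by
        have := (continuous_sub_left L).tendsto 0
        rwa [sub_zero] at this
      filter_upwards [this.eventually hGφ] with x hx
      rw [hx]; simp; ring)
  refine ⟨C + C', by positivity, fun s hs t₁ ht₁ t₂ ht₂ h₁ h₂ h12 => ?_⟩
  rcases le_total s (L / 2) with h | h
  · linarith [hC s ⟨hs.1, h⟩ t₁ ht₁ t₂ ht₂ h₁ h₂ h12]
  · have := hC' (L - s) ⟨by linarith [hs.2], by linarith⟩ (L - t₂)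
      ⟨by linarith [ht₂.2], by linarith [ht₂.1]⟩ (L - t₁) ⟨by linarith [ht₁.2], by linarith [ht₁.1]⟩
      (by contrapose! h₂; linarith) (by contrapose! h₁; linarith) (by linarith)
    simp only [slopeDefect_reflect, sub_sub_cancel] at this
    linarith

/-- The cross-ratio of four points, small when the middle interval `[b, c]` is short compared
with one of its neighbours. -/
def crossRatio (a b c d : ℝ) : ℝ := (c - b) * (d - a) / ((b - a) * (d - c))

lemma hasDerivAt_log_dslope {F : ℝ → ℝ} {s p : ℝ} (hF : DifferentiableAt ℝ F s) (hsp : s ≠ p)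
    (hpos : 0 < dslope F p s) :
    HasDerivAt (fun x => Real.log (dslope F p x)) (slopeDefect F s p) s := by
  have h1 : dslope F p =ᶠ[nhds s] fun x => (F x - F p) / (x - p) := by
    filter_upwards [isOpen_ne.mem_nhds hsp] with x hx
    rw [dslope_of_ne _ hx, slope_def_field]
  have hne : s - p ≠ 0 := sub_ne_zero.2 hsp
  have hF0 : F s - F p ≠ 0 := by
    rw [h1.eq_of_nhds] at hpos
    intro h; simp [h] at hpos
  have h2 : HasDerivAt (fun x => (F x - F p) / (x - p))
      ((deriv F s * (s - p) - (F s - F p) * 1) / (s - p) ^ 2) s :=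
    (hF.hasDerivAt.sub_const _).div ((hasDerivAt_id s).sub_const p) hne
  have h3 := (h2.congr_of_eventuallyEq h1).log hpos.ne'
  convert h3 using 1
  have hF0' : F p - F s ≠ 0 := by rw [← neg_sub]; exact neg_ne_zero.2 hF0
  have hne' : p - s ≠ 0 := by rw [← neg_sub]; exact neg_ne_zero.2 hne
  rw [h1.eq_of_nhds, slopeDefect]
  field_simp
  ring

lemma crossRatio_le_exp_mul {F : ℝ → ℝ} {L C : ℝ} (hF : ContDiff ℝ 2 F)
    (hpos : ∀ x ∈ Ioo 0 L, 0 < deriv F x)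
    (hC : ∀ s ∈ Ioo 0 L, ∀ t₁ ∈ Icc 0 L, ∀ t₂ ∈ Icc 0 L, t₁ ≠ s → t₂ ≠ s →
      t₁ < t₂ → slopeDefect F s t₂ ≤ slopeDefect F s t₁ + C)
    {a b c d : ℝ} (ha : 0 ≤ a) (hab : a < b) (hbc : b < c) (hcd : c < d) (hd : d ≤ L) :
    crossRatio a b c d ≤ Real.exp (C * (c - a)) * crossRatio (F a) (F b) (F c) (F d) := by
  have hdiff : Differentiable ℝ F := hF.differentiable two_ne_zero
  have hmono := strictMonoOn_Icc_of_deriv_pos_Ioo hF.continuous hpos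
  have hslope : ∀ p ∈ Icc 0 L, ∀ s ∈ Icc 0 L, s ≠ p → 0 < dslope F p s := by
    intro p hp s hs hne
    rw [dslope_of_ne _ hne, slope_def_field]
    rcases hne.lt_or_gt with h | h
    · exact div_pos_of_neg_of_neg (sub_neg.2 (hmono hs hp h)) (sub_neg.2 h)
    · exact div_pos (sub_pos.2 (hmono hp hs h)) (sub_pos.2 h)
  have hbI : b ∈ Icc 0 L := ⟨by linarith, by linarith⟩
  have hdI : d ∈ Icc 0 L := ⟨by linarith, by linarith⟩
  have hposb : ∀ s ∈ Icc a c, 0 < dslope F b s := by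
    intro s hs
    rcases eq_or_ne s b with rfl | h
    · rw [dslope_same]; exact hpos _ ⟨by linarith, by linarith⟩
    · exact hslope b hbI s ⟨by linarith [hs.1], by linarith [hs.2]⟩ h
  have hposd : ∀ s ∈ Icc a c, 0 < dslope F d s := fun s hs =>
    hslope d hdI s ⟨by linarith [hs.1], by linarith [hs.2]⟩ (by linarith [hs.2])
  have hcont : ∀ p, Continuous (dslope F p) := fun p => by
    rw [← continuousOn_univ, continuousOn_dslope univ_mem]
    exact ⟨hdiff.continuous.continuousOn, hdiff p⟩
  let E : ℝ → ℝ := fun s => Real.log (dslope F b s) - Real.log (dslope F d s) + C * s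
  have hEc : ContinuousOn E (Icc a c) :=
    (((hcont b).continuousOn.log fun s hs => (hposb s hs).ne').sub
      ((hcont d).continuousOn.log fun s hs => (hposd s hs).ne')).add (by fun_prop)
  have hEd : ∀ s ∈ Ioo a c, s ≠ b →
      HasDerivAt E (slopeDefect F s b - slopeDefect F s d + C) s := by
    intro s hs hsb
    have hs' := Ioo_subset_Icc_self hs
    have h1 := hasDerivAt_log_dslope (hdiff s) hsb (hposb s hs')
    have h2 := hasDerivAt_log_dslope (p := d) (hdiff s) (by linarith [hs.2]) (hposd s hs')
    have h3 : HasDerivAt (fun s : ℝ => C * s) C s := by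
      simpa using (hasDerivAt_id s).const_mul C
    exact (h1.sub h2).add h3
  have hEn : ∀ s ∈ Ioo a c, s ≠ b → 0 ≤ deriv E s := by
    intro s hs hsb
    rw [(hEd s hs hsb).deriv]
    have := hC s ⟨by linarith [hs.1], by linarith [hs.2]⟩ b hbI d hdI hsb.symm
      (by linarith [hs.2]) (by linarith)
    linarith
  have m1 : MonotoneOn E (Icc a b) := by
    apply monotoneOn_of_deriv_nonneg (convex_Icc a b)
      (hEc.mono (Icc_subset_Icc_right hbc.le)) <;> rw [interior_Icc] <;> intro s hs
    · exact (hEd s ⟨hs.1, hs.2.trans hbc⟩ hs.2.ne).differentiableAt.differentiableWithinAt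
    · exact hEn s ⟨hs.1, hs.2.trans hbc⟩ hs.2.ne
  have m2 : MonotoneOn E (Icc b c) := by
    apply monotoneOn_of_deriv_nonneg (convex_Icc b c)
      (hEc.mono (Icc_subset_Icc_left hab.le)) <;> rw [interior_Icc] <;> intro s hs
    · exact (hEd s ⟨hab.trans hs.1, hs.2⟩ hs.1.ne').differentiableAt.differentiableWithinAt
    · exact hEn s ⟨hab.trans hs.1, hs.2⟩ hs.1.ne'
  have hE : E a ≤ E c := (m1 ⟨le_rfl, hab.le⟩ ⟨hab.le, le_rfl⟩ hab.le).trans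
    (m2 ⟨le_rfl, hbc.le⟩ ⟨hbc.le, le_rfl⟩ hbc.le)
  have ha' : a ∈ Icc a c := ⟨le_rfl, by linarith⟩
  have hc' : c ∈ Icc a c := ⟨by linarith, le_rfl⟩
  have hlog : Real.log (dslope F b a * dslope F d c) ≤
      Real.log (Real.exp (C * (c - a)) * (dslope F b c * dslope F d a)) := by
    rw [Real.log_mul (hposb a ha').ne' (hposd c hc').ne', Real.log_mul (Real.exp_pos _).ne'
      (mul_pos (hposb c hc') (hposd a ha')).ne', Real.log_mul (hposb c hc').ne' (hposd a ha').ne',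
      Real.log_exp]
    simp only [E] at hE
    linarith
  rw [Real.log_le_log_iff (mul_pos (hposb a ha') (hposd c hc'))
    (mul_pos (Real.exp_pos _) (mul_pos (hposb c hc') (hposd a ha')))] at hlog
  have aI : a ∈ Icc 0 L := ⟨ha, by linarith⟩
  have cI : c ∈ Icc 0 L := ⟨by linarith, by linarith⟩
  have f1 := sub_pos.2 (hmono aI hbI hab)
  have f2 := sub_pos.2 (hmono hbI cI hbc)
  have f3 := sub_pos.2 (hmono cI hdI hcd)
  have f4 := sub_pos.2 (hmono aI hdI (by linarith))
  have g1 := sub_pos.2 hab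
  have g2 := sub_pos.2 hbc
  have g3 := sub_pos.2 hcd
  have g4 : 0 < d - a := by linarith
  have sl : ∀ p q, p < q → dslope F q p = (F q - F p) / (q - p) := fun p q h => by
    rw [dslope_of_ne _ h.ne, slope_comm, slope_def_field]
  have sl' : ∀ p q, p < q → dslope F p q = (F q - F p) / (q - p) := fun p q h => by
    rw [dslope_of_ne _ h.ne', slope_def_field]
  rw [sl a b hab, sl c d hcd, sl' b c hbc, sl a d (by linarith)] at hlog
  have e1 : crossRatio a b c d = (F b - F a) / (b - a) * ((F d - F c) / (d - c)) *
      ((c - b) * (d - a) / ((F b - F a) * (F d - F c))) := by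
    rw [crossRatio]; field_simp
  have e2 : Real.exp (C * (c - a)) * crossRatio (F a) (F b) (F c) (F d) =
      Real.exp (C * (c - a)) * ((F c - F b) / (c - b) * ((F d - F a) / (d - a))) *
      ((c - b) * (d - a) / ((F b - F a) * (F d - F c))) := by
    rw [crossRatio]; field_simp
  rw [e1, e2]
  exact mul_le_mul_of_nonneg_right hlog (by positivity)

/-- A set each of whose points has, at arbitrarily small scales on its left, a hole of
comparable size, is Lebesgue null. -/
lemma volume_eq_zero_of_porous {E : Set ℝ} {κ : ℝ} (hκ : 0 < κ)
    (h : ∀ x ∈ E, ∀ r > 0, ∃ b < x, x - b < r ∧ Disjoint (Ioo (b - κ * (x - b)) b) E) :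
    volume E = 0 := by
  have hdens := IsUnifLocDoublingMeasure.ae_tendsto_measure_inter_div (volume : Measure ℝ) E 1
  have hnot : ∀ x ∈ E, ¬ (∀ {ι : Type} {l : Filter ι} (w : ι → ℝ) (δ : ι → ℝ)
      (_ : Tendsto δ l (nhdsWithin 0 (Ioi 0)))
      (_ : ∀ᶠ j in l, x ∈ Metric.closedBall (w j) (1 * δ j)),
      Tendsto (fun j => volume (E ∩ Metric.closedBall (w j) (δ j)) /
        volume (Metric.closedBall (w j) (δ j))) l (nhds 1)) := by
    intro x hx hlim
    choose b hb using fun n : ℕ => h x hx (1 / ((n : ℝ) + 1)) (by positivity)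
    have hpos : ∀ n, 0 < x - b n := fun n => sub_pos.2 (hb n).1
    let δ : ℕ → ℝ := fun n => (1 + κ) * (x - b n) / 2
    let w : ℕ → ℝ := fun n => x - δ n
    have hδpos : ∀ n, 0 < δ n := fun n => by have := hpos n; positivity
    have hball : ∀ n, Metric.closedBall (w n) (δ n) = Icc (b n - κ * (x - b n)) x := fun n => by
      rw [Real.closedBall_eq_Icc]; simp only [w, δ]; congr 1 <;> ring
    have hδ : Tendsto δ atTop (nhdsWithin 0 (Ioi 0)) := by
      refine tendsto_nhdsWithin_iff.2 ⟨?_, Eventually.of_forall hδpos⟩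
      have h1 : Tendsto (fun n : ℕ => (1 + κ) * (1 / ((n : ℝ) + 1)) / 2) atTop (nhds 0) := by
        simpa using (tendsto_one_div_add_atTop_nhds_zero_nat.const_mul (1 + κ)).div_const 2
      refine squeeze_zero (fun n => (hδpos n).le) (fun n => ?_) h1
      have := (hb n).2.1.le
      simp only [δ]
      gcongr
    have ht := hlim w δ hδ (Eventually.of_forall fun n => by
      rw [one_mul, hball]; exact ⟨by nlinarith [hpos n], le_rfl⟩)
    have hle : ∀ n, volume (E ∩ Metric.closedBall (w n) (δ n)) /
        volume (Metric.closedBall (w n) (δ n)) ≤ ENNReal.ofReal (1 / (1 + κ)) := by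
      intro n
      have hsub : E ∩ Metric.closedBall (w n) (δ n) ⊆
          {b n - κ * (x - b n)} ∪ Icc (b n) x := by
        rintro y ⟨hyE, hyB⟩
        rw [hball] at hyB
        by_cases h1 : y = b n - κ * (x - b n)
        · exact Or.inl h1
        · refine Or.inr ⟨?_, hyB.2⟩
          by_contra! h2
          exact disjoint_left.1 (hb n).2.2 ⟨lt_of_le_of_ne hyB.1 (Ne.symm h1), h2⟩ hyE
      have h1 : volume (E ∩ Metric.closedBall (w n) (δ n)) ≤ ENNReal.ofReal (x - b n) := by
        refine (measure_mono hsub).trans ((measure_union_le _ _).trans ?_)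
        simp
      rw [hball, Real.volume_Icc, ← hball]
      refine (ENNReal.div_le_div_right h1 _).trans ?_
      rw [← ENNReal.ofReal_div_of_pos (by nlinarith [hpos n])]
      apply ENNReal.ofReal_le_ofReal
      rw [div_le_div_iff₀ (by nlinarith [hpos n]) (by positivity)]
      nlinarith
    have h1 := le_of_tendsto ht (Eventually.of_forall hle)
    rw [ENNReal.one_le_ofReal, le_div_iff₀ (by positivity)] at h1
    linarith
  have h0 : ∀ᵐ x ∂(volume.restrict E), x ∉ E := by
    filter_upwards [hdens] with x hx hxE
    exact hnot x hxE fun w δ h1 h2 => hx w δ h1 h2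
  have h1 := ae_iff.1 h0
  simp only [not_not, ofPred_mem_eq] at h1
  rwa [Measure.restrict_apply_self] at h1

/-- Intervals lying in unit cells and pairwise disjoint modulo `1` have total length at most `1`. -/
lemma sum_length_le_one_s8 {s : Finset ℕ} {a b : ℕ → ℝ} {N : ℕ → ℤ}
    (hab : ∀ i ∈ s, a i ≤ b i) (ha : ∀ i ∈ s, N i ≤ a i) (hb : ∀ i ∈ s, b i ≤ N i + 1)
    (hdisj : ∀ i ∈ s, ∀ j ∈ s, i < j → ∀ x ∈ Ioo (a i) (b i), ∀ m : ℤ,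
      x + m ∉ Ioo (a j) (b j)) :
    ∑ i ∈ s, (b i - a i) ≤ 1 := by
  have hd : (s : Set ℕ).PairwiseDisjoint fun i => Ioo (a i - N i) (b i - N i) := by
    have hlt : ∀ i ∈ s, ∀ j ∈ s, i < j →
        Disjoint (Ioo (a i - N i) (b i - N i)) (Ioo (a j - N j) (b j - N j)) := by
      intro i hi j hj hij
      refine disjoint_left.2 fun x hx hx' => ?_
      apply hdisj i hi j hj hij (x + N i) ⟨by linarith [hx.1], by linarith [hx.2]⟩ (N j - N i)
      push_cast
      exact ⟨by linarith [hx'.1], by linarith [hx'.2]⟩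
    intro i hi j hj hij
    rcases hij.lt_or_gt with h | h
    · exact hlt i hi j hj h
    · exact (hlt j hj i hi h).symm
  have h1 := measure_biUnion_finset hd (fun i _ => measurableSet_Ioo) (μ := volume)
  have h2 : volume (⋃ i ∈ s, Ioo (a i - N i) (b i - N i)) ≤ volume (Icc (0 : ℝ) 1) :=
    measure_mono (iUnion₂_subset fun i hi x hx =>
      ⟨by linarith [hx.1, ha i hi], by linarith [hx.2, hb i hi]⟩)
  rw [h1, Real.volume_Icc] at h2
  have h3 : ∑ i ∈ s, volume (Ioo (a i - N i) (b i - N i)) =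
      ENNReal.ofReal (∑ i ∈ s, (b i - a i)) := by
    rw [ENNReal.ofReal_sum_of_nonneg fun i hi => sub_nonneg.2 (hab i hi)]
    exact Finset.sum_congr rfl fun i _ => by rw [Real.volume_Ioo]; congr 1; ring
  rw [h3, sub_zero, ENNReal.ofReal_le_ofReal_iff zero_le_one] at h2
  exact h2

lemma map_add_int_of_map_add_one {F : ℝ → ℝ} (hF : ∀ x, F (x + 1) = F x + 1) (x : ℝ) (m : ℤ) :
    F (x + m) = F x + m := by
  have hp : Function.Periodic (fun x => F x - x) 1 := fun x => by simp only [hF]; ring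
  have := hp.int_mul m x
  simp only [mul_one] at this
  linarith

/-- A `C²` lift `F` of a degree one map of the circle, increasing on `[0, L]` with bounded slope
defect there, whose periodic points are repelling and such that the forward orbits of `0` and
`L` avoid certain one-sided or two-sided neighbourhoods of `0` and `L` modulo `1`. -/
structure GapLift where
  F : ℝ → ℝ
  L : ℝ
  η : ℝ
  C : ℝ
  L_pos : 0 < L
  η_pos : 0 < η
  η_le : η ≤ 1 - L
  C_nonneg : 0 ≤ C
  map_add_one : ∀ x, F (x + 1) = F x + 1
  contDiff : ContDiff ℝ 2 F
  deriv_pos : ∀ x ∈ Ioo 0 L, 0 < deriv F x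
  defect : ∀ s ∈ Ioo 0 L, ∀ t₁ ∈ Icc 0 L, ∀ t₂ ∈ Icc 0 L, t₁ ≠ s → t₂ ≠ s →
    t₁ < t₂ → slopeDefect F s t₂ ≤ slopeDefect F s t₁ + C
  orbit_zero_left : ∀ j : ℕ, 1 ≤ j → ∀ m : ℤ, F^[j] 0 - m ∉ Ioc (-η) 0
  orbit_zero_near : ∀ j : ℕ, 1 ≤ j → ∀ m : ℤ, F^[j] 0 - m ∉ Ioo (L - η) (L + η)
  orbit_L_right : ∀ j : ℕ, 1 ≤ j → ∀ m : ℤ, F^[j] L - m ∉ Ico L (L + η)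
  orbit_L_near : ∀ j : ℕ, 1 ≤ j → ∀ m : ℤ, F^[j] L - m ∉ Ioo (-η) η
  repelling : ∀ (x : ℝ) (n : ℕ), 1 ≤ n → (∃ m : ℤ, F^[n] x = x + m) → 1 < |deriv (F^[n]) x|

namespace GapLift

variable (T : GapLift)

lemma L_lt_one : T.L < 1 := by linarith [T.η_pos, T.η_le]

lemma continuous : Continuous T.F := T.contDiff.continuous

lemma continuous_iterate (n : ℕ) : Continuous (T.F^[n]) := T.continuous.iterate n

lemma differentiable_iterate (n : ℕ) : Differentiable ℝ (T.F^[n]) :=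
  (T.contDiff.differentiable two_ne_zero).iterate n

lemma map_add_int (x : ℝ) (m : ℤ) : T.F (x + m) = T.F x + m :=
  map_add_int_of_map_add_one T.map_add_one x m

lemma iterate_add_int (n : ℕ) (x : ℝ) (m : ℤ) : T.F^[n] (x + m) = T.F^[n] x + m := by
  induction n generalizing x with
  | zero => rfl
  | succ n ih => rw [Function.iterate_succ_apply, Function.iterate_succ_apply, map_add_int, ih]

lemma strictMonoOn (N : ℤ) : StrictMonoOn T.F (Icc N (N + T.L)) := by
  intro x hx y hy hxy
  have h := strictMonoOn_Icc_of_deriv_pos_Ioo T.continuous T.deriv_pos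
    (a := x - N) ⟨by linarith [hx.1], by linarith [hx.2]⟩
    (b := y - N) ⟨by linarith [hy.1], by linarith [hy.2]⟩ (by linarith)
  have e : ∀ z : ℝ, T.F z = T.F (z - N) + N := fun z => by
    rw [← T.map_add_int, sub_add_cancel]
  rw [e x, e y]; linarith

lemma eventually_one_lt_slope {n : ℕ} {p : ℝ} {m : ℤ} (hn : 1 ≤ n)
    (hp : T.F^[n] p = p + m) {l : Filter ℝ} [l.NeBot] (hl : l ≤ nhdsWithin p {p}ᶜ)
    (hmono : ∀ᶠ y in l, 0 ≤ slope (T.F^[n]) p y) : ∀ᶠ y in l, 1 < slope (T.F^[n]) p y := by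
  have h1 := T.repelling p n hn ⟨m, hp⟩
  have h2 : Tendsto (slope (T.F^[n]) p) l (nhds (deriv (T.F^[n]) p)) :=
    (hasDerivAt_iff_tendsto_slope.1 ((T.differentiable_iterate n) p).hasDerivAt).mono_left hl
  have h3 : 0 ≤ deriv (T.F^[n]) p := ge_of_tendsto h2 hmono
  rw [abs_of_nonneg h3] at h1
  exact h2.eventually (lt_mem_nhds h1)

/-- An iterate, translated by an integer, which is monotone on `[u, v]` does not map `[u, v]`
into itself: otherwise it would have a periodic point that is not repelling. -/
lemma not_trapped {n : ℕ} {u v : ℝ} {m : ℤ} (hn : 1 ≤ n) (huv : u < v)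
    (hmono : MonotoneOn (T.F^[n]) (Icc u v)) (hu : u + m ≤ T.F^[n] u)
    (hv : T.F^[n] v ≤ v + m) : False := by
  have hslope : ∀ p ∈ Icc u v, ∀ y ∈ Icc u v, p ≠ y → 0 ≤ slope (T.F^[n]) p y := by
    intro p hp y hy hne
    rw [slope_def_field]
    rcases le_total p y with h | h
    · exact div_nonneg (sub_nonneg.2 (hmono hp hy h)) (sub_nonneg.2 h)
    · exact div_nonneg_of_nonpos (sub_nonpos.2 (hmono hy hp h)) (sub_nonpos.2 h)
  have main : ∀ w, u ≤ w → w ≤ v → T.F^[n] w < w + m → False := by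
    intro w huw hwv hw
    have huw' : u < w := lt_of_le_of_ne huw (by rintro rfl; linarith)
    let Z := Icc u w ∩ {y | y + m ≤ T.F^[n] y}
    have hZc : IsCompact Z := isCompact_Icc.inter_right
      (isClosed_le (continuous_id.add continuous_const) (T.continuous_iterate n))
    obtain ⟨p, ⟨hpI, hpZ⟩, hmax⟩ := hZc.exists_isGreatest ⟨u, ⟨le_rfl, huw⟩, hu⟩
    have hpw : p < w := lt_of_le_of_ne hpI.2 (by rintro rfl; exact absurd hw (not_lt.2 hpZ))
    have hafter : ∀ y ∈ Ioc p w, T.F^[n] y < y + m := fun y hy => by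
      by_contra! h
      exact absurd (hmax ⟨⟨hpI.1.trans hy.1.le, hy.2⟩, h⟩) (not_le.2 hy.1)
    have hmem : ∀ᶠ y in nhdsWithin p (Ioi p), y ∈ Ioc p w := Ioc_mem_nhdsGT hpw
    have hpeq : T.F^[n] p = p + m := by
      refine le_antisymm ?_ hpZ
      have h1 : Tendsto (T.F^[n]) (nhdsWithin p (Ioi p)) (nhds (T.F^[n] p)) :=
        (T.continuous_iterate n).continuousAt.mono_left nhdsWithin_le_nhds
      have h2 : Tendsto (fun y : ℝ => y + m) (nhdsWithin p (Ioi p)) (nhds (p + m)) :=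
        (continuous_id.add continuous_const).continuousAt.mono_left nhdsWithin_le_nhds
      exact le_of_tendsto_of_tendsto h1 h2 (hmem.mono fun y hy => (hafter y hy).le)
    have := T.eventually_one_lt_slope hn hpeq (l := nhdsWithin p (Ioi p))
      (nhdsWithin_mono p fun y (hy : p < y) => hy.ne')
      (hmem.mono fun y hy => hslope p ⟨hpI.1, hpI.2.trans hwv⟩ y
        ⟨hpI.1.trans hy.1.le, hy.2.trans hwv⟩ hy.1.ne)
    obtain ⟨y, hy1, hy2⟩ := (this.and hmem).exists
    rw [slope_def_field, lt_div_iff₀ (sub_pos.2 hy2.1), hpeq] at hy1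
    linarith [hafter y hy2]
  rcases hv.lt_or_eq with h | h
  · exact main v huv.le le_rfl h
  · have hmem : ∀ᶠ y in nhdsWithin v (Iio v), y ∈ Ico u v := Ico_mem_nhdsLT huv
    have := T.eventually_one_lt_slope hn h (l := nhdsWithin v (Iio v))
      (nhdsWithin_mono v fun y (hy : y < v) => hy.ne)
      (hmem.mono fun y hy => hslope v ⟨huv.le, le_rfl⟩ y ⟨hy.1, hy.2.le⟩ hy.2.ne')
    obtain ⟨y, hy1, hy2⟩ := (this.and hmem).exists
    rw [slope_comm, slope_def_field, lt_div_iff₀ (sub_pos.2 hy2.2), h] at hy1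
    exact main y hy2.1 hy2.2.le (by linarith)

/-- Points whose orbit stays in the open arc `(0, L)` modulo `1`. -/
def staying : Set ℝ := {x | ∀ n : ℕ, Int.fract (T.F^[n] x) ∈ Ioo 0 T.L}

lemma crossRatio_le {N : ℤ} {a b c d : ℝ} (ha : N ≤ a) (hab : a < b) (hbc : b < c) (hcd : c < d)
    (hd : d ≤ N + T.L) :
    crossRatio a b c d ≤
      Real.exp (T.C * (c - a)) * crossRatio (T.F a) (T.F b) (T.F c) (T.F d) := by
  have h := crossRatio_le_exp_mul T.contDiff T.deriv_pos T.defect (a := a - N) (b := b - N)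
    (c := c - N) (d := d - N) (by linarith) (by linarith) (by linarith) (by linarith) (by linarith)
  have e : ∀ z : ℝ, T.F (z - N) = T.F z - N := fun z => by
    rw [eq_sub_iff_add_eq, ← T.map_add_int, sub_add_cancel]
  simpa only [e, crossRatio, sub_sub_sub_cancel_right] using h

/-- At a time of closest approach to `0` from the right, a neighbourhood of `0` of fixed size
can be pulled back along the orbit inside the region where `F` is increasing. -/
lemma exists_pullback (n : ℕ) : ∀ (x : ℝ) (M : ℤ) (z : ℝ), T.F^[n] x = M + z → 0 < z → z < T.η →
    (∀ i < n, Int.fract (T.F^[i] x) ∈ Ioo 0 T.L) → (∀ i < n, z < Int.fract (T.F^[i] x)) →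
    ∃ a b d, a < b ∧ b < x ∧ x < d ∧ T.F^[n] a = M - T.η ∧ T.F^[n] b = M ∧ T.F^[n] d = M + T.η ∧
      (∀ i < n, ⌊T.F^[i] x⌋ ≤ T.F^[i] a ∧ T.F^[i] d ≤ ⌊T.F^[i] x⌋ + T.L) ∧
      ∀ i ≤ n, StrictMonoOn (T.F^[i]) (Icc a d) := by
  induction n with
  | zero =>
    intro x M z hx hz hzη _ _
    simp only [Function.iterate_zero, id] at hx
    refine ⟨M - T.η, M, M + T.η, by linarith [T.η_pos], by linarith, by linarith, rfl, rfl, rfl,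
      by simp, fun i hi => ?_⟩
    obtain rfl : i = 0 := by omega
    exact strictMonoOn_id
  | succ n ih =>
    intro x M z hx hz hzη hstay hclose
    obtain ⟨a', b', d', hab, hbx, hxd, ha, hb, hd, hin, hmono⟩ := ih (T.F x) M z hx hz hzη
      (fun i hi => hstay (i + 1) (by omega)) (fun i hi => hclose (i + 1) (by omega))
    obtain ⟨hf0, hfL⟩ := hstay 0 (by omega)
    have hzx := hclose 0 (by omega)
    simp only [Function.iterate_zero, id] at hf0 hfL hzx
    set N := ⌊x⌋ with hN
    have hfr : Int.fract x = x - N := rfl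
    rw [hfr] at hf0 hfL hzx
    have hFm := T.strictMonoOn N
    have hxI : x ∈ Icc (N : ℝ) (N + T.L) := ⟨by linarith, by linarith⟩
    have hNI : (N : ℝ) ∈ Icc (N : ℝ) (N + T.L) := ⟨le_rfl, by linarith⟩
    have hLI : (N : ℝ) + T.L ∈ Icc (N : ℝ) (N + T.L) := ⟨by linarith, le_rfl⟩
    have hFNx : T.F N < T.F x := hFm hNI hxI (by linarith)
    have hFxL : T.F x < T.F (N + T.L) := hFm hxI hLI (by linarith)
    have hFxI : T.F x ∈ Icc a' d' := ⟨by linarith, by linarith⟩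
    have ha'I : a' ∈ Icc a' d' := ⟨le_rfl, by linarith⟩
    have hd'I : d' ∈ Icc a' d' := ⟨by linarith, le_rfl⟩
    have hleft : T.F N ≤ a' := by
      by_contra! hlt
      have hNI' : T.F N ∈ Icc a' d' := ⟨hlt.le, by linarith⟩
      have h1 := hmono n le_rfl ha'I hNI' hlt
      have hF0 : T.F^[n] (T.F N) = T.F^[n + 1] 0 + N := by
        rw [← T.iterate_add_int, zero_add, Function.iterate_succ_apply]
      have h3 := T.orbit_zero_left (n + 1) (by omega) (M - N)
      push_cast at h3
      have h4 : (M : ℝ) < T.F^[n] (T.F N) := by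
        by_contra! h5
        exact h3 ⟨by linarith, by linarith⟩
      refine T.not_trapped (n := n + 1) (u := N) (v := x) (m := M - N) (by omega) (by linarith)
        ?_ ?_ ?_
      · intro p hp q hq hpq
        have hmem : ∀ y ∈ Icc (N : ℝ) x, y ∈ Icc (N : ℝ) (N + T.L) := fun y hy =>
          ⟨hy.1, hy.2.trans hxI.2⟩
        have hmem' : ∀ y ∈ Icc (N : ℝ) x, T.F y ∈ Icc a' d' := fun y hy =>
          ⟨hlt.le.trans (hFm.monotoneOn hNI (hmem y hy) hy.1),
            (hFm.monotoneOn (hmem y hy) hxI hy.2).trans hxd.le⟩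
        exact (hmono n le_rfl).monotoneOn (hmem' p hp) (hmem' q hq)
          (hFm.monotoneOn (hmem p hp) (hmem q hq) hpq)
      · push_cast
        rw [Function.iterate_succ_apply]; linarith
      · push_cast
        linarith
    have hright : d' ≤ T.F (N + T.L) := by
      by_contra! hlt
      have hLI' : T.F (N + T.L) ∈ Icc a' d' := ⟨by linarith, hlt.le⟩
      have h1 := hmono n le_rfl hLI' hd'I hlt
      have h2 := hmono n le_rfl hFxI hLI' hFxL
      have hFL : T.F^[n] (T.F (N + T.L)) = T.F^[n + 1] T.L + N := by
        rw [← T.iterate_add_int, add_comm T.L, Function.iterate_succ_apply]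
      rw [← Function.iterate_succ_apply, hx] at h2
      have h3 := T.orbit_L_near (n + 1) (by omega) (M - N)
      push_cast at h3
      exact h3 ⟨by linarith [T.η_pos], by linarith⟩
    have hivt : ∀ y ∈ Icc a' d', ∃ w ∈ Icc (N : ℝ) (N + T.L), T.F w = y := fun y hy =>
      intermediate_value_Icc (by linarith [T.L_pos]) T.continuous.continuousOn
        ⟨hleft.trans hy.1, hy.2.trans hright⟩
    obtain ⟨a, haI, rfl⟩ := hivt a' ha'I
    obtain ⟨b, hbI, rfl⟩ := hivt b' ⟨hab.le, by linarith⟩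
    obtain ⟨d, hdI, rfl⟩ := hivt d' hd'I
    have hab' := (hFm.lt_iff_lt haI hbI).1 hab
    have hbx' := (hFm.lt_iff_lt hbI hxI).1 hbx
    have hxd' := (hFm.lt_iff_lt hxI hdI).1 hxd
    refine ⟨a, b, d, hab', hbx', hxd', ha, hb, hd, ?_, ?_⟩
    · rintro (_ | i) hi
      · exact ⟨haI.1, hdI.2⟩
      · exact hin i (by omega)
    · have hsub : Icc a d ⊆ Icc (N : ℝ) (N + T.L) := Icc_subset_Icc haI.1 hdI.2
      rintro (_ | i) hi
      · exact strictMonoOn_id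
      · refine (hmono i (by omega)).comp (hFm.mono hsub) fun y hy => ?_
        exact ⟨hFm.monotoneOn haI (hsub hy) hy.1, hFm.monotoneOn (hsub hy) hdI hy.2⟩

end GapLift

lemma le_exp_mul_of_backward_step {n : ℕ} {D l δ : ℕ → ℝ} {C : ℝ} (hC : 0 ≤ C)
    (hD : ∀ i ≤ n, 0 ≤ D i) (hl : ∀ i < n, 0 ≤ l i)
    (hstep : ∀ i < n, D i ≤ Real.exp (C * δ i) * D (i + 1)) (hδ : ∀ i < n, δ i ≤ 1)
    (hδl : ∀ i < n, D i ≤ 1 → δ i ≤ 2 * l i) (hsum : ∑ i ∈ Finset.range n, l i ≤ 1)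
    (hn : D n ≤ Real.exp (-(3 * C))) : D 0 ≤ Real.exp (2 * C) * D n := by
  have key : ∀ k ≤ n, D (n - k) ≤ Real.exp (2 * C * ∑ i ∈ Finset.Ico (n - k) n, l i) * D n := by
    intro k
    induction k with
    | zero => simp
    | succ k ih =>
      intro hk
      have ih' := ih (by omega)
      obtain ⟨i, hi⟩ : ∃ i, n - (k + 1) = i := ⟨_, rfl⟩
      have hi' : n - k = i + 1 := by omega
      have hin : i < n := by omega
      rw [hi'] at ih'
      rw [hi]
      have hS : ∑ j ∈ Finset.Ico (i + 1) n, l j ≤ 1 := by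
        refine le_trans (Finset.sum_le_sum_of_subset_of_nonneg ?_ ?_) hsum
        · intro j hj; simp at hj ⊢; omega
        · intro j hj _; simp at hj; exact hl j hj
      have h1 : D (i + 1) ≤ Real.exp (-C) := by
        calc D (i + 1) ≤ Real.exp (2 * C * ∑ j ∈ Finset.Ico (i + 1) n, l j) * D n := ih'
          _ ≤ Real.exp (2 * C * 1) * Real.exp (-(3 * C)) := by
            have := hD n le_rfl
            gcongr
          _ = Real.exp (-C) := by rw [← Real.exp_add]; congr 1; ring
      have h2 : D i ≤ 1 := by
        calc D i ≤ Real.exp (C * δ i) * D (i + 1) := hstep i hin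
          _ ≤ Real.exp (C * 1) * Real.exp (-C) := by
            have := hD (i + 1) hin
            have := hδ i hin
            gcongr
          _ = 1 := by rw [← Real.exp_add]; simp
      calc D i ≤ Real.exp (C * δ i) * D (i + 1) := hstep i hin
        _ ≤ Real.exp (C * (2 * l i)) *
            (Real.exp (2 * C * ∑ j ∈ Finset.Ico (i + 1) n, l j) * D n) := by
            have := hδl i hin h2
            have := hD (i + 1) hin
            gcongr
        _ = Real.exp (2 * C * ∑ j ∈ Finset.Ico i n, l j) * D n := by
            rw [Finset.sum_eq_sum_Ico_succ_bot hin, ← mul_assoc, ← Real.exp_add]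
            congr 2; ring
  have := key n le_rfl
  rw [Nat.sub_self, ← Finset.range_eq_Ico] at this
  refine this.trans ?_
  exact mul_le_mul_of_nonneg_right (Real.exp_le_exp.2 (by nlinarith)) (hD n le_rfl)

namespace GapLift

variable (T : GapLift)

/-- Points of `staying` whose orbit accumulates at `0` modulo `1`. -/
def approachingZero : Set ℝ := {x ∈ T.staying | ∀ r > 0, ∃ n : ℕ, Int.fract (T.F^[n] x) < r}

lemma L_lt_fract_of_mem_Ioo {M : ℤ} {y : ℝ} (hy : y ∈ Ioo (M - T.η) M) : T.L < Int.fract y := by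
  have h1 : ⌊y⌋ = M - 1 := by
    rw [Int.floor_eq_iff]; push_cast
    exact ⟨by linarith [hy.1, T.η_le, T.L_pos], by linarith [hy.2]⟩
  rw [Int.fract, h1]; push_cast
  linarith [hy.1, T.η_le]

lemma volume_approachingZero : volume T.approachingZero = 0 := by
  refine volume_eq_zero_of_porous one_pos fun x ⟨hx, hinf⟩ r hr => ?_
  have hη := T.η_pos
  have hC := T.C_nonneg
  set q := min (Real.exp (-(3 * T.C))) (r / 2 * Real.exp (-(2 * T.C))) with hq
  have hq0 : 0 < q := by positivity
  have hs : 0 < min (T.η / 2) (T.η / 4 * q) := by positivity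
  classical
  have hex := hinf _ hs
  set n := Nat.find hex with hn
  have hzn := Nat.find_spec hex
  rw [← hn] at hzn
  set z := Int.fract (T.F^[n] x) with hz
  have hz0 : 0 < z := (hx n).1
  have hzη : z < T.η / 2 := lt_of_lt_of_le hzn (min_le_left _ _)
  have hzq : z < T.η / 4 * q := lt_of_lt_of_le hzn (min_le_right _ _)
  set M := ⌊T.F^[n] x⌋ with hM
  obtain ⟨a, b, d, hab, hbx, hxd, ha, hb, hd, hin, hmono⟩ := T.exists_pullback n x M z
    (Int.floor_add_fract _).symm hz0 (by linarith) (fun i _ => hx i)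
    (fun i hi => hzn.trans_le (not_lt.1 (Nat.find_min hex hi)))
  have haI : a ∈ Icc a d := ⟨le_rfl, by linarith⟩
  have hbI : b ∈ Icc a d := ⟨by linarith, by linarith⟩
  have hxI : x ∈ Icc a d := ⟨by linarith, by linarith⟩
  have hdI : d ∈ Icc a d := ⟨by linarith, by linarith⟩
  have lt1 : ∀ i ≤ n, T.F^[i] a < T.F^[i] b := fun i hi => hmono i hi haI hbI hab
  have lt2 : ∀ i ≤ n, T.F^[i] b < T.F^[i] x := fun i hi => hmono i hi hbI hxI hbx
  have lt3 : ∀ i ≤ n, T.F^[i] x < T.F^[i] d := fun i hi => hmono i hi hxI hdI hxd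
  have hlift : ∀ i ≤ n, ∀ u ∈ Ioo (T.F^[i] a) (T.F^[i] b), ∃ v ∈ Ioo a b, T.F^[i] v = u := by
    intro i hi u hu
    exact intermediate_value_Ioo hab.le (T.continuous_iterate i).continuousOn hu
  have hexit : ∀ v ∈ Ioo a b, T.F^[n] v ∈ Ioo (M - T.η) M := by
    intro v hv
    have hvI : v ∈ Icc a d := ⟨hv.1.le, by linarith [hv.2]⟩
    exact ⟨ha ▸ hmono n le_rfl haI hvI hv.1, hb ▸ hmono n le_rfl hvI hbI hv.2⟩
  let D : ℕ → ℝ := fun i => crossRatio (T.F^[i] a) (T.F^[i] b) (T.F^[i] x) (T.F^[i] d)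
  have hDpos : ∀ i ≤ n, 0 ≤ D i := by
    intro i hi
    have g1 := sub_pos.2 (lt1 i hi)
    have g2 := sub_pos.2 (lt2 i hi)
    have g3 := sub_pos.2 (lt3 i hi)
    have g4 : 0 < T.F^[i] d - T.F^[i] a := by linarith
    simp only [D, crossRatio]; positivity
  have hDle : ∀ i ≤ n, T.F^[i] x - T.F^[i] b ≤ D i * (T.F^[i] b - T.F^[i] a) := by
    intro i hi
    have g1 := sub_pos.2 (lt1 i hi)
    have g2 := sub_pos.2 (lt2 i hi)
    have g3 := sub_pos.2 (lt3 i hi)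
    have e : D i * (T.F^[i] b - T.F^[i] a) = (T.F^[i] x - T.F^[i] b) *
        ((T.F^[i] d - T.F^[i] a) / (T.F^[i] d - T.F^[i] x)) := by
      simp only [D, crossRatio]; field_simp
    rw [e]
    refine le_mul_of_one_le_right g2.le ?_
    rw [one_le_div g3]; linarith
  have hsum : ∑ i ∈ Finset.range n, (T.F^[i] b - T.F^[i] a) ≤ 1 := by
    refine sum_length_le_one_s8 (N := fun i => ⌊T.F^[i] x⌋)
      (fun i hi => (lt1 i (Finset.mem_range.1 hi).le).le)
      (fun i hi => (hin i (Finset.mem_range.1 hi)).1) (fun i hi => ?_) ?_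
    · have hi' := Finset.mem_range.1 hi
      linarith [lt2 i hi'.le, lt3 i hi'.le, (hin i hi').2, T.L_lt_one]
    · intro i hi j hj hij u hu k huk
      have hi' := Finset.mem_range.1 hi
      have hj' := Finset.mem_range.1 hj
      obtain ⟨v, hv, rfl⟩ := hlift i hi'.le u hu
      obtain ⟨w, hw, hwe⟩ := hlift j hj'.le _ huk
      have hp : (n - j) + i < n := by omega
      have e1 : T.F^[n] w = T.F^[(n - j) + i] v + k := by
        rw [Function.iterate_add_apply, ← T.iterate_add_int, ← hwe, ← Function.iterate_add_apply]
        congr 2; omega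
      have hvI : v ∈ Icc a d := ⟨hv.1.le, by linarith [hv.2]⟩
      have h1 := hexit w hw
      have h2 := hin _ hp
      have h3 := (hmono _ hp.le).monotoneOn haI hvI hvI.1
      have h4 := (hmono _ hp.le).monotoneOn hvI hdI hvI.2
      have h5 := T.L_lt_fract_of_mem_Ioo h1
      rw [e1, Int.fract_add_intCast] at h5
      have h6 : ⌊T.F^[(n - j) + i] v⌋ = ⌊T.F^[(n - j) + i] x⌋ := by
        rw [Int.floor_eq_iff]
        exact ⟨by linarith, by linarith [T.L_lt_one]⟩
      rw [Int.fract, h6] at h5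
      linarith
  have hDn : D n ≤ 4 * z / T.η := by
    have : D n = z * (2 * T.η) / (T.η * (T.η - z)) := by
      simp only [D, crossRatio]
      rw [ha, hb, hd, show T.F^[n] x = M + z from (Int.floor_add_fract _).symm]
      congr 1 <;> ring
    have hpos : 0 < T.η - z := by linarith
    rw [this, div_le_div_iff₀ (by positivity) hη]
    nlinarith [mul_pos hz0 hη, mul_pos (mul_pos hz0 hη) hη, mul_pos (mul_pos hz0 hη) hz0]
  have hDq : D n ≤ q := hDn.trans (by rw [div_le_iff₀ hη]; linarith)
  have hD0 : D 0 ≤ Real.exp (2 * T.C) * D n := by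
    refine le_exp_mul_of_backward_step (l := fun i => T.F^[i] b - T.F^[i] a)
      (δ := fun i => T.F^[i] x - T.F^[i] a) hC hDpos
      (fun i hi => (sub_pos.2 (lt1 i hi.le)).le) (fun i hi => ?_) (fun i hi => ?_)
      (fun i hi h1 => ?_) hsum (hDq.trans (min_le_left _ _))
    · simp only [D, Function.iterate_succ_apply']
      exact T.crossRatio_le (hin i hi).1 (lt1 i hi.le) (lt2 i hi.le) (lt3 i hi.le) (hin i hi).2
    · linarith [(hin i hi).1, (hin i hi).2, lt3 i hi.le, T.L_lt_one]
    · have h2 := hDle i hi.le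
      have h3 := sub_pos.2 (lt1 i hi.le)
      nlinarith
  have hba : b - a ≤ 1 := by
    rcases Nat.eq_zero_or_pos n with h0 | h0
    · rw [h0] at ha hb
      simp only [Function.iterate_zero, id] at ha hb
      linarith [T.η_le, T.L_pos]
    · have := hin 0 h0
      simp only [Function.iterate_zero, id] at this
      linarith [T.L_lt_one]
  have hxb : x - b ≤ D 0 * (b - a) := hDle 0 (by omega)
  have hD0r : D 0 ≤ r / 2 := by
    calc D 0 ≤ Real.exp (2 * T.C) * D n := hD0
      _ ≤ Real.exp (2 * T.C) * (r / 2 * Real.exp (-(2 * T.C))) := by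
        gcongr; exact hDq.trans (min_le_right _ _)
      _ = r / 2 * (Real.exp (2 * T.C) * Real.exp (-(2 * T.C))) := by ring
      _ = r / 2 := by rw [← Real.exp_add]; simp
  have hD01 : D 0 ≤ 1 := by
    calc D 0 ≤ Real.exp (2 * T.C) * D n := hD0
      _ ≤ Real.exp (2 * T.C) * Real.exp (-(3 * T.C)) := by
        gcongr; exact hDq.trans (min_le_left _ _)
      _ = Real.exp (-T.C) := by rw [← Real.exp_add]; congr 1; ring
      _ ≤ 1 := Real.exp_le_one_iff.2 (by linarith)
  have hD00 := hDpos 0 (by omega)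
  refine ⟨b, hbx, by nlinarith, disjoint_left.2 fun v hv ⟨hvs, _⟩ => ?_⟩
  have hva : v ∈ Ioo a b := ⟨by nlinarith [hv.1], hv.2⟩
  exact absurd (hvs n).2 (T.L_lt_fract_of_mem_Ioo (hexit v hva)).not_gt

end GapLift

lemma volume_inter_preimage_eq_zero {F : ℝ → ℝ} {U S : Set ℝ} (hU : MeasurableSet U)
    (hF : Differentiable ℝ F) (hinj : InjOn F U) (hne : ∀ x ∈ U, deriv F x ≠ 0)
    (hS : volume S = 0) : volume (U ∩ F ⁻¹' S) = 0 := by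
  set S' := toMeasurable volume S with hS'
  have hS'0 : volume S' = 0 := by rw [hS', measure_toMeasurable, hS]
  have hA : MeasurableSet (U ∩ F ⁻¹' S') :=
    hU.inter (hF.continuous.measurable (measurableSet_toMeasurable _ _))
  refine measure_mono_null (t := U ∩ F ⁻¹' S')
    (inter_subset_inter_right _ (preimage_mono (subset_toMeasurable _ _))) ?_
  have h1 := lintegral_image_eq_lintegral_abs_deriv_mul hA
    (fun x _ => (hF x).hasDerivAt.hasDerivWithinAt) (hinj.mono inter_subset_left) fun _ => 1
  have h2 : volume (F '' (U ∩ F ⁻¹' S')) = 0 :=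
    measure_mono_null (by rintro _ ⟨x, hx, rfl⟩; exact hx.2) hS'0
  simp only [mul_one, lintegral_const, Measure.restrict_apply_univ, h2, one_mul] at h1
  have hmeas : Measurable fun x => ENNReal.ofReal |deriv F x| :=
    (measurable_deriv F).abs.ennreal_ofReal
  have h3 := (lintegral_eq_zero_iff hmeas).1 h1.symm
  rw [Filter.EventuallyEq, ae_restrict_iff' hA] at h3
  rw [← nonpos_iff_eq_zero, ← ae_iff.1 h3]
  refine measure_mono fun x hx h => ?_
  have := h hx
  simp only [Pi.zero_apply, ENNReal.ofReal_eq_zero] at this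
  exact hne x hx.1 (abs_nonpos_iff.1 this)

/-- Control of the ratio of adjacent intervals along a sequence with bounded distortion. -/
lemma adjacent_ratio_bounds {k : ℕ} {u b t : ℕ → ℝ} {K : ℝ} (hK : 0 ≤ K)
    (hub : ∀ i ≤ k, u i < b i) (hbt : ∀ i ≤ k, b i < t i)
    (hup : ∀ i < k, (t (i + 1) - b (i + 1)) * (b i - u i) ≤
      Real.exp (K * (t i - u i)) * ((b (i + 1) - u (i + 1)) * (t i - b i)))
    (hlow : ∀ i < k, (b (i + 1) - u (i + 1)) * (t i - b i) ≤
      Real.exp (K * (t i - u i)) * ((t (i + 1) - b (i + 1)) * (b i - u i)))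
    (hsum : ∑ i ∈ Finset.range k, (b i - u i) ≤ 1)
    (h0 : t 0 - b 0 = Real.exp (-(2 * K)) * (b 0 - u 0)) :
    t k - b k ≤ b k - u k ∧ Real.exp (-(4 * K)) * (b k - u k) ≤ t k - b k := by
  have hS : ∀ i ≤ k, ∑ j ∈ Finset.range i, (b j - u j) ≤ 1 := fun i hi =>
    le_trans (Finset.sum_le_sum_of_subset_of_nonneg
      (fun j hj => by simp at hj ⊢; omega)
      fun j hj _ => by simp at hj; linarith [hub j hj.le]) hsum
  have key : ∀ i ≤ k,
      t i - b i ≤ Real.exp (-(2 * K) + 2 * K * ∑ j ∈ Finset.range i, (b j - u j)) * (b i - u i) ∧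
      Real.exp (-(2 * K) - 2 * K * ∑ j ∈ Finset.range i, (b j - u j)) * (b i - u i) ≤
        t i - b i := by
    intro i
    induction i with
    | zero => intro _; simp [h0]
    | succ i ih =>
      intro hi
      obtain ⟨ih1, ih2⟩ := ih (by omega)
      have g1 := sub_pos.2 (hub i (by omega))
      have g2 := sub_pos.2 (hbt i (by omega))
      have g3 := sub_pos.2 (hub (i + 1) hi)
      have g4 := sub_pos.2 (hbt (i + 1) hi)
      have hle : t i - b i ≤ b i - u i := by
        refine ih1.trans (mul_le_of_le_one_left g1.le (Real.exp_le_one_iff.2 ?_))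
        nlinarith [hS i (by omega)]
      have hexp : Real.exp (K * (t i - u i)) ≤ Real.exp (2 * K * (b i - u i)) :=
        Real.exp_le_exp.2 (by nlinarith)
      rw [Finset.sum_range_succ]
      constructor
      · have h1 : (t (i + 1) - b (i + 1)) * (b i - u i) ≤ (Real.exp (2 * K * (b i - u i)) *
            Real.exp (-(2 * K) + 2 * K * ∑ j ∈ Finset.range i, (b j - u j)) *
            (b (i + 1) - u (i + 1))) * (b i - u i) := by
          calc _ ≤ Real.exp (K * (t i - u i)) * ((b (i + 1) - u (i + 1)) * (t i - b i)) :=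
                hup i (by omega)
            _ ≤ Real.exp (2 * K * (b i - u i)) * ((b (i + 1) - u (i + 1)) *
              (Real.exp (-(2 * K) + 2 * K * ∑ j ∈ Finset.range i, (b j - u j)) *
                (b i - u i))) := by gcongr
            _ = _ := by ring
        have h2 := le_of_mul_le_mul_right h1 g1
        rw [← Real.exp_add] at h2
        have e : -(2 * K) + 2 * K * (∑ j ∈ Finset.range i, (b j - u j) + (b i - u i)) =
            2 * K * (b i - u i) + (-(2 * K) + 2 * K * ∑ j ∈ Finset.range i, (b j - u j)) := by
          ring
        rw [e]; exact h2
      · have h1 : (Real.exp (-(2 * K) - 2 * K * ∑ j ∈ Finset.range i, (b j - u j)) *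
            (b (i + 1) - u (i + 1))) * (b i - u i) ≤
            (Real.exp (2 * K * (b i - u i)) * (t (i + 1) - b (i + 1))) * (b i - u i) := by
          calc _ = (b (i + 1) - u (i + 1)) *
              (Real.exp (-(2 * K) - 2 * K * ∑ j ∈ Finset.range i, (b j - u j)) *
                (b i - u i)) := by ring
            _ ≤ (b (i + 1) - u (i + 1)) * (t i - b i) := by gcongr
            _ ≤ Real.exp (K * (t i - u i)) * ((t (i + 1) - b (i + 1)) * (b i - u i)) :=
                hlow i (by omega)
            _ ≤ Real.exp (2 * K * (b i - u i)) * ((t (i + 1) - b (i + 1)) * (b i - u i)) := by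
                gcongr
            _ = _ := by ring
        have h2 := le_of_mul_le_mul_right h1 g1
        have h3 : Real.exp (-(2 * K) - 2 * K * (∑ j ∈ Finset.range i, (b j - u j) +
            (b i - u i))) = Real.exp (-(2 * K * (b i - u i))) *
            Real.exp (-(2 * K) - 2 * K * ∑ j ∈ Finset.range i, (b j - u j)) := by
          rw [← Real.exp_add]; congr 1; ring
        rw [h3, mul_assoc]
        calc _ ≤ Real.exp (-(2 * K * (b i - u i))) *
              (Real.exp (2 * K * (b i - u i)) * (t (i + 1) - b (i + 1))) := by gcongr
          _ = _ := by rw [← mul_assoc, ← Real.exp_add]; simp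
  obtain ⟨h1, h2⟩ := key k le_rfl
  have g := sub_pos.2 (hub k le_rfl)
  constructor
  · refine h1.trans (mul_le_of_le_one_left g.le (Real.exp_le_one_iff.2 ?_))
    nlinarith
  · refine le_trans (mul_le_mul_of_nonneg_right (Real.exp_le_exp.2 ?_) g.le) h2
    nlinarith

namespace GapLift

variable (T : GapLift)

/-- Bounded distortion away from the endpoints of `[0, L]`. -/
lemma exists_distortion {α β : ℝ} (hα : 0 < α) (hβ : β < T.L) :
    ∃ K, 0 ≤ K ∧ ∀ (N : ℤ) (p q t : ℝ), N + α ≤ p → p < q → q < t → t ≤ N + β →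
      (T.F t - T.F q) * (q - p) ≤ Real.exp (K * (t - p)) * ((T.F q - T.F p) * (t - q)) ∧
      (T.F q - T.F p) * (t - q) ≤ Real.exp (K * (t - p)) * ((T.F t - T.F q) * (q - p)) := by
  obtain ⟨M, hM0, hM⟩ := T.contDiff.exists_abs_deriv_sub_le α β
  obtain ⟨m, hm, hmd⟩ := exists_pos_le_deriv T.contDiff (a := α) (b := β)
    fun x hx => T.deriv_pos x ⟨by linarith [hx.1], by linarith [hx.2]⟩
  have hd : Differentiable ℝ T.F := T.contDiff.differentiable two_ne_zero
  have hcmp : ∀ ξ ∈ Icc α β, ∀ ζ ∈ Icc α β, ∀ r, |ξ - ζ| ≤ r →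
      deriv T.F ξ ≤ Real.exp (M / m * r) * deriv T.F ζ := by
    intro ξ hξ ζ hζ r hr
    have h1 := (abs_le.1 (hM ξ hξ ζ hζ)).2
    have h2 := hmd ζ hζ
    have h3 : M / m * r + 1 ≤ Real.exp (M / m * r) := Real.add_one_le_exp _
    have h4 : M * |ξ - ζ| ≤ M / m * r * deriv T.F ζ := by
      have hr0 : 0 ≤ r := (abs_nonneg _).trans hr
      calc M * |ξ - ζ| ≤ M * r := by gcongr
        _ = M / m * r * m := by field_simp
        _ ≤ _ := by gcongr
    have h5 := mul_le_mul_of_nonneg_right h3 (hm.trans_le h2).le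
    linarith
  refine ⟨M / m, by positivity, fun N p q t hp hpq hqt ht => ?_⟩
  have e : ∀ z : ℝ, T.F z = T.F (z - N) + N := fun z => by
    rw [← T.map_add_int, sub_add_cancel]
  have hmvt : ∀ x y, x < y → p ≤ x → y ≤ t → ∃ c ∈ Icc (p - N) (t - N), c ∈ Icc α β ∧
      T.F y - T.F x = deriv T.F c * (y - x) := by
    intro x y hxy hpx hyt
    obtain ⟨c, hc, hce⟩ := exists_deriv_eq_slope T.F (sub_lt_sub_right hxy (N : ℝ))
      hd.continuous.continuousOn hd.differentiableOn
    refine ⟨c, ⟨by linarith [hc.1], by linarith [hc.2]⟩,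
      ⟨by linarith [hc.1], by linarith [hc.2]⟩, ?_⟩
    rw [hce, e x, e y, sub_sub_sub_cancel_right, add_sub_add_right_eq_sub,
      div_mul_cancel₀ _ (sub_pos.2 hxy).ne']
  obtain ⟨ξ, hξ, hξ', eξ⟩ := hmvt q t hqt hpq.le le_rfl
  obtain ⟨ζ, hζ, hζ', eζ⟩ := hmvt p q hpq le_rfl hqt.le
  have habs : |ξ - ζ| ≤ t - p := abs_le.2 ⟨by linarith [hξ.1, hζ.2], by linarith [hξ.2, hζ.1]⟩
  have hpos : 0 ≤ (t - q) * (q - p) := mul_nonneg (by linarith) (by linarith)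
  rw [eξ, eζ]
  constructor
  · have := mul_le_mul_of_nonneg_right (hcmp ξ hξ' ζ hζ' _ habs) hpos
    linarith
  · rw [abs_sub_comm] at habs
    have := mul_le_mul_of_nonneg_right (hcmp ζ hζ' ξ hξ' _ habs) hpos
    linarith

/-- Points whose orbit stays in `[α, β]` modulo `1`. -/
def core (α β : ℝ) : Set ℝ := {x | ∀ n : ℕ, Int.fract (T.F^[n] x) ∈ Icc α β}

lemma isClosed_fract_mem_Icc {α β : ℝ} (hα : 0 < α) (hβ : β < 1) :
    IsClosed {y : ℝ | Int.fract y ∈ Icc α β} := by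
  have : {y : ℝ | Int.fract y ∈ Icc α β} = (⋃ m : ℤ, Ioo (m + β) (m + 1 + α))ᶜ := by
    ext y
    simp only [mem_ofPred_eq, mem_compl_iff, mem_iUnion, not_exists]
    constructor
    · intro hy m hm
      rcases lt_or_ge y (m + 1) with h | h
      · have h1 := Int.floor_le y
        have h2 := Int.lt_floor_add_one y
        have h3 : ⌊y⌋ ≤ m := by
          have : (⌊y⌋ : ℝ) < (m + 1 : ℤ) := by push_cast; linarith
          have := Int.cast_lt.1 this; omega
        have h4 : ((⌊y⌋ : ℤ) : ℝ) ≤ m := by exact_mod_cast h3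
        have h5 := hy.2
        rw [Int.fract] at h5
        linarith [hm.1]
      · have h3 : m + 1 ≤ ⌊y⌋ := Int.le_floor.2 (by push_cast; exact h)
        have h4 : (m : ℝ) + 1 ≤ (⌊y⌋ : ℤ) := by exact_mod_cast h3
        have h5 := hy.1
        rw [Int.fract] at h5
        linarith [hm.2]
    · intro h
      have h1 := Int.floor_le y
      have h2 := Int.lt_floor_add_one y
      refine ⟨?_, ?_⟩
      · by_contra! h3
        apply h (⌊y⌋ - 1)
        push_cast
        rw [Int.fract] at h3
        exact ⟨by linarith, by linarith⟩
      · by_contra! h3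
        apply h ⌊y⌋
        rw [Int.fract] at h3
        exact ⟨by linarith, by linarith⟩
  rw [this]
  exact (isOpen_iUnion fun _ => isOpen_Ioo).isClosed_compl

lemma isClosed_core {α β : ℝ} (hα : 0 < α) (hβ : β < 1) : IsClosed (T.core α β) := by
  have : T.core α β = ⋂ n : ℕ, T.F^[n] ⁻¹' {y : ℝ | Int.fract y ∈ Icc α β} := by
    ext; simp [core]
  rw [this]
  exact isClosed_iInter fun n =>
    (isClosed_fract_mem_Icc hα hβ).preimage (T.continuous_iterate n)

lemma add_int_mem_core {α β x : ℝ} (m : ℤ) (hx : x ∈ T.core α β) : x + m ∈ T.core α β :=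
  fun n => by rw [iterate_add_int, Int.fract_add_intCast]; exact hx n

lemma iterate_mem_core {α β x : ℝ} (k : ℕ) (hx : x ∈ T.core α β) : T.F^[k] x ∈ T.core α β :=
  fun n => by rw [← Function.iterate_add_apply]; exact hx _

lemma mem_core_of_map_mem {α β x : ℝ} (hx : Int.fract x ∈ Icc α β) (hF : T.F x ∈ T.core α β) :
    x ∈ T.core α β := by
  rintro (_ | n)
  · exact hx
  · exact hF n

lemma floor_eq_of_mem_Ico {N : ℤ} {y : ℝ} (h1 : N ≤ y) (h2 : y < N + 1) : ⌊y⌋ = N :=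
  Int.floor_eq_iff.2 ⟨h1, h2⟩

lemma fract_mem_Icc_of_mem {α β y : ℝ} {N : ℤ} (hα : 0 < α) (hβ : β < 1)
    (h : y ∈ Icc (N + α) (N + β)) : Int.fract y ∈ Icc α β := by
  rw [Int.fract, floor_eq_of_mem_Ico (N := N) (by linarith [h.1]) (by linarith [h.2])]
  exact ⟨by linarith [h.1], by linarith [h.2]⟩

lemma mem_Icc_floor_of_mem_core {α β x : ℝ} (hx : x ∈ T.core α β) :
    x ∈ Icc (⌊x⌋ + α) (⌊x⌋ + β) := by
  have := hx 0
  simp only [Function.iterate_zero, id, Int.fract] at this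
  exact ⟨by linarith [this.1], by linarith [this.2]⟩

/-- An interval contained in `core α β` lies in a single cell. -/
lemma Icc_subset_cell {α β p r y : ℝ} (hα : 0 < α) (hsub : Icc p r ⊆ T.core α β)
    (hy : y ∈ Icc p r) : Icc p r ⊆ Icc (⌊y⌋ + α) (⌊y⌋ + β) := by
  have key : ∀ m : ℤ, (m : ℝ) ∉ Icc p r := fun m hm => by
    have := (hsub hm 0).1
    simp at this; linarith
  intro w hw
  have h : ⌊w⌋ = ⌊y⌋ := by
    have h1 := Int.floor_le y
    have h2 := Int.lt_floor_add_one y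
    refine floor_eq_of_mem_Ico ?_ ?_
    · by_contra! h3
      exact key _ ⟨hw.1.trans h3.le, h1.trans hy.2⟩
    · by_contra! h3
      apply key (⌊y⌋ + 1)
      push_cast
      exact ⟨by linarith [hy.1], by linarith [hw.2]⟩
  rw [← h]
  exact T.mem_Icc_floor_of_mem_core (hsub hw)

lemma exists_maximal_Icc {α β y : ℝ} (hα : 0 < α) (hβ : β < 1) (hy : y ∈ T.core α β) :
    ∃ p r, y ∈ Icc p r ∧ Icc p r ⊆ T.core α β ∧
      ∀ p' r', y ∈ Icc p' r' → Icc p' r' ⊆ T.core α β → p ≤ p' ∧ r' ≤ r := by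
  set Y := connectedComponentIn (T.core α β) y with hY
  have hYsub : Y ⊆ T.core α β := connectedComponentIn_subset _ _
  have hyY : y ∈ Y := mem_connectedComponentIn hy
  have hpre : IsPreconnected Y := isPreconnected_connectedComponentIn
  have hclosed : IsClosed Y := by
    refine isClosed_of_closure_subset (hpre.closure.subset_connectedComponentIn
      (subset_closure hyY) ?_)
    exact (closure_mono hYsub).trans (T.isClosed_core hα hβ).closure_subset
  have hord : OrdConnected Y := hpre.ordConnected
  have hIcc : ∀ p' r', y ∈ Icc p' r' → Icc p' r' ⊆ T.core α β → Icc p' r' ⊆ Y :=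
    fun p' r' h1 h2 => isPreconnected_Icc.subset_connectedComponentIn h1 h2
  have hcell : ∀ w ∈ Y, w ∈ Icc (⌊y⌋ + α) (⌊y⌋ + β) := by
    intro w hw
    rcases le_total y w with h | h
    · exact T.Icc_subset_cell hα ((hord.out hyY hw).trans hYsub) ⟨le_rfl, h⟩ ⟨h, le_rfl⟩
    · exact T.Icc_subset_cell hα ((hord.out hw hyY).trans hYsub) ⟨h, le_rfl⟩ ⟨le_rfl, h⟩
  have hbb : BddBelow Y := ⟨_, fun w hw => (hcell w hw).1⟩
  have hba : BddAbove Y := ⟨_, fun w hw => (hcell w hw).2⟩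
  refine ⟨sInf Y, sSup Y, ⟨csInf_le hbb hyY, le_csSup hba hyY⟩,
    (hord.out (hclosed.csInf_mem ⟨y, hyY⟩ hbb) (hclosed.csSup_mem ⟨y, hyY⟩ hba)).trans hYsub,
    fun p' r' h1 h2 => ?_⟩
  have h3 := hIcc p' r' h1 h2
  have h4 : p' ≤ r' := h1.1.trans h1.2
  exact ⟨csInf_le hbb (h3 ⟨le_rfl, h4⟩), le_csSup hba (h3 ⟨h4, le_rfl⟩)⟩

lemma strictMonoOn_iterate {n : ℕ} {p q : ℝ} {N : ℕ → ℤ} (hp : ∀ i < n, N i ≤ T.F^[i] p)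
    (hq : ∀ i < n, T.F^[i] q ≤ N i + T.L) : StrictMonoOn (T.F^[n]) (Icc p q) := by
  induction n with
  | zero => exact strictMonoOn_id
  | succ n ih =>
    have h := ih (fun i hi => hp i (by omega)) fun i hi => hq i (by omega)
    have hcell : ∀ x ∈ Icc p q, T.F^[n] x ∈ Icc (N n : ℝ) (N n + T.L) := fun x hx =>
      ⟨(hp n (by omega)).trans (h.monotoneOn ⟨le_rfl, hx.1.trans hx.2⟩ hx hx.1),
        (h.monotoneOn hx ⟨hx.1.trans hx.2, le_rfl⟩ hx.2).trans (hq n (by omega))⟩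
    intro x hx y hy hxy
    rw [Function.iterate_succ_apply', Function.iterate_succ_apply']
    exact T.strictMonoOn (N n) (hcell x hx) (hcell y hy) (h hx hy hxy)

lemma strictMonoOn_iterate_of_subset_core {α β p q : ℝ} (hα : 0 < α) (hβ : β < T.L)
    (hpq : p ≤ q) (hsub : Icc p q ⊆ T.core α β) (n : ℕ) :
    StrictMonoOn (T.F^[n]) (Icc p q) ∧ Icc (T.F^[n] p) (T.F^[n] q) ⊆ T.core α β := by
  induction n with
  | zero => exact ⟨strictMonoOn_id, hsub⟩
  | succ n ih =>
    obtain ⟨h, hs⟩ := ih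
    have hcell := T.Icc_subset_cell hα hs (y := T.F^[n] p)
      ⟨le_rfl, h.monotoneOn ⟨le_rfl, hpq⟩ ⟨hpq, le_rfl⟩ hpq⟩
    refine ⟨?_, ?_⟩
    · intro x hx y hy hxy
      have hm : ∀ x ∈ Icc p q, T.F^[n] x ∈
          Icc (⌊T.F^[n] p⌋ : ℝ) (⌊T.F^[n] p⌋ + T.L) := fun x hx => by
        have := hcell ⟨h.monotoneOn ⟨le_rfl, hpq⟩ hx hx.1, h.monotoneOn hx ⟨hpq, le_rfl⟩ hx.2⟩
        exact ⟨by linarith [this.1], by linarith [this.2]⟩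
      rw [Function.iterate_succ_apply', Function.iterate_succ_apply']
      exact T.strictMonoOn _ (hm x hx) (hm y hy) (h hx hy hxy)
    · refine (intermediate_value_Icc hpq (T.continuous_iterate (n + 1)).continuousOn).trans ?_
      rintro _ ⟨x, hx, rfl⟩
      exact T.iterate_mem_core _ (hsub hx)

lemma core_mono {α β α' β' : ℝ} (hα : α' ≤ α) (hβ : β ≤ β') : T.core α β ⊆ T.core α' β' :=
  fun _ hx n => Icc_subset_Icc hα hβ (hx n)

/-- There are no wandering intervals staying away from the endpoints of `[0, L]`. -/
lemma not_Icc_subset_core {α β p₀ q₀ : ℝ} (hα : 0 < α) (hβ : β < T.L) (hpq : p₀ < q₀) :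
    ¬ Icc p₀ q₀ ⊆ T.core α β := by
  intro hsub
  obtain ⟨α', hα', hαα'⟩ : ∃ α', 0 < α' ∧ α' < α := ⟨α / 2, by linarith, by linarith⟩
  obtain ⟨β', hββ', hβ'⟩ := exists_between hβ
  have hβ1 : β' < 1 := hβ'.trans T.L_lt_one
  have hy0 : p₀ ∈ T.core α β := hsub ⟨le_rfl, hpq.le⟩
  have hy : ∀ j, T.F^[j] p₀ ∈ T.core α β := fun j => T.iterate_mem_core j hy0
  have hcc := T.core_mono hαα'.le hββ'.le
  choose p r hypr hprsub hmax using fun j => T.exists_maximal_Icc hα' hβ1 (hcc (hy j))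
  have hle : ∀ j, p j ≤ r j := fun j => (hypr j).1.trans (hypr j).2
  have hmono : ∀ j n, StrictMonoOn (T.F^[n]) (Icc (p j) (r j)) := fun j n =>
    (T.strictMonoOn_iterate_of_subset_core hα' hβ' (hle j) (hprsub j) n).1
  have hstep : ∀ j n, p (j + n) ≤ T.F^[n] (p j) ∧ T.F^[n] (r j) ≤ r (j + n) := by
    intro j n
    refine hmax (j + n) _ _ ?_
      (T.strictMonoOn_iterate_of_subset_core hα' hβ' (hle j) (hprsub j) n).2
    rw [add_comm, Function.iterate_add_apply]
    exact ⟨(hmono j n).monotoneOn ⟨le_rfl, hle j⟩ (hypr j) (hypr j).1,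
      (hmono j n).monotoneOn (hypr j) ⟨hle j, le_rfl⟩ (hypr j).2⟩
  have hlt : ∀ j, p j < r j := by
    have h0 : p 0 < r 0 := by
      have := hmax 0 p₀ q₀ ⟨le_rfl, hpq.le⟩ (hsub.trans hcc)
      linarith
    intro j
    have h1 := hstep 0 j
    rw [zero_add] at h1
    exact h1.1.trans_lt ((hmono 0 j ⟨le_rfl, h0.le⟩ ⟨h0.le, le_rfl⟩ h0).trans_le h1.2)
  have hcell : ∀ j, ∀ x ∈ Icc (p j) (r j),
      x ∈ Icc (⌊T.F^[j] p₀⌋ + α') (⌊T.F^[j] p₀⌋ + β') := fun j x hx =>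
    T.Icc_subset_cell hα' (hprsub j) (hypr j) hx
  have hshift : ∀ j (m : ℤ), Icc (p j + m) (r j + m) ⊆ T.core α' β' := by
    intro j m x hx
    have := T.add_int_mem_core m (hprsub j (a := x - m) ⟨by linarith [hx.1], by linarith [hx.2]⟩)
    rwa [sub_add_cancel] at this
  have hincl : ∀ i j (m : ℤ) x, x ∈ Ioo (p i) (r i) → x + m ∈ Ioo (p j) (r j) →
      p j ≤ p i + m ∧ r i + m ≤ r j := by
    intro i j m x hx hxm
    have h := hmax j (min (p i + m) (p j)) (max (r i + m) (r j))
      ⟨(min_le_right _ _).trans (hypr j).1, (hypr j).2.trans (le_max_right _ _)⟩ ?_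
    · exact ⟨h.1.trans (min_le_left _ _), (le_max_left _ _).trans h.2⟩
    · intro z hz
      rcases le_total z (x + m) with hzx | hzx
      · rcases min_le_iff.1 hz.1 with h | h
        · exact hshift i m ⟨h, by linarith [hx.2]⟩
        · exact hprsub j ⟨h, by linarith [hxm.2]⟩
      · rcases le_max_iff.1 hz.2 with h | h
        · exact hshift i m ⟨by linarith [hx.1], h⟩
        · exact hprsub j ⟨by linarith [hxm.1], h⟩
  have hdisj : ∀ i j, i < j → ∀ x ∈ Ioo (p i) (r i), ∀ m : ℤ, x + m ∉ Ioo (p j) (r j) := by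
    intro i j hij x hx m hxm
    have h1 := hincl i j m x hx hxm
    have h2 := hincl j i (-m) (x + m) hxm (by simpa using hx)
    push_cast at h2
    have h3 := hstep i (j - i)
    rw [Nat.add_sub_cancel' hij.le] at h3
    exact T.not_trapped (n := j - i) (m := m) (by omega) (hlt i) (hmono i _).monotoneOn
      (by linarith) (by linarith)
  have hsum : ∀ J k, ∑ i ∈ Finset.range k, (r (J + i) - p (J + i)) ≤ 1 := fun J k =>
    sum_length_le_one_s8 (N := fun i => ⌊T.F^[J + i] p₀⌋) (fun i _ => hle _)
      (fun i _ => by linarith [(hcell (J + i) _ ⟨le_rfl, hle _⟩).1])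
      (fun i _ => by linarith [(hcell (J + i) _ ⟨hle _, le_rfl⟩).2])
      fun i _ j _ hij => hdisj _ _ (by omega)
  have htend : Tendsto (fun j => r j - p j) atTop (nhds 0) :=
    (summable_of_sum_range_le (c := 1) (fun j => sub_nonneg.2 (hle j))
      fun k => by simpa using hsum 0 k).tendsto_atTop_zero
  obtain ⟨J, hJ⟩ := eventually_atTop.1
    (htend.eventually (gt_mem_nhds (show 0 < (β' - β) / 2 by linarith)))
  obtain ⟨K, hK, hdist⟩ := T.exists_distortion hα' hβ'
  set t := r J + Real.exp (-(2 * K)) * (r J - p J) with ht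
  have hrt : r J < t := by
    have := mul_pos (Real.exp_pos (-(2 * K))) (sub_pos.2 (hlt J)); linarith
  have hleft : ∀ i, ⌊T.F^[J + i] p₀⌋ + α' ≤ T.F^[i] (p J) := fun i =>
    (hcell (J + i) _ ⟨le_rfl, hle _⟩).1.trans (hstep J i).1
  have hright : ∀ k, T.F^[k] t ≤ ⌊T.F^[J + k] p₀⌋ + β' := by
    intro k
    induction k using Nat.strong_induction_on with
    | _ k ih =>
    have hm : ∀ i ≤ k, StrictMonoOn (T.F^[i]) (Icc (p J) t) := fun i hi =>
      T.strictMonoOn_iterate (N := fun i => ⌊T.F^[J + i] p₀⌋)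
        (fun a _ => by linarith [hleft a]) fun a ha => by linarith [ih a (by omega)]
    have hP : p J ∈ Icc (p J) t := ⟨le_rfl, by linarith [hlt J]⟩
    have hR : r J ∈ Icc (p J) t := ⟨hle J, hrt.le⟩
    have hT : t ∈ Icc (p J) t := ⟨by linarith [hlt J], le_rfl⟩
    have hub : ∀ i ≤ k, T.F^[i] (p J) < T.F^[i] (r J) := fun i hi => hm i hi hP hR (hlt J)
    have hbt : ∀ i ≤ k, T.F^[i] (r J) < T.F^[i] t := fun i hi => hm i hi hR hT hrt
    have hd := fun i (hi : i < k) => hdist ⌊T.F^[J + i] p₀⌋ _ _ _ (hleft i) (hub i hi.le)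
      (hbt i hi.le) (ih i hi)
    have := (adjacent_ratio_bounds (k := k) (u := fun i => T.F^[i] (p J))
      (b := fun i => T.F^[i] (r J)) (t := fun i => T.F^[i] t) hK hub hbt
      (fun i hi => by simpa only [Function.iterate_succ_apply'] using (hd i hi).1)
      (fun i hi => by simpa only [Function.iterate_succ_apply'] using (hd i hi).2)
      (le_trans (Finset.sum_le_sum fun i _ => by linarith [hstep J i]) (hsum J k))
      (by simp [ht])).1
    have h1 := hstep J k
    have h2 := hJ (J + k) (by omega)
    have h3 := (hypr (J + k)).1
    have h4 := (T.mem_Icc_floor_of_mem_core (hy (J + k))).2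
    linarith
  have hm : ∀ n, StrictMonoOn (T.F^[n]) (Icc (p J) t) := fun n =>
    T.strictMonoOn_iterate (N := fun i => ⌊T.F^[J + i] p₀⌋)
      (fun a _ => by linarith [hleft a]) fun a _ => by linarith [hright a]
  have hpt : p J ≤ t := by linarith [hlt J]
  have := hmax J (p J) t ⟨(hypr J).1, (hypr J).2.trans hrt.le⟩ fun x hx n =>
    fract_mem_Icc_of_mem hα' hβ1 ⟨(hleft n).trans ((hm n).monotoneOn ⟨le_rfl, hpt⟩ hx hx.1),
      ((hm n).monotoneOn hx ⟨hpt, le_rfl⟩ hx.2).trans (hright n)⟩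
  linarith

end GapLift

lemma IsClosed.exists_gap_left {S : Set ℝ} {b c : ℝ} (hS : IsClosed S) (hc : c ∈ S) (hcb : c < b)
    (hev : ∀ᶠ w in nhdsWithin b (Iio b), w ∉ S) : ∃ u ∈ S, u < b ∧ ∀ w ∈ Ioo u b, w ∉ S := by
  obtain ⟨l, hl, hlS⟩ := mem_nhdsLT_iff_exists_Ioo_subset.1 hev
  have hl' : l < b := hl
  set d := (max l c + b) / 2 with hd
  have h1 : l ≤ max l c := le_max_left _ _
  have h2 : c ≤ max l c := le_max_right _ _
  have h3 : max l c < b := max_lt hl' hcb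
  have hne : (S ∩ Iic d).Nonempty := ⟨c, hc, by simp only [mem_Iic]; linarith⟩
  have hbd : BddAbove (S ∩ Iic d) := ⟨d, fun w hw => hw.2⟩
  have hmem := (hS.inter isClosed_Iic).csSup_mem hne hbd
  refine ⟨_, hmem.1, lt_of_le_of_lt hmem.2 (by linarith), fun w hw hwS => ?_⟩
  rcases le_or_gt w d with h | h
  · exact absurd (le_csSup hbd ⟨hwS, h⟩) (not_le.2 hw.1)
  · exact hlS ⟨by linarith, hw.2⟩ hwS

namespace GapLift

variable (T : GapLift)

lemma deriv_pos_of_mem_cell {N : ℤ} {x : ℝ} (hx : x ∈ Ioo (N : ℝ) (N + T.L)) :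
    0 < deriv T.F x := by
  have e : T.F = fun z => T.F (z - N) + N := by
    funext z; rw [← T.map_add_int, sub_add_cancel]
  rw [e, deriv_add_const, deriv_comp_sub_const]
  exact T.deriv_pos _ ⟨by linarith [hx.1], by linarith [hx.2]⟩

lemma volume_iterate_preimage_eq_zero {S : Set ℝ} (hS : volume S = 0) (n : ℕ) :
    volume {x | (∀ i < n, Int.fract (T.F^[i] x) ∈ Ioo 0 T.L) ∧ T.F^[n] x ∈ S} = 0 := by
  induction n with
  | zero => simpa using hS
  | succ n ih =>
    set S' := {x | (∀ i < n, Int.fract (T.F^[i] x) ∈ Ioo 0 T.L) ∧ T.F^[n] x ∈ S} with hS'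
    refine measure_mono_null (t := ⋃ N : ℤ, Ioo (N : ℝ) (N + T.L) ∩ T.F ⁻¹' S') ?_
      (measure_iUnion_null fun N => volume_inter_preimage_eq_zero measurableSet_Ioo
        (T.contDiff.differentiable two_ne_zero)
        ((T.strictMonoOn N).injOn.mono Ioo_subset_Icc_self)
        (fun x hx => (T.deriv_pos_of_mem_cell hx).ne') ih)
    rintro x ⟨h1, h2⟩
    refine mem_iUnion.2 ⟨⌊x⌋, ?_, ?_⟩
    · have := h1 0 (by omega)
      simp only [Function.iterate_zero, id, Int.fract] at this
      exact ⟨by linarith [this.1], by linarith [this.2]⟩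
    · exact ⟨fun i hi => by simpa using h1 (i + 1) (by omega), by simpa using h2⟩

lemma mem_core_of_iterate_mem {α β x : ℝ} {k : ℕ}
    (hx : ∀ i < k, Int.fract (T.F^[i] x) ∈ Icc α β) (hk : T.F^[k] x ∈ T.core α β) :
    x ∈ T.core α β := by
  intro n
  rcases lt_or_ge n k with h | h
  · exact hx n h
  · have := hk (n - k)
    rwa [← Function.iterate_add_apply, Nat.sub_add_cancel h] at this

lemma exists_left_pullback {x a₁ β : ℝ} (ha₁ : 0 ≤ a₁) (hβ : β < T.L)
    (hx : ∀ i, Int.fract (T.F^[i] x) ∈ Icc a₁ β) (n : ℕ) :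
    ∃ b ≤ x, (∀ i ≤ n, ⌊T.F^[i] x⌋ + a₁ ≤ T.F^[i] b) ∧ ∃ k ≤ n, T.F^[k] b = ⌊T.F^[k] x⌋ + a₁ := by
  have hx1 : ∀ i, ⌊T.F^[i] x⌋ + a₁ ≤ T.F^[i] x := fun i => by
    have := (hx i).1; rw [Int.fract] at this; linarith
  have hx2 : ∀ i, T.F^[i] x ≤ ⌊T.F^[i] x⌋ + T.L := fun i => by
    have := (hx i).2; rw [Int.fract] at this; linarith
  induction n with
  | zero => exact ⟨⌊x⌋ + a₁, hx1 0, fun i hi => by simp [Nat.le_zero.1 hi], 0, le_rfl, rfl⟩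
  | succ n ih =>
    obtain ⟨b, hbx, hb, k, hk, hbk⟩ := ih
    rcases le_or_gt (⌊T.F^[n + 1] x⌋ + a₁) (T.F^[n + 1] b) with h | h
    · refine ⟨b, hbx, fun i hi => ?_, k, by omega, hbk⟩
      rcases Nat.lt_or_ge n i with hi' | hi'
      · rwa [show i = n + 1 by omega]
      · exact hb i hi'
    · obtain ⟨b', hbc, hbe⟩ := intermediate_value_Icc hbx
        (T.continuous_iterate (n + 1)).continuousOn ⟨h.le, hx1 (n + 1)⟩
      refine ⟨b', hbc.2, fun i hi => ?_, n + 1, le_rfl, hbe⟩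
      rcases Nat.lt_or_ge n i with hi' | hi'
      · rw [show i = n + 1 by omega, hbe]
      · refine (hb i hi').trans ?_
        exact (T.strictMonoOn_iterate (N := fun i => ⌊T.F^[i] x⌋)
          (fun j hj => by linarith [hb j (by omega)]) fun j _ => hx2 j).monotoneOn
          ⟨le_rfl, hbx⟩ hbc hbc.1

/-- The part of a `core` to the left of a point first hitting the minimum of the `core` at time
`k` is a gap whose forward images are pairwise disjoint. -/
lemma exists_gap_of_first_hit {a β a₁ b : ℝ} {k : ℕ} {N : ℕ → ℤ} (ha : 0 < a) (hβ : β < T.L)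
    (ha₁ : a₁ ∈ T.core a β) (haa₁ : a ≤ a₁) (hmin : ∀ y ∈ T.core a β, a₁ ≤ Int.fract y)
    (hb : ∀ i ≤ k, T.F^[i] b ∈ Icc (N i + a₁) (N i + β)) (hk : T.F^[k] b = N k + a₁)
    (hfirst : ∀ i < k, T.F^[i] b ≠ N i + a₁) :
    ∃ u < b, (∀ w ∈ Ioo u b, w ∉ T.core a β) ∧ (∀ i < k, N i + a₁ ≤ T.F^[i] u) ∧
      ∑ i ∈ Finset.range k, (T.F^[i] b - T.F^[i] u) ≤ 1 ∧
      1 - T.L ≤ T.F^[k] b - T.F^[k] u := by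
  have hL1 := T.L_lt_one
  have hcell : ∀ (M : ℤ) y, y ∈ Icc (M + a₁) (M + β) → Int.fract y ∈ Icc a β := fun M y hy =>
    fract_mem_Icc_of_mem ha (by linarith) ⟨by linarith [hy.1], hy.2⟩
  have hNa : ∀ M : ℤ, (M : ℝ) + a₁ ∈ T.core a β := fun M => by
    rw [add_comm]; exact T.add_int_mem_core M ha₁
  have hbcore : b ∈ T.core a β :=
    T.mem_core_of_iterate_mem (fun i hi => hcell _ _ (hb i hi.le)) (by rw [hk]; exact hNa _)
  have hev : ∀ᶠ w in nhdsWithin b (Iio b), w ∉ T.core a β := by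
    have h1 : ∀ᶠ w in nhds b, ∀ i ∈ Finset.range (k + 1), (N i : ℝ) < T.F^[i] w := by
      rw [Filter.eventually_all_finset]
      intro i hi
      refine (T.continuous_iterate i).continuousAt.eventually (lt_mem_nhds ?_)
      linarith [(hb i (by simp at hi; omega)).1]
    filter_upwards [h1.filter_mono nhdsWithin_le_nhds, self_mem_nhdsWithin] with w hw hwb hwc
    have hwb' : w < b := hwb
    have hlt : T.F^[k] w < T.F^[k] b :=
      T.strictMonoOn_iterate (N := N) (fun i hi => (hw i (by simp; omega)).le)
        (fun i hi => by linarith [(hb i hi.le).2]) ⟨le_rfl, hwb'.le⟩ ⟨hwb'.le, le_rfl⟩ hwb'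
    have h2 := hw k (by simp)
    have h3 := hmin _ (T.iterate_mem_core k hwc)
    rw [Int.fract, floor_eq_of_mem_Ico (N := N k) h2.le
      (by linarith [(hb k le_rfl).2])] at h3
    linarith
  obtain ⟨u, hu, hub, hgap⟩ := (T.isClosed_core ha (by linarith)).exists_gap_left
    (T.add_int_mem_core (-1) hbcore) (by push_cast; linarith) hev
  have key : ∀ i ≤ k, T.F^[i] u < T.F^[i] b ∧
      ∀ w ∈ Ioo (T.F^[i] u) (T.F^[i] b), w ∉ T.core a β := by
    intro i
    induction i with
    | zero => exact fun _ => ⟨hub, hgap⟩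
    | succ i ih =>
      intro hi
      obtain ⟨h1, h2⟩ := ih (by omega)
      have hbi := hb i (by omega)
      have hlow : N i + a₁ ≤ T.F^[i] u := by
        by_contra! h
        exact h2 _ ⟨h, lt_of_le_of_ne hbi.1 (hfirst i (by omega)).symm⟩ (hNa _)
      rw [Function.iterate_succ_apply', Function.iterate_succ_apply']
      refine ⟨T.strictMonoOn (N i) ⟨by linarith, by linarith [hbi.2]⟩
        ⟨by linarith [hbi.1], by linarith [hbi.2]⟩ h1, ?_⟩
      rintro w hw hwc
      obtain ⟨w', hw', rfl⟩ := intermediate_value_Ioo h1.le T.continuous.continuousOn hw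
      exact h2 w' hw' (T.mem_core_of_map_mem
        (hcell (N i) _ ⟨by linarith [hw'.1], by linarith [hw'.2, hbi.2]⟩) hwc)
  have hlow : ∀ i < k, N i + a₁ ≤ T.F^[i] u := by
    intro i hi
    by_contra! h
    exact (key i hi.le).2 _ ⟨h, lt_of_le_of_ne (hb i hi.le).1 (hfirst i hi).symm⟩ (hNa _)
  refine ⟨u, hub, hgap, hlow, ?_, ?_⟩
  · refine sum_length_le_one_s8 (N := N) (fun i hi => (key i (by simp at hi; omega)).1.le)
      (fun i hi => by linarith [hlow i (by simpa using hi)])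
      (fun i hi => by linarith [(hb i (by simp at hi; omega)).2]) ?_
    intro i hi j hj hij x hx m hxm
    simp only [Finset.mem_range] at hi hj
    have hbi := T.iterate_mem_core i hbcore
    have hbj := T.iterate_mem_core j hbcore
    have heq : T.F^[j] b = T.F^[i] b + m := by
      rcases lt_trichotomy (T.F^[j] b) (T.F^[i] b + m) with h | h | h
      · exfalso
        refine (key i hi.le).2 (T.F^[j] b + (-m : ℤ)) ?_ (T.add_int_mem_core _ hbj)
        push_cast
        exact ⟨by linarith [hx.1, hxm.2], by linarith⟩
      · exact h
      · exfalso
        exact (key j hj.le).2 _ ⟨by linarith [hx.2, hxm.1], h⟩ (T.add_int_mem_core m hbi)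
    have h1 : T.F^[k] b = T.F^[k - j + i] b + m := by
      rw [Function.iterate_add_apply, ← T.iterate_add_int, ← heq, ← Function.iterate_add_apply,
        Nat.sub_add_cancel hj.le]
    have h2 := hb (k - j + i) (by omega)
    have h3 : T.F^[k - j + i] b = (N k - m : ℤ) + a₁ := by push_cast; linarith
    have h4 : N (k - j + i) = N k - m := by
      rw [← floor_eq_of_mem_Ico (N := N (k - j + i)) (y := T.F^[k - j + i] b)
        (by linarith [h2.1]) (by linarith [h2.2]), h3, Int.floor_intCast_add]
      have h5 : a₁ ≤ β := by linarith [h2.1, h2.2]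
      rw [Int.floor_eq_zero_iff.2 ⟨by linarith, by linarith⟩, add_zero]
    exact hfirst (k - j + i) (by omega) (by rw [h3, h4])
  · have h1 := (key k le_rfl).1
    have h2 := T.iterate_mem_core k hu
    have h3 := hmin _ h2
    have h4 := T.mem_Icc_floor_of_mem_core h2
    rw [Int.fract] at h3
    have h5 : ⌊T.F^[k] u⌋ ≤ N k - 1 := by
      have : (⌊T.F^[k] u⌋ : ℝ) < N k := by linarith
      have := Int.cast_lt.1 this
      omega
    have h6 : (⌊T.F^[k] u⌋ : ℝ) ≤ N k - 1 := by exact_mod_cast h5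
    linarith [h4.2]

lemma volume_returning_eq_zero {a β a₁ K : ℝ} (ha : 0 < a) (hβ : β < T.L)
    (ha₁ : a₁ ∈ T.core a β) (haa₁ : a ≤ a₁) (hmin : ∀ y ∈ T.core a β, a₁ ≤ Int.fract y)
    (hK : 0 ≤ K) (hdist : ∀ (N : ℤ) (p q t : ℝ), N + a ≤ p → p < q → q < t → t ≤ N + β →
      (T.F t - T.F q) * (q - p) ≤ Real.exp (K * (t - p)) * ((T.F q - T.F p) * (t - q)) ∧
      (T.F q - T.F p) * (t - q) ≤ Real.exp (K * (t - p)) * ((T.F t - T.F q) * (q - p))) :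
    volume {x ∈ T.core a β |
      (∀ M : ℕ, ∃ n ≥ M, Int.fract (T.F^[n] x) < a₁ + Real.exp (-(4 * K)) * (1 - T.L)) ∧
      ∀ n : ℕ, Int.fract (T.F^[n] x) ≠ a₁} = 0 := by
  refine volume_eq_zero_of_porous (Real.exp_pos (2 * K)) ?_
  rintro x ⟨hx, hret, hne⟩ r hr
  have hL1 := T.L_lt_one
  have hxa : ∀ i, Int.fract (T.F^[i] x) ∈ Icc a₁ β := fun i =>
    ⟨hmin _ (T.iterate_mem_core i hx), (hx i).2⟩
  have hxβ : ∀ i, T.F^[i] x ≤ ⌊T.F^[i] x⌋ + β := fun i => by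
    have := (hxa i).2; rw [Int.fract] at this; linarith
  obtain ⟨w, hw, hwc⟩ := not_subset.1 (T.not_Icc_subset_core ha hβ (sub_lt_self x hr))
  obtain ⟨i, hi⟩ : ∃ i : ℕ, Int.fract (T.F^[i] w) ∉ Icc a β := by
    simpa [core] using hwc
  obtain ⟨n, hin, hn⟩ := hret i
  obtain ⟨b, hbx, hb, hhit⟩ := T.exists_left_pullback (by linarith) hβ hxa n
  have hex : ∃ k, T.F^[k] b = ⌊T.F^[k] x⌋ + a₁ := by
    obtain ⟨k, -, h⟩ := hhit; exact ⟨k, h⟩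
  classical
  obtain ⟨k, hkn, hk, hfirst⟩ : ∃ k ≤ n, T.F^[k] b = ⌊T.F^[k] x⌋ + a₁ ∧
      ∀ i < k, T.F^[i] b ≠ ⌊T.F^[i] x⌋ + a₁ := by
    obtain ⟨k, hkn, h⟩ := hhit
    exact ⟨Nat.find hex, (Nat.find_min' hex h).trans hkn, Nat.find_spec hex,
      fun i hi => Nat.find_min hex hi⟩
  have hbx' : b < x := by
    refine lt_of_le_of_ne hbx ?_
    rintro rfl
    apply hne k
    rw [Int.fract]; linarith
  have hmono : ∀ j ≤ n, StrictMonoOn (T.F^[j]) (Icc b x) := fun j hj =>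
    T.strictMonoOn_iterate (N := fun i => ⌊T.F^[i] x⌋)
      (fun i hi => by linarith [hb i (by omega)]) fun i _ => by linarith [hxβ i]
  have hmem_b : b ∈ Icc b x := ⟨le_rfl, hbx⟩
  have hmem_x : x ∈ Icc b x := ⟨hbx, le_rfl⟩
  have hxb : x - b < r := by
    by_contra! h
    have hwb : w ∈ Icc b x := ⟨by linarith [hw.1], hw.2⟩
    refine hi (fract_mem_Icc_of_mem ha (by linarith) (N := ⌊T.F^[i] x⌋) ⟨?_, ?_⟩)
    · linarith [hb i hin, (hmono i hin).monotoneOn hmem_b hwb hwb.1]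
    · linarith [hxβ i, (hmono i hin).monotoneOn hwb hmem_x hwb.2]
  have hzk : Int.fract (T.F^[k] x) < a₁ + Real.exp (-(4 * K)) * (1 - T.L) := by
    rcases hkn.eq_or_lt with rfl | hlt
    · exact hn
    · by_contra! h
      have hle : Int.fract (T.F^[n] x) ≤ Int.fract (T.F^[k] x) := hn.le.trans h
      simp only [Int.fract] at hle
      have hit : ∀ j y, T.F^[j] (T.F^[k] y) = T.F^[j + k] y := fun j y =>
        (Function.iterate_add_apply _ _ _ _).symm
      refine T.not_trapped (n := n - k) (m := ⌊T.F^[n] x⌋ - ⌊T.F^[k] x⌋) (by omega)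
        (hmono k hkn hmem_b hmem_x hbx') (T.strictMonoOn_iterate
          (N := fun j => ⌊T.F^[j + k] x⌋) (fun j hj => ?_) fun j hj => ?_).monotoneOn ?_ ?_
      · rw [hit]; linarith [hb (j + k) (by omega)]
      · rw [hit]; linarith [hxβ (j + k)]
      · rw [hit, Nat.sub_add_cancel hkn, hk]; push_cast; linarith [hb n le_rfl]
      · rw [hit, Nat.sub_add_cancel hkn]; push_cast; linarith
  obtain ⟨u, hub, hgap, hlow, hsum, hbig⟩ := T.exists_gap_of_first_hit
    (N := fun i => ⌊T.F^[i] x⌋) ha hβ ha₁ haa₁ hmin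
    (fun i hi => ⟨hb i (by omega), by
      linarith [hxβ i, (hmono i (by omega)).monotoneOn hmem_b hmem_x hbx]⟩) hk hfirst
  have hclose : x - b ≤ Real.exp (-(2 * K)) * (b - u) := by
    by_contra! h
    set t := b + Real.exp (-(2 * K)) * (b - u) with ht
    have hbt : b < t := by
      have := mul_pos (Real.exp_pos (-(2 * K))) (sub_pos.2 hub); linarith
    have htx : t < x := by linarith
    have hm : ∀ j ≤ k, StrictMonoOn (T.F^[j]) (Icc u x) := fun j hj =>
      T.strictMonoOn_iterate (N := fun i => ⌊T.F^[i] x⌋)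
        (fun i hi => by linarith [hlow i (by omega)]) fun i _ => by linarith [hxβ i]
    have hU : u ∈ Icc u x := ⟨le_rfl, by linarith⟩
    have hB : b ∈ Icc u x := ⟨hub.le, hbx⟩
    have hT : t ∈ Icc u x := ⟨by linarith, htx.le⟩
    have hX : x ∈ Icc u x := ⟨by linarith, le_rfl⟩
    have h1 : ∀ i ≤ k, T.F^[i] u < T.F^[i] b := fun i hi => hm i hi hU hB hub
    have h2 : ∀ i ≤ k, T.F^[i] b < T.F^[i] t := fun i hi => hm i hi hB hT hbt
    have hd := fun i (hi : i < k) => hdist ⌊T.F^[i] x⌋ _ _ _ (by linarith [hlow i hi])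
      (h1 i hi.le) (h2 i hi.le) (by linarith [hxβ i, hm i hi.le hT hX htx])
    have := (adjacent_ratio_bounds (k := k) (u := fun i => T.F^[i] u)
      (b := fun i => T.F^[i] b) (t := fun i => T.F^[i] t) hK h1 h2
      (fun i hi => by simpa only [Function.iterate_succ_apply'] using (hd i hi).1)
      (fun i hi => by simpa only [Function.iterate_succ_apply'] using (hd i hi).2)
      hsum (by simp [ht])).2
    have h3 := mul_le_mul_of_nonneg_left hbig (Real.exp_pos (-(4 * K))).le
    have h4 := hm k le_rfl hT hX htx
    rw [Int.fract] at hzk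
    linarith
  refine ⟨b, hbx', hxb, disjoint_left.2 fun v hv hvE => hgap v ⟨?_, hv.2⟩ hvE.1⟩
  have h5 := mul_le_mul_of_nonneg_left hclose (Real.exp_pos (2 * K)).le
  rw [← mul_assoc, ← Real.exp_add, add_neg_cancel, Real.exp_zero, one_mul] at h5
  linarith [hv.1]

lemma exists_min_core {a β : ℝ} (ha : 0 < a) (hβ : β < 1) (hne : (T.core a β).Nonempty) :
    ∃ a₁ ∈ T.core a β, a ≤ a₁ ∧ ∀ y ∈ T.core a β, a₁ ≤ Int.fract y := by
  have hfr : ∀ y ∈ T.core a β, Int.fract y ∈ T.core a β ∩ Icc a β := fun y hy => by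
    refine ⟨?_, hy 0⟩
    have := T.add_int_mem_core (-⌊y⌋) hy
    push_cast at this
    rwa [← sub_eq_add_neg] at this
  have hcpt : IsCompact (T.core a β ∩ Icc a β) :=
    isCompact_Icc.inter_left (T.isClosed_core ha hβ)
  obtain ⟨y, hy⟩ := hne
  obtain ⟨a₁, h1, h2⟩ := hcpt.exists_isLeast ⟨_, hfr y hy⟩
  exact ⟨a₁, h1.1, h1.2.1, fun z hz => h2 (hfr z hz)⟩

lemma volume_core_eq_zero_of_step {a β K : ℝ} (ha : 0 < a) (hβ : β < T.L)
    (hK : 0 ≤ K) (hdist : ∀ (N : ℤ) (p q t : ℝ), N + a ≤ p → p < q → q < t → t ≤ N + β →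
      (T.F t - T.F q) * (q - p) ≤ Real.exp (K * (t - p)) * ((T.F q - T.F p) * (t - q)) ∧
      (T.F q - T.F p) * (t - q) ≤ Real.exp (K * (t - p)) * ((T.F t - T.F q) * (q - p)))
    (hstep : volume (T.core (a + Real.exp (-(4 * K)) * (1 - T.L)) β) = 0) :
    volume (T.core a β) = 0 := by
  rcases (T.core a β).eq_empty_or_nonempty with h | hne
  · simp [h]
  obtain ⟨a₁, ha₁, haa₁, hmin⟩ := T.exists_min_core ha (hβ.trans T.L_lt_one) hne
  have h1 := T.volume_returning_eq_zero ha hβ ha₁ haa₁ hmin hK hdist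
  have hcount : volume {y : ℝ | Int.fract y = a₁} = 0 := by
    refine ((countable_range fun m : ℤ => (m : ℝ) + a₁).mono ?_).measure_zero volume
    intro y hy
    exact ⟨⌊y⌋, by rw [← (show Int.fract y = a₁ from hy)]; exact Int.floor_add_fract y⟩
  refine measure_mono_null ?_ (measure_union_null h1 (measure_union_null
    (measure_iUnion_null fun n => T.volume_iterate_preimage_eq_zero hstep n)
    (measure_iUnion_null fun n => T.volume_iterate_preimage_eq_zero hcount n)))
  intro x hx
  have hIoo : ∀ i, Int.fract (T.F^[i] x) ∈ Ioo 0 T.L := fun i =>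
    ⟨by linarith [(hx i).1], by linarith [(hx i).2]⟩
  by_cases hc : ∀ n : ℕ, Int.fract (T.F^[n] x) ≠ a₁
  · by_cases hr : ∀ M : ℕ, ∃ n ≥ M,
        Int.fract (T.F^[n] x) < a₁ + Real.exp (-(4 * K)) * (1 - T.L)
    · exact Or.inl ⟨hx, hr, hc⟩
    · push Not at hr
      obtain ⟨M, hM⟩ := hr
      refine Or.inr (Or.inl (mem_iUnion.2 ⟨M, fun i _ => hIoo i, fun j => ?_⟩))
      rw [← Function.iterate_add_apply]
      exact ⟨by linarith [hM (j + M) (by omega)], (hx _).2⟩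
  · push Not at hc
    obtain ⟨n, hn⟩ := hc
    exact Or.inr (Or.inr (mem_iUnion.2 ⟨n, fun i _ => hIoo i, hn⟩))

lemma volume_core_eq_zero {a β : ℝ} (ha : 0 < a) (hβ : β < T.L) :
    volume (T.core a β) = 0 := by
  obtain ⟨K, hK, hdist⟩ := T.exists_distortion ha hβ
  set δ := Real.exp (-(4 * K)) * (1 - T.L) with hδ
  have hδ0 : 0 < δ := mul_pos (Real.exp_pos _) (by linarith [T.L_lt_one])
  have key : ∀ n : ℕ, ∀ a' ≥ a, β < a' + n * δ → volume (T.core a' β) = 0 := by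
    intro n
    induction n with
    | zero =>
      intro a' _ h
      have : T.core a' β = ∅ := by
        refine eq_empty_of_forall_notMem fun x hx => ?_
        have := hx 0
        simp at h
        linarith [this.1, this.2]
      simp [this]
    | succ n ih =>
      intro a' ha' h
      refine T.volume_core_eq_zero_of_step (by linarith) hβ hK
        (fun N p q t hp => hdist N p q t (by linarith)) (ih _ (by linarith) ?_)
      push_cast at h
      linarith
  obtain ⟨n, hn⟩ := exists_nat_gt ((β - a) / δ)
  exact key n a le_rfl (by rw [div_lt_iff₀ hδ0] at hn; linarith)

lemma iterate_reflect (n : ℕ) (x : ℝ) :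
    (fun x => T.L - T.F (T.L - x))^[n] x = T.L - T.F^[n] (T.L - x) := by
  induction n with
  | zero => simp
  | succ n ih => simp only [Function.iterate_succ_apply', ih, sub_sub_cancel]

/-- The conjugate of a `GapLift` by the reflection `x ↦ L - x`. -/
def reflect : GapLift where
  F := fun x => T.L - T.F (T.L - x)
  L := T.L
  η := T.η
  C := T.C
  L_pos := T.L_pos
  η_pos := T.η_pos
  η_le := T.η_le
  C_nonneg := T.C_nonneg
  map_add_one x := by
    have := T.map_add_int (T.L - x) (-1)
    push_cast at this
    rw [show T.L - (x + 1) = T.L - x + -1 by ring, this]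
    ring
  contDiff := contDiff_const.sub (T.contDiff.comp (contDiff_const.sub contDiff_id))
  deriv_pos x hx := by
    rw [deriv_const_sub, deriv_comp_const_sub, neg_neg]
    exact T.deriv_pos _ ⟨by linarith [hx.2], by linarith [hx.1]⟩
  defect s hs t₁ ht₁ t₂ ht₂ h₁ h₂ h := by
    have := T.defect (T.L - s) ⟨by linarith [hs.2], by linarith [hs.1]⟩
      (T.L - t₂) ⟨by linarith [ht₂.2], by linarith [ht₂.1]⟩
      (T.L - t₁) ⟨by linarith [ht₁.2], by linarith [ht₁.1]⟩
      (fun e => h₂ (by linarith)) (fun e => h₁ (by linarith)) (by linarith)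
    rw [slopeDefect_reflect, slopeDefect_reflect]
    linarith
  orbit_zero_left j hj m h := by
    rw [iterate_reflect, sub_zero] at h
    refine T.orbit_L_right j hj (-m) ?_
    push_cast
    exact ⟨by linarith [h.2], by linarith [h.1]⟩
  orbit_zero_near j hj m h := by
    rw [iterate_reflect, sub_zero] at h
    refine T.orbit_L_near j hj (-m) ?_
    push_cast
    exact ⟨by linarith [h.2], by linarith [h.1]⟩
  orbit_L_right j hj m h := by
    rw [iterate_reflect, sub_self] at h
    refine T.orbit_zero_left j hj (-m) ?_
    push_cast
    exact ⟨by linarith [h.2], by linarith [h.1]⟩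
  orbit_L_near j hj m h := by
    rw [iterate_reflect, sub_self] at h
    refine T.orbit_zero_near j hj (-m) ?_
    push_cast
    exact ⟨by linarith [h.2], by linarith [h.1]⟩
  repelling x n hn := by
    rintro ⟨m, hm⟩
    rw [iterate_reflect] at hm
    rw [show (fun x => T.L - T.F (T.L - x))^[n] = fun x => T.L - T.F^[n] (T.L - x) from
      funext (T.iterate_reflect n), deriv_const_sub, deriv_comp_const_sub, neg_neg]
    exact T.repelling _ n hn ⟨-m, by push_cast; linarith⟩

lemma fract_reflect_iterate {x : ℝ} (hx : x ∈ T.staying) (n : ℕ) :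
    Int.fract (T.reflect.F^[n] (T.L - x)) = T.L - Int.fract (T.F^[n] x) := by
  have h : T.reflect.F^[n] (T.L - x) = T.L - T.F^[n] x := by
    have := T.iterate_reflect n (T.L - x)
    rwa [sub_sub_cancel] at this
  have hn := hx n
  rw [h, Int.fract_eq_iff]
  refine ⟨by linarith [hn.2], by linarith [hn.1, T.L_lt_one], -⌊T.F^[n] x⌋, ?_⟩
  rw [Int.fract]; push_cast; ring

lemma volume_staying : volume T.staying = 0 := by
  have hrefl : volume ((fun x => T.L - x) ⁻¹' T.reflect.approachingZero) = 0 :=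
    (Measure.measurePreserving_sub_left volume T.L).quasiMeasurePreserving.preimage_null
      T.reflect.volume_approachingZero
  refine measure_mono_null ?_ (measure_union_null T.volume_approachingZero
    (measure_union_null hrefl (measure_iUnion_null fun k : ℕ =>
      T.volume_core_eq_zero (a := 1 / ((k : ℝ) + 1)) (β := T.L - 1 / ((k : ℝ) + 1))
        (by positivity) (sub_lt_self _ (by positivity)))))
  intro x hx
  by_cases h0 : ∀ r > 0, ∃ n : ℕ, Int.fract (T.F^[n] x) < r
  · exact Or.inl ⟨hx, h0⟩
  by_cases hL : ∀ r > 0, ∃ n : ℕ, Int.fract (T.reflect.F^[n] (T.L - x)) < r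
  · refine Or.inr (Or.inl ⟨fun n => ?_, hL⟩)
    rw [T.fract_reflect_iterate hx]
    have := hx n
    exact ⟨by linarith [this.2], (by linarith [this.1] : T.L - Int.fract (T.F^[n] x) < T.L)⟩
  push Not at h0 hL
  obtain ⟨r, hr, h0⟩ := h0
  obtain ⟨s, hs, hL⟩ := hL
  obtain ⟨k, hk⟩ := exists_nat_one_div_lt (lt_min hr hs)
  refine Or.inr (Or.inr (mem_iUnion.2 ⟨k, fun n => ?_⟩))
  have h1 := h0 n
  have h2 := hL n
  rw [T.fract_reflect_iterate hx] at h2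
  exact ⟨by linarith [min_le_left r s], by linarith [min_le_right r s]⟩

end GapLift

/-- The orbit of a critical point never returns to the plateau of the associated monotone map
when the latter has irrational rotation number. -/
lemma CircleDeg1Lift.iterate_sub_int_notMem_plateau (g : CircleDeg1Lift) {F : ℝ → ℝ}
    (hF : ∀ x, F (x + 1) = F x + 1) {p q c v : ℝ} (hconst : ∀ x ∈ Icc p q, g x = v)
    (heq : ∀ x ∈ Icc q (p + 1), g x = F x) (hc : c ∈ Icc p q) (hFc : F c = v)
    (hirr : Irrational g.translationNumber) {j : ℕ} (hj : 1 ≤ j) (m : ℤ) :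
    F^[j] c - m ∉ Icc p q := by
  have hg : ∀ j : ℕ, 1 ≤ j → ∀ m : ℤ, g^[j] c - m ∉ Icc p q := by
    intro j hj m hmem
    have h1 : (g ^ j) (g c) = g c + m := by
      rw [CircleDeg1Lift.coe_pow, ← Function.iterate_succ_apply, Function.iterate_succ_apply',
        ← sub_add_cancel (g^[j] c) (m : ℝ), g.map_add_int, hconst _ hmem, hconst c hc]
    rw [g.translationNumber_of_map_pow_eq_add_int h1 hj] at hirr
    exact hirr ⟨m / j, by push_cast; rfl⟩
  have hFg : ∀ j, F^[j] c = g^[j] c := by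
    intro j
    induction j with
    | zero => rfl
    | succ j ih =>
      rw [Function.iterate_succ_apply', Function.iterate_succ_apply', ih]
      rcases Nat.eq_zero_or_pos j with rfl | hj
      · simp [hFc, hconst c hc]
      · set x := g^[j] c
        have h1 := Int.floor_le (x - p)
        have h2 := Int.lt_floor_add_one (x - p)
        have h3 := hg j hj ⌊x - p⌋
        have h4 : q < x - ⌊x - p⌋ := by
          by_contra! h
          exact h3 ⟨by linarith, h⟩
        rw [← sub_add_cancel x (⌊x - p⌋ : ℝ), map_add_int_of_map_add_one hF, g.map_add_int,
          heq _ ⟨h4.le, by linarith⟩]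
  rw [hFg]
  exact hg j hj m

namespace BimodData

variable (B : BimodData)

lemma iterate_translate (n : ℕ) (x : ℝ) :
    (fun x => B.F (x + B.ctm) - B.ctm)^[n] x = B.F^[n] (x + B.ctm) - B.ctm := by
  induction n with
  | zero => simp
  | succ n ih => simp only [Function.iterate_succ_apply', ih, sub_add_cancel]

lemma iterate_add_one (n : ℕ) (x : ℝ) : B.F^[n] (x + 1) = B.F^[n] x + 1 := by
  induction n generalizing x with
  | zero => rfl
  | succ n ih => rw [Function.iterate_succ_apply, Function.iterate_succ_apply, B.hlift, ih]

lemma iterate_ctm_notMem {j : ℕ} (hj : 1 ≤ j) (m : ℤ) :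
    B.F^[j] B.ctm - m ∉ Icc B.dtm B.ctm :=
  B.Fm.iterate_sub_int_notMem_plateau B.hlift B.hFm1 B.hFm2
    ⟨(B.hdtm.2.trans B.h1).le, le_rfl⟩ rfl B.hirrm hj m

lemma iterate_ctp_notMem {j : ℕ} (hj : 1 ≤ j) (m : ℤ) :
    B.F^[j] B.ctp - m ∉ Icc B.ctp B.dtp :=
  B.Fp.iterate_sub_int_notMem_plateau B.hlift B.hFp1 B.hFp2
    ⟨le_rfl, (B.h1.trans B.hdtp.1).le⟩ rfl B.hirrp hj m

lemma exists_slopeDefect_translate_le : ∃ C, 0 ≤ C ∧ ∀ s ∈ Ioo 0 (B.ctp + 1 - B.ctm),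
    ∀ t₁ ∈ Icc 0 (B.ctp + 1 - B.ctm), ∀ t₂ ∈ Icc 0 (B.ctp + 1 - B.ctm), t₁ ≠ s → t₂ ≠ s →
      t₁ < t₂ → slopeDefect (fun x => B.F (x + B.ctm) - B.ctm) s t₂ ≤
        slopeDefect (fun x => B.F (x + B.ctm) - B.ctm) s t₁ + C := by
  have hadd : ∀ c : ℝ, ContDiff ℝ 2 fun x : ℝ => x + c := fun c => contDiff_id.add contDiff_const
  have htend : ∀ c x : ℝ, Tendsto (fun x : ℝ => x + c) (nhds x) (nhds (x + c)) := fun c x =>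
    (continuous_add_const c).tendsto x
  refine exists_slopeDefect_le (ψ := fun x => B.psim (x + B.ctm))
    (φ := fun x => B.psip (x + (B.ctm - 1))) (by linarith [B.h0, B.h2]) B.hlm B.hlp
    ((B.hC2.comp (hadd _)).sub contDiff_const) (fun x hx => ?_)
    (B.hpsimC2.comp (hadd _)) (by simp [B.hpsim0]) ?_ ?_
    (B.hpsipC2.comp (hadd _)) ?_ ?_ ?_
  · rw [deriv_sub_const, deriv_comp_add_const]
    exact B.hincr _ ⟨by linarith [hx.1], by linarith [hx.2]⟩
  · rw [deriv_comp_add_const]; exact B.hpsimD _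
  · have h := htend B.ctm 0
    rw [zero_add] at h
    filter_upwards [h.eventually B.hpsimEq] with x hx
    rw [hx, zero_add]; ring
  · rw [show B.ctp + 1 - B.ctm + (B.ctm - 1) = B.ctp by ring, B.hpsip0]
  · rw [deriv_comp_add_const]; exact B.hpsipD _
  · have h := htend (B.ctm - 1) (B.ctp + 1 - B.ctm)
    rw [show B.ctp + 1 - B.ctm + (B.ctm - 1) = B.ctp by ring] at h
    filter_upwards [h.eventually B.hpsipEq] with x hx
    rw [show x + B.ctm = x + (B.ctm - 1) + 1 by ring, B.hlift, hx, sub_add_cancel, B.hlift]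
    ring

/-- The lift of a bimodal map, translated so that `c̃⁻` becomes the origin. -/
lemma exists_gapLift : ∃ T : GapLift, T.F = (fun x => B.F (x + B.ctm) - B.ctm) ∧
    T.L = B.ctp + 1 - B.ctm := by
  obtain ⟨C, hC0, hC⟩ := B.exists_slopeDefect_translate_le
  have h1 := B.h1
  obtain ⟨hdm, hdm'⟩ := B.hdtm
  obtain ⟨hdp, hdp'⟩ := B.hdtp
  obtain ⟨η, hη, hη1, hη2, hη3⟩ : ∃ η, 0 < η ∧ η ≤ B.ctm - B.ctp ∧ η ≤ B.ctp - B.dtm ∧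
      η ≤ B.dtp - B.ctm :=
    ⟨min (B.ctm - B.ctp) (min (B.ctp - B.dtm) (B.dtp - B.ctm)),
      lt_min (by linarith) (lt_min (by linarith) (by linarith)), min_le_left _ _,
      (min_le_right _ _).trans (min_le_left _ _), (min_le_right _ _).trans (min_le_right _ _)⟩
  have hL : ∀ j, B.F^[j] (B.ctp + 1 - B.ctm + B.ctm) = B.F^[j] B.ctp + 1 := fun j => by
    rw [sub_add_cancel, B.iterate_add_one]
  exact ⟨{
    F := fun x => B.F (x + B.ctm) - B.ctm
    L := B.ctp + 1 - B.ctm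
    η := η
    C := C
    L_pos := by linarith [B.h0, B.h2]
    η_pos := hη
    η_le := by linarith
    C_nonneg := hC0
    map_add_one := fun x => by
      rw [show x + 1 + B.ctm = x + B.ctm + 1 by ring, B.hlift]; ring
    contDiff := (B.hC2.comp (contDiff_id.add contDiff_const)).sub contDiff_const
    deriv_pos := fun x hx => by
      rw [deriv_sub_const, deriv_comp_add_const]
      exact B.hincr _ ⟨by linarith [hx.1], by linarith [hx.2]⟩
    defect := hC
    orbit_zero_left := fun j hj m h => by
      rw [iterate_translate, zero_add] at h
      exact B.iterate_ctm_notMem hj m ⟨by linarith [h.1], by linarith [h.2]⟩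
    orbit_zero_near := fun j hj m h => by
      rw [iterate_translate, zero_add] at h
      refine B.iterate_ctm_notMem hj (m + 1) ?_
      push_cast
      exact ⟨by linarith [h.1], by linarith [h.2]⟩
    orbit_L_right := fun j hj m h => by
      rw [iterate_translate, hL] at h
      exact B.iterate_ctp_notMem hj m ⟨by linarith [h.1], by linarith [h.2]⟩
    orbit_L_near := fun j hj m h => by
      rw [iterate_translate, hL] at h
      refine B.iterate_ctp_notMem hj (m - 1) ?_
      push_cast
      exact ⟨by linarith [h.1], by linarith [h.2]⟩
    repelling := fun x n hn => by
      rintro ⟨m, hm⟩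
      rw [iterate_translate] at hm
      rw [show (fun x => B.F (x + B.ctm) - B.ctm)^[n] = fun x => B.F^[n] (x + B.ctm) - B.ctm from
        funext (B.iterate_translate n), deriv_sub_const, deriv_comp_add_const]
      exact B.hA3 _ n hn ⟨m, by linarith⟩ }, rfl, rfl⟩

lemma iterate_coe (n : ℕ) (x : ℝ) : B.f^[n] (x : UnitAddCircle) = (B.F^[n] x : ℝ) := by
  induction n generalizing x with
  | zero => rfl
  | succ n ih => rw [Function.iterate_succ_apply, Function.iterate_succ_apply, B.hf, ih]

lemma continuous_f : Continuous B.f := by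
  refine (QuotientAddGroup.isQuotientMap_mk
    (N := AddSubgroup.zmultiples (1 : ℝ))).continuous_iff.2 ?_
  have : Continuous fun x : ℝ => ((B.F x : ℝ) : UnitAddCircle) :=
    (AddCircle.continuous_mk' 1).comp B.hC2.continuous
  exact this.congr fun x => (B.hf x).symm

lemma coe_mem_II {x : ℝ} (m : ℤ) (hx : x - m ∈ Icc B.ctp B.ctm) : (x : UnitAddCircle) ∈ B.II := by
  refine ⟨x - m, hx, ?_⟩
  have : ((x - m : ℝ) : UnitAddCircle) = (x : UnitAddCircle) - ((m : ℝ) : UnitAddCircle) :=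
    AddCircle.coe_sub 1 x m
  simp [this]

lemma measurableSet_never_enters :
    MeasurableSet {x : UnitAddCircle | ∀ n : ℕ, 1 ≤ n → B.f^[n] x ∉ B.II} := by
  have hII : IsClosed B.II := (isCompact_Icc.image (AddCircle.continuous_mk' 1)).isClosed
  have : {x : UnitAddCircle | ∀ n : ℕ, 1 ≤ n → B.f^[n] x ∉ B.II} =
      ⋂ n : ℕ, ⋂ _ : 1 ≤ n, (B.f^[n] ⁻¹' B.II)ᶜ := by
    ext; simp
  rw [this]
  exact MeasurableSet.iInter fun n => MeasurableSet.iInter fun _ =>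
    ((hII.preimage (B.continuous_f.iterate n)).measurableSet).compl

lemma map_sub_mem_staying {T : GapLift} (hTF : T.F = fun x => B.F (x + B.ctm) - B.ctm)
    (hTL : T.L = B.ctp + 1 - B.ctm) {x : ℝ}
    (hx : ∀ n : ℕ, 1 ≤ n → B.f^[n] (x : UnitAddCircle) ∉ B.II) :
    B.F x - B.ctm ∈ T.staying := by
  intro n
  have h := hx (n + 1) (by omega)
  rw [B.iterate_coe, Function.iterate_succ_apply] at h
  rw [hTF, iterate_translate, sub_add_cancel, hTL]
  set z := B.F^[n] (B.F x)
  have h1 := Int.fract_nonneg (z - B.ctm)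
  have h2 := Int.fract_lt_one (z - B.ctm)
  have h3 : z = ⌊z - B.ctm⌋ + Int.fract (z - B.ctm) + B.ctm := by
    rw [Int.floor_add_fract]; ring
  refine ⟨lt_of_le_of_ne h1 fun h0 => h (B.coe_mem_II ⌊z - B.ctm⌋ ?_), ?_⟩
  · exact ⟨by linarith [B.h1], by linarith⟩
  · by_contra! h4
    refine h (B.coe_mem_II (⌊z - B.ctm⌋ + 1) ?_)
    push_cast
    exact ⟨by linarith, by linarith⟩

end BimodData

/-- For every `f ∈ Bimod`, Lebesgue-almost every point of `𝕋¹` enters `𝕀` under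
iteration. -/
theorem ae_enters_II (B : BimodData) :
    volume {x : UnitAddCircle | ∀ n : ℕ, 1 ≤ n → B.f^[n] x ∉ B.II} = 0 := by
  obtain ⟨T, hTF, hTL⟩ := B.exists_gapLift
  have hS : volume ((fun y => y - B.ctm) ⁻¹' T.staying) = 0 :=
    (measurePreserving_sub_right volume B.ctm).quasiMeasurePreserving.preimage_null
      T.volume_staying
  have hd : Differentiable ℝ B.F := B.hC2.differentiable two_ne_zero
  have hanti : StrictAntiOn B.F (Ioo B.ctp B.ctm) :=
    strictAntiOn_of_deriv_neg (convex_Ioo _ _) hd.continuous.continuousOn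
      (by simpa only [interior_Ioo] using B.hdecr)
  have hmono : StrictMonoOn B.F (Ioo B.ctm (B.ctp + 1)) :=
    strictMonoOn_of_deriv_pos (convex_Ioo _ _) hd.continuous.continuousOn
      (by simpa only [interior_Ioo] using B.hincr)
  have hmp := UnitAddCircle.measurePreserving_mk B.ctp
  rw [← hmp.measure_preimage B.measurableSet_never_enters.nullMeasurableSet,
    Measure.restrict_apply (hmp.measurable B.measurableSet_never_enters)]
  refine measure_mono_null ?_ (measure_union_null
    (volume_inter_preimage_eq_zero measurableSet_Ioo hd hanti.injOn
      (fun x hx => (B.hdecr x hx).ne) hS)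
    (measure_union_null (volume_inter_preimage_eq_zero measurableSet_Ioo hd hmono.injOn
      (fun x hx => (B.hincr x hx).ne') hS)
      ((toFinite {B.ctm, B.ctp + 1}).measure_zero volume)))
  rintro x ⟨hx, hx1, hx2⟩
  have hst := B.map_sub_mem_staying hTF hTL hx
  rcases lt_trichotomy x B.ctm with h | h | h
  · exact Or.inl ⟨⟨hx1, h⟩, hst⟩
  · exact Or.inr (Or.inr (Or.inl h))
  · rcases hx2.lt_or_eq with h' | h'
    · exact Or.inr (Or.inl ⟨⟨h, h'⟩, hst⟩)
    · exact Or.inr (Or.inr (Or.inr h'))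
end
end
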